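/- Fix σ > 0. There exist C > 0 and μ₀ > 0 such that for all μ ≥ μ₀: N_D(μ − C·μ^{−3/7}) − C·μ^{4/7} ≤ N_σ(μ²) ≤ N_D(μ + C·μ^{−3/7}) + C·μ^{4/7}, where N_σ(μ²) := #{(n,t) ∈ ℤ×ℝ : 0 < t ≤ μ and φ_{|n|,σ}(t) = 0} is the Robin eigenvalue counting function of the unit disk, and N_D(μ) := #{(n,k) ∈ ℤ×ℤ : k ≥ 1 and (n, k + max(0,−n) − 3/4) ∈ μD} is the shifted lattice point count in the dilated domain μD. -/

import Mathlib

open Real MeasureTheory Pointwise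

/-- The Bessel function of integer order `n`: `J_n(x) = (1/π)∫₀^π cos(x sin t − n t) dt`. -/
noncomputable def besselJ (n : ℕ) (x : ℝ) : ℝ :=
  (1 / π) * ∫ t in (0:ℝ)..π, Real.cos (x * Real.sin t - n * t)

/-- The derivative `J_n′` of the Bessel function. -/
noncomputable def besselJ' (n : ℕ) (x : ℝ) : ℝ := deriv (besselJ n) x

/-- `φ_{n,σ}(x) = x·J_n′(x) + σ·J_n(x)`. -/
noncomputable def phiRobin (σ : ℝ) (n : ℕ) (x : ℝ) : ℝ :=
  x * besselJ' n x + σ * besselJ n x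

/-- `g(x) = (1/π)(√(1−x²) − x·arccos x)`. -/
noncomputable def gfun (x : ℝ) : ℝ :=
  (1 / π) * (Real.sqrt (1 - x ^ 2) - x * Real.arccos x)

/-- The cusped domain `D = {(x,y) : −1 ≤ x ≤ 1, max(0,−x) ≤ y ≤ g(x)}`. -/
def domD : Set (ℝ × ℝ) :=
  {p | -1 ≤ p.1 ∧ p.1 ≤ 1 ∧ max 0 (-p.1) ≤ p.2 ∧ p.2 ≤ gfun p.1}

/-- The shifted lattice point count
`N_D(μ) = #{(n,k) ∈ ℤ×ℤ : k ≥ 1, (n, k + max(0,−n) − 3/4) ∈ μD}`. -/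
noncomputable def latticeCountD (μ : ℝ) : ℕ :=
  ({p : ℤ × ℤ | 1 ≤ p.2 ∧
    ((p.1 : ℝ), (p.2 : ℝ) + max 0 (-(p.1 : ℝ)) - 3/4) ∈ μ • domD}).ncard

/-- The Robin eigenvalue counting function of the unit disk:
`N_σ(μ²) = #{(n,t) ∈ ℤ×ℝ : 0 < t ≤ μ, φ_{|n|,σ}(t) = 0}`. -/
noncomputable def diskRobinCountMu (σ μ : ℝ) : ℕ :=
  ({q : ℤ × ℝ | 0 < q.2 ∧ q.2 ≤ μ ∧ phiRobin σ q.1.natAbs q.2 = 0}).ncard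


lemma bj_hasDerivAt_aux (n : ℕ) (x : ℝ) : HasDerivAt (besselJ n)
    (-((1 / π) * ∫ t in (0:ℝ)..π, Real.sin (x * Real.sin t - n * t) * Real.sin t)) x := by
  have h := (intervalIntegral.hasDerivAt_integral_of_dominated_loc_of_deriv_le
    (μ := volume) (a := 0) (b := π) (x₀ := x) (s := Set.univ) (bound := fun _ => 1)
    (F := fun y t => Real.cos (y * Real.sin t - n * t))
    (F' := fun y t => -(Real.sin (y * Real.sin t - n * t) * Real.sin t))
    Filter.univ_mem
    (Filter.Eventually.of_forall fun y => by
      apply Continuous.aestronglyMeasurable; fun_prop)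
    (by apply Continuous.intervalIntegrable; fun_prop)
    (by apply Continuous.aestronglyMeasurable; fun_prop)
    (Filter.Eventually.of_forall fun t _ y _ => by
      rw [norm_neg, norm_mul]
      have h1 := Real.abs_sin_le_one (y * Real.sin t - n * t)
      have h2 := Real.abs_sin_le_one t
      simpa using mul_le_mul h1 h2 (abs_nonneg _) zero_le_one)
    (by simp)
    (Filter.Eventually.of_forall fun t _ y _ => by
      have := ((hasDerivAt_id y).mul_const (Real.sin t)).sub_const ((n:ℝ) * t) |>.cos
      simpa using this)).2
  have h2 := h.const_mul (1 / π)
  rw [intervalIntegral.integral_neg, mul_neg] at h2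
  exact h2

lemma bj_cos_int (n : ℕ) (x : ℝ) :
    x * (∫ t in (0:ℝ)..π, Real.cos (x * Real.sin t - n * t) * Real.cos t)
      = n * ∫ t in (0:ℝ)..π, Real.cos (x * Real.sin t - n * t) := by
  have h : ∫ t in (0:ℝ)..π, Real.cos (x * Real.sin t - n * t) * (x * Real.cos t - n) = 0 := by
    rw [intervalIntegral.integral_eq_sub_of_hasDerivAt
      (f := fun t => Real.sin (x * Real.sin t - n * t))]
    · simp
    · intro t _
      have := (((Real.hasDerivAt_sin t).const_mul x).sub ((hasDerivAt_id t).const_mul (n:ℝ))).sin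
      simpa using this
    · apply Continuous.intervalIntegrable; fun_prop
  have e : (fun t => Real.cos (x * Real.sin t - n * t) * (x * Real.cos t - n)) =
     fun t => x * (Real.cos (x * Real.sin t - n * t) * Real.cos t)
       - n * Real.cos (x * Real.sin t - n * t) := by
    funext t; ring
  rw [e, intervalIntegral.integral_sub, intervalIntegral.integral_const_mul,
    intervalIntegral.integral_const_mul] at h
  · linarith
  · apply Continuous.intervalIntegrable; fun_prop
  · apply Continuous.intervalIntegrable; fun_prop

lemma bj_succ (n : ℕ) (x : ℝ) : besselJ (n+1) x =
    (1/π) * (∫ t in (0:ℝ)..π, Real.cos (x * Real.sin t - n * t) * Real.cos t)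
    + (1/π) * (∫ t in (0:ℝ)..π, Real.sin (x * Real.sin t - n * t) * Real.sin t) := by
  rw [besselJ, ← mul_add, ← intervalIntegral.integral_add]
  · congr 1
    apply intervalIntegral.integral_congr
    intro t _
    have : x * Real.sin t - ((n+1 : ℕ):ℝ) * t = (x * Real.sin t - n * t) - t := by push_cast; ring
    simp only [this, Real.cos_sub]
  · apply Continuous.intervalIntegrable; fun_prop
  · apply Continuous.intervalIntegrable; fun_prop

lemma bj_pred (n : ℕ) (x : ℝ) : besselJ n x =
    (1/π) * (∫ t in (0:ℝ)..π, Real.cos (x * Real.sin t - (n+1:ℕ) * t) * Real.cos t)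
    - (1/π) * (∫ t in (0:ℝ)..π, Real.sin (x * Real.sin t - (n+1:ℕ) * t) * Real.sin t) := by
  rw [besselJ, ← mul_sub, ← intervalIntegral.integral_sub]
  · congr 1
    apply intervalIntegral.integral_congr
    intro t _
    have : x * Real.sin t - (n:ℝ) * t = (x * Real.sin t - ((n+1 : ℕ):ℝ) * t) + t := by
      push_cast; ring
    simp only [this, Real.cos_add]
  · apply Continuous.intervalIntegrable; fun_prop
  · apply Continuous.intervalIntegrable; fun_prop

lemma bj_differentiable (n : ℕ) : Differentiable ℝ (besselJ n) :=
  fun x => (bj_hasDerivAt_aux n x).differentiableAt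

lemma bj_continuous (n : ℕ) : Continuous (besselJ n) := (bj_differentiable n).continuous

lemma bj'_hasDerivAt (n : ℕ) (x : ℝ) : HasDerivAt (besselJ n) (besselJ' n x) x :=
  (bj_differentiable n x).hasDerivAt

/-- `x J_n' = n J_n - x J_{n+1}` -/
lemma bj_rec1 (n : ℕ) (x : ℝ) :
    x * besselJ' n x = n * besselJ n x - x * besselJ (n+1) x := by
  have h1 := (bj_hasDerivAt_aux n x).deriv
  have h2 := bj_cos_int n x
  have h3 := bj_succ n x
  rw [besselJ', h1, h3]
  unfold besselJ
  linear_combination (1/π) * h2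

/-- `x J_{n+1}' = x J_n - (n+1) J_{n+1}` -/
lemma bj_rec2 (n : ℕ) (x : ℝ) :
    x * besselJ' (n+1) x = x * besselJ n x - (n+1) * besselJ (n+1) x := by
  have h1 := (bj_hasDerivAt_aux (n+1) x).deriv
  have h2 := bj_cos_int (n+1) x
  have h3 := bj_pred n x
  rw [besselJ', h1, h3]
  unfold besselJ
  push_cast at h2 ⊢
  linear_combination (-1/π) * h2

lemma bj_rec3 (n : ℕ) (x : ℝ) (hx : x ≠ 0) :
    besselJ (n+2) x = 2 * (n+1) / x * besselJ (n+1) x - besselJ n x := by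
  have h1 := bj_rec1 (n+1) x
  have h2 := bj_rec2 n x
  field_simp
  push_cast at h1
  linear_combination h1 - h2

lemma bj_zero_deriv (x : ℝ) : besselJ' 0 x = - besselJ 1 x := by
  have h1 := (bj_hasDerivAt_aux 0 x).deriv
  have h2 := bj_cos_int 0 x
  have h3 := bj_succ 0 x
  by_cases hx : x = 0
  · subst hx
    rw [besselJ', h1, h3]
    simp
  · have := bj_rec1 0 x
    simp at this
    have h : x * (besselJ' 0 x + besselJ 1 x) = 0 := by linear_combination this
    rcases mul_eq_zero.1 h with h | h
    · exact absurd h hx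
    · linarith

/-- `v_n = x J_n'` -/
noncomputable def bv (n : ℕ) (x : ℝ) : ℝ := n * besselJ n x - x * besselJ (n+1) x

lemma bv_eq (n : ℕ) (x : ℝ) : bv n x = x * besselJ' n x := (bj_rec1 n x).symm

lemma bj_hasDerivAt (n : ℕ) {x : ℝ} (hx : x ≠ 0) : HasDerivAt (besselJ n) (bv n x / x) x := by
  rw [bv_eq, mul_div_cancel_left₀ _ hx]
  exact bj'_hasDerivAt n x

lemma bv_hasDerivAt (n : ℕ) {x : ℝ} (hx : x ≠ 0) :
    HasDerivAt (bv n) (-((x^2 - n^2) / x) * besselJ n x) x := by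
  have h := ((bj'_hasDerivAt n x).const_mul (n:ℝ)).sub
    ((hasDerivAt_id x).mul (bj'_hasDerivAt (n+1) x))
  have h1 := bj_rec1 n x
  have h2 := bj_rec2 n x
  refine HasDerivAt.congr_deriv (f := bv n) h ?_
  simp only [id]
  field_simp
  linear_combination (n:ℝ) * h1 - x * h2

lemma bv_continuous (n : ℕ) : Continuous (bv n) := by
  unfold bv
  have := bj_continuous n
  have := bj_continuous (n+1)
  fun_prop

lemma phi_eq (σ : ℝ) (n : ℕ) (x : ℝ) : phiRobin σ n x = bv n x + σ * besselJ n x := by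
  rw [phiRobin, bv_eq]

lemma phi_hasDerivAt (σ : ℝ) (n : ℕ) {x : ℝ} (hx : x ≠ 0) :
    HasDerivAt (phiRobin σ n) (-((x^2 - n^2) / x) * besselJ n x + σ * (bv n x / x)) x := by
  have : phiRobin σ n = fun x => bv n x + σ * besselJ n x := by funext x; exact phi_eq σ n x
  rw [this]
  exact (bv_hasDerivAt n hx).add ((bj_hasDerivAt n hx).const_mul σ)


lemma bj0_pos {x : ℝ} (hx : 0 ≤ x) (hx2 : x < π/2) : 0 < besselJ 0 x := by
  unfold besselJ
  apply mul_pos (by positivity)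
  apply intervalIntegral.intervalIntegral_pos_of_pos_on
  · apply Continuous.intervalIntegrable; fun_prop
  · intro t ht
    have h1 := Real.sin_le_one t
    have h0 := Real.sin_nonneg_of_nonneg_of_le_pi ht.1.le ht.2.le
    apply Real.cos_pos_of_mem_Ioo
    constructor
    · have : 0 ≤ x * Real.sin t := by positivity
      simp; linarith [Real.pi_pos]
    · simp; nlinarith
  · exact Real.pi_pos

lemma bj_pos_small (n : ℕ) : ∀ {x : ℝ}, 0 < x → x < π/2 → 0 < besselJ n x := by
  induction n with
  | zero => intro x h1 h2; exact bj0_pos h1.le h2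
  | succ n ih =>
    intro x h1 h2
    have hd : ∀ y : ℝ, HasDerivAt (fun y => y^(n+1) * besselJ (n+1) y) (y^(n+1) * besselJ n y) y := by
      intro y
      refine HasDerivAt.congr_deriv ((hasDerivAt_pow (n+1) y).mul (bj'_hasDerivAt (n+1) y)) ?_
      have := bj_rec2 n y
      push_cast
      linear_combination y^n * this
    have hm : StrictMonoOn (fun y => y^(n+1) * besselJ (n+1) y) (Set.Icc 0 x) := by
      apply strictMonoOn_of_deriv_pos (convex_Icc 0 x)
      · exact fun y _ => (hd y).continuousAt.continuousWithinAt
      · intro y hy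
        rw [interior_Icc] at hy
        rw [(hd y).deriv]
        exact mul_pos (pow_pos hy.1 _) (ih hy.1 (hy.2.trans h2))
    have := hm (Set.left_mem_Icc.2 h1.le) (Set.right_mem_Icc.2 h1.le) h1
    simp only [ne_eq, Nat.add_eq_zero_iff, one_ne_zero, and_false, not_false_eq_true, zero_pow, zero_mul] at this
    exact (pos_iff_pos_of_mul_pos this).1 (pow_pos h1 _)

lemma bjv_mono (n : ℕ) : MonotoneOn (fun y => besselJ n y * bv n y) (Set.Icc 0 n) := by
  apply monotoneOn_of_deriv_nonneg (convex_Icc _ _)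
  · exact ((bj_continuous n).mul (bv_continuous n)).continuousOn
  · intro y hy
    rw [interior_Icc] at hy
    exact ((bj_hasDerivAt n hy.1.ne').mul (bv_hasDerivAt n hy.1.ne')).differentiableAt.differentiableWithinAt
  · intro y hy
    rw [interior_Icc] at hy
    have := ((bj_hasDerivAt n hy.1.ne').mul (bv_hasDerivAt n hy.1.ne')).deriv
    have e : deriv (fun y => besselJ n y * bv n y) y = bv n y / y * bv n y + besselJ n y * (-((y ^ 2 - n ^ 2) / y) * besselJ n y) := this
    rw [e]
    have h3 : bv n y / y * bv n y + besselJ n y * (-((y ^ 2 - n ^ 2) / y) * besselJ n y) 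
      = (bv n y ^2 + (n^2-y^2) * besselJ n y ^2)/y := by
      field_simp; ring
    rw [h3]
    have := hy.1
    have : y^2 ≤ (n:ℝ)^2 := pow_le_pow_left₀ hy.1.le hy.2.le 2
    have : 0 ≤ (n:ℝ)^2 - y^2 := by linarith
    positivity

lemma bv_zero_mul (n : ℕ) : besselJ n 0 * bv n 0 = 0 := by
  rw [bv_eq]; simp

lemma bjv_nonneg (n : ℕ) {x : ℝ} (h0 : 0 ≤ x) (hx : x ≤ n) : 0 ≤ besselJ n x * bv n x := by
  have := bjv_mono n (Set.left_mem_Icc.2 (h0.trans hx)) ⟨h0, hx⟩ h0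
  simpa [bv_zero_mul] using this

lemma bj_sq_mono (n : ℕ) : MonotoneOn (fun y => besselJ n y ^ 2) (Set.Icc 0 n) := by
  apply monotoneOn_of_deriv_nonneg (convex_Icc _ _)
  · exact ((bj_continuous n).pow 2).continuousOn
  · intro y hy
    exact ((bj_differentiable n).pow 2 y).differentiableWithinAt
  · intro y hy
    rw [interior_Icc] at hy
    have e : deriv (fun y => besselJ n y ^ 2) y = _ := ((bj_hasDerivAt n hy.1.ne').pow 2).deriv
    rw [e]
    have := bjv_nonneg n hy.1.le hy.2.le
    have h1 := hy.1
    have : (2:ℕ) * besselJ n y ^ (2-1) * (bv n y / y) = 2 * (besselJ n y * bv n y) / y := by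
      push_cast; simp; ring
    rw [this]
    positivity

lemma bj_pos (n : ℕ) {x : ℝ} (h0 : 0 < x) (hx : x ≤ n) : 0 < besselJ n x := by
  have hne : ∀ y ∈ Set.Icc (min x 1) x, besselJ n y ≠ 0 := by
    intro y hy h
    have hm : 0 < min x 1 := lt_min h0 one_pos
    have h1 := bj_pos_small n hm (lt_of_le_of_lt (min_le_right _ _) (by linarith [Real.pi_gt_three]))
    have h2 := bj_sq_mono n ⟨hm.le, (min_le_left _ _).trans hx⟩ ⟨hm.le.trans hy.1, hy.2.trans hx⟩ hy.1
    simp only [h] at h2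
    nlinarith
  have hm : 0 < min x 1 := lt_min h0 one_pos
  have h1 := bj_pos_small n hm (lt_of_le_of_lt (min_le_right _ _) (by linarith [Real.pi_gt_three]))
  by_contra hcon
  push Not at hcon
  obtain ⟨y, hy, hy2⟩ := intermediate_value_Icc' (min_le_left x 1) (bj_continuous n).continuousOn ⟨hcon, h1.le⟩
  exact hne y hy hy2

lemma bv_nonneg (n : ℕ) {x : ℝ} (h0 : 0 < x) (hx : x ≤ n) : 0 ≤ bv n x := by
  have h1 := bj_pos n h0 hx
  have h2 := bjv_nonneg n h0.le hx
  exact nonneg_of_mul_nonneg_right h2 h1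

lemma phi_pos {σ : ℝ} (hσ : 0 < σ) (n : ℕ) {x : ℝ} (h0 : 0 < x) (hx : x ≤ n) :
    0 < phiRobin σ n x := by
  rw [phi_eq]
  have := bj_pos n h0 hx
  have := bv_nonneg n h0 hx
  positivity

lemma bj_not_both (n : ℕ) {x : ℝ} (h0 : 0 < x) : ¬ (besselJ n x = 0 ∧ besselJ (n+1) x = 0) := by
  rintro ⟨h1, h2⟩
  have : ∀ m, besselJ (n+m) x = 0 ∧ besselJ (n+m+1) x = 0 := by
    intro m
    induction m with
    | zero => exact ⟨h1, h2⟩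
    | succ m ih =>
      refine ⟨ih.2, ?_⟩
      rw [show n + (m+1) + 1 = (n+m)+2 by ring, bj_rec3 _ _ h0.ne', ih.1, ih.2]; ring
  obtain ⟨m, hm⟩ := exists_nat_ge x
  have h3 := (this m).1
  have := bj_pos (n+m) h0 (by push_cast; linarith [(Nat.cast_nonneg n : (0:ℝ) ≤ n)])
  linarith

lemma phi_bj_not_both (σ : ℝ) (n : ℕ) {x : ℝ} (h0 : 0 < x) :
    ¬ (phiRobin σ n x = 0 ∧ besselJ n x = 0) := by
  rintro ⟨h1, h2⟩
  rw [phi_eq, h2, bv, h2] at h1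
  have : besselJ (n+1) x = 0 := by
    have : x * besselJ (n+1) x = 0 := by linarith
    simpa [h0.ne'] using this
  exact bj_not_both n h0 ⟨h2, this⟩

/-- for `n = 0`, `φ` is positive near zero -/
lemma phi_pos_near {σ : ℝ} (hσ : 0 < σ) (n : ℕ) : ∃ a, 0 < a ∧ a < π/2 ∧ ∀ x, 0 < x → x ≤ a → 0 < phiRobin σ n x := by
  rcases Nat.eq_zero_or_pos n with rfl | hn
  · have hc : Continuous (phiRobin σ 0) := by
      have : phiRobin σ 0 = fun x => bv 0 x + σ * besselJ 0 x := by funext x; exact phi_eq σ 0 x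
      rw [this]
      exact (bv_continuous 0).add ((bj_continuous 0).const_mul σ)
    have h0 : 0 < phiRobin σ 0 0 := by
      rw [phi_eq, bv]; simp; exact mul_pos hσ (bj0_pos le_rfl (by positivity))
    have := hc.continuousAt.eventually (lt_mem_nhds h0)
    obtain ⟨ε, hε, h⟩ := Metric.eventually_nhds_iff.1 this
    refine ⟨min (ε/2) 1, by positivity, lt_of_le_of_lt (min_le_right _ _) (by linarith [Real.pi_gt_three]), fun x h1 h2 => h ?_⟩
    rw [Real.dist_eq, sub_zero, abs_of_pos h1]
    linarith [min_le_left (ε/2) 1]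
  · refine ⟨1, one_pos, by linarith [Real.pi_gt_three], fun x h1 h2 => phi_pos hσ n h1 ?_⟩
    have : (1:ℝ) ≤ n := by exact_mod_cast hn
    linarith


open Filter Topology in
lemma cross_stay (Ψ : ℝ → ℝ) (a L : ℝ) (hc : ContinuousOn Ψ (Set.Ici a))
    (hr : ∀ t, a ≤ t → Ψ t = L → ∀ᶠ s in 𝓝[>] t, L < Ψ s)
    (hl : ∀ t, a < t → Ψ t = L → ∀ᶠ s in 𝓝[<] t, Ψ s < L)
    (t s : ℝ) (hat : a ≤ t) (hts : t < s) (ht : L ≤ Ψ t) : L < Ψ s := by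
  by_contra hcon
  push Not at hcon
  obtain ⟨t1, h1, h2, h3⟩ : ∃ t1, t ≤ t1 ∧ t1 < s ∧ L < Ψ t1 := by
    rcases ht.lt_or_eq with h | h
    · exact ⟨t, le_rfl, hts, h⟩
    · have := (hr t hat h.symm).and (Ioo_mem_nhdsGT hts)
      obtain ⟨r, hr1, hr2⟩ := this.exists
      exact ⟨r, hr2.1.le, hr2.2, hr1⟩
  have hcl : IsCompact (Set.Icc t1 s ∩ Ψ ⁻¹' Set.Iic L) := by
    have : IsClosed (Set.Icc t1 s ∩ Ψ ⁻¹' Set.Iic L) :=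
      (hc.mono (fun y hy => (hat.trans h1).trans hy.1)).preimage_isClosed_of_isClosed isClosed_Icc isClosed_Iic
    exact isCompact_Icc.of_isClosed_subset this Set.inter_subset_left
  obtain ⟨r0, hr0, hmin⟩ := hcl.exists_isLeast ⟨s, ⟨h2.le, le_rfl⟩, hcon⟩
  have hlt : t1 < r0 := by
    rcases hr0.1.1.lt_or_eq with h | h
    · exact h
    · have := hr0.2; rw [← h] at this; exact absurd h3 (not_lt.2 this)
  have hbefore : ∀ y, t1 ≤ y → y < r0 → L < Ψ y := by
    intro y hy1 hy2
    by_contra hy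
    push Not at hy
    exact absurd (hmin ⟨⟨hy1, hy2.le.trans hr0.1.2⟩, hy⟩) (not_le.2 hy2)
  have hcr : ContinuousAt Ψ r0 := hc.continuousAt (Ici_mem_nhds (by linarith))
  have hge : L ≤ Ψ r0 := by
    have h4 : Tendsto Ψ (𝓝[<] r0) (𝓝 (Ψ r0)) := hcr.tendsto.mono_left nhdsWithin_le_nhds
    apply ge_of_tendsto h4
    filter_upwards [Ioo_mem_nhdsLT hlt] with y hy
    exact (hbefore y hy.1.le hy.2).le
  have heq : Ψ r0 = L := le_antisymm hr0.2 hge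
  have := (hl r0 (by linarith) heq).and (Ioo_mem_nhdsLT hlt)
  obtain ⟨y, hy1, hy2⟩ := this.exists
  exact absurd (hbefore y hy2.1.le hy2.2) (not_lt.2 hy1.le)

open Filter Topology in
lemma cross_count (Ψ : ℝ → ℝ) (a x : ℝ) (hax : a ≤ x) (hc : ContinuousOn Ψ (Set.Ici a))
    (hr : ∀ t, a ≤ t → ∀ k : ℤ, Ψ t = k * π → ∀ᶠ s in 𝓝[>] t, k * π < Ψ s)
    (hl : ∀ t, a < t → ∀ k : ℤ, Ψ t = k * π → ∀ᶠ s in 𝓝[<] t, Ψ s < k * π) :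
    {t | a < t ∧ t ≤ x ∧ ∃ k : ℤ, Ψ t = k * π}.Finite ∧
    (({t | a < t ∧ t ≤ x ∧ ∃ k : ℤ, Ψ t = k * π}.ncard : ℕ) : ℤ) = ⌊Ψ x / π⌋ - ⌊Ψ a / π⌋ := by
  have hst : ∀ k : ℤ, ∀ t s, a ≤ t → t < s → k * π ≤ Ψ t → k * π < Ψ s := fun k t s h1 h2 h3 =>
    cross_stay Ψ a (k*π) hc (fun t h => hr t h k) (fun t h => hl t h k) t s h1 h2 h3
  have hπ := Real.pi_pos
  set T := {t | a < t ∧ t ≤ x ∧ ∃ k : ℤ, Ψ t = k * π} with hT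
  have hfl : ∀ t, ∀ k : ℤ, Ψ t = k * π → ⌊Ψ t / π⌋ = k := by
    intro t k h; rw [h, mul_div_cancel_right₀ _ hπ.ne']; simp
  have hinj : Set.InjOn (fun t => ⌊Ψ t / π⌋) T := by
    rintro t ⟨h1, h2, k, h3⟩ s ⟨h4, h5, l, h6⟩ h
    simp only [hfl t k h3, hfl s l h6] at h
    subst h
    rcases lt_trichotomy t s with h | h | h
    · have := hst k t s h1.le h h3.ge; linarith
    · exact h
    · have := hst k s t h4.le h h6.ge; linarith
  have himg : (fun t => ⌊Ψ t / π⌋) '' T = ↑(Finset.Ioc ⌊Ψ a / π⌋ ⌊Ψ x / π⌋) := by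
    ext k
    simp only [Set.mem_image, Finset.coe_Ioc, Set.mem_Ioc]
    rw [Int.floor_lt, Int.le_floor, div_lt_iff₀ hπ, le_div_iff₀ hπ]
    constructor
    · rintro ⟨t, ⟨h1, h2, l, h3⟩, h⟩
      rw [hfl t l h3] at h; subst h
      constructor
      · by_contra hcon
        push Not at hcon
        have := hst l a t le_rfl h1 hcon; linarith
      · rcases h2.lt_or_eq with h | h
        · exact (hst l t x h1.le h h3.ge).le
        · rw [← h, h3]
    · rintro ⟨h1, h2⟩
      obtain ⟨t, ht, ht2⟩ := intermediate_value_Icc hax (hc.mono (fun y hy => hy.1)) ⟨h1.le, h2⟩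
      refine ⟨t, ⟨?_, ht.2, k, ht2⟩, hfl t k ht2⟩
      rcases ht.1.lt_or_eq with h | h
      · exact h
      · rw [← h] at ht2; linarith
  constructor
  · apply Set.Finite.of_finite_image _ hinj
    rw [himg]; exact Finset.finite_toSet _
  · rw [← Set.ncard_image_of_injOn hinj, himg, Set.ncard_coe_finset, Int.card_Ioc]
    have : ⌊Ψ a / π⌋ ≤ ⌊Ψ x / π⌋ := by
      rcases hax.lt_or_eq with h | h
      · have h1 : (⌊Ψ a / π⌋ : ℝ) * π ≤ Ψ a := by
          rw [← le_div_iff₀ hπ]; exact Int.floor_le _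
        have := hst _ a x le_rfl h h1
        rw [Int.le_floor, le_div_iff₀ hπ]; exact this.le
      · rw [h]
    omega

lemma sin_sub_int_pi (y : ℝ) (k : ℤ) : Real.sin (y - k * π) = Real.cos (k * π) * Real.sin y := by
  rw [Real.sin_sub, Real.sin_int_mul_pi]; ring

open Filter Topology in
lemma cross_count2 (f g g' r1 r2 Ψ : ℝ → ℝ) (a x : ℝ) (hax : a ≤ x) (hc : ContinuousOn Ψ (Set.Ici a))
    (hr1 : ∀ t, a ≤ t → 0 < r1 t) (hr2 : ∀ t, a < t → 0 < r2 t)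
    (hr2a : 0 < r2 a)
    (hf : ∀ t, a ≤ t → f t = r1 t * Real.cos (Ψ t)) (hg : ∀ t, a ≤ t → g t = r2 t * Real.sin (Ψ t))
    (hd : ∀ t, a ≤ t → HasDerivAt g (g' t) t) (hgt : ∀ t, a ≤ t → g t = 0 → 0 < g' t * f t) :
    {t | a < t ∧ t ≤ x ∧ g t = 0}.Finite ∧
    (({t | a < t ∧ t ≤ x ∧ g t = 0}.ncard : ℕ) : ℤ) = ⌊Ψ x / π⌋ - ⌊Ψ a / π⌋ := by
  have hπ := Real.pi_pos
  have hr2' : ∀ t, a ≤ t → 0 < r2 t := fun t ht => by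
    rcases ht.lt_or_eq with h | h
    · exact hr2 t h
    · rw [← h]; exact hr2a
  have hiff : ∀ t, a ≤ t → (g t = 0 ↔ ∃ k : ℤ, Ψ t = k * π) := by
    intro t ht
    rw [hg t ht, mul_eq_zero, or_iff_right (hr2' t ht).ne', Real.sin_eq_zero_iff]
    exact ⟨fun ⟨k, h⟩ => ⟨k, h.symm⟩, fun ⟨k, h⟩ => ⟨k, h.symm⟩⟩
  have hset : {t | a < t ∧ t ≤ x ∧ g t = 0} = {t | a < t ∧ t ≤ x ∧ ∃ k : ℤ, Ψ t = k * π} := by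
    ext t
    simp only [Set.mem_setOf_eq]
    constructor
    · rintro ⟨h1, h2, h3⟩; exact ⟨h1, h2, (hiff t h1.le).1 h3⟩
    · rintro ⟨h1, h2, h3⟩; exact ⟨h1, h2, (hiff t h1.le).2 h3⟩
  rw [hset]
  -- key : sign of `cos(kπ) * g`
  have key : ∀ t, a ≤ t → ∀ k : ℤ, Ψ t = k * π → 
      0 < g' t * Real.cos (k * π) ∧ g t = 0 := by
    intro t ht k hk
    have h0 := (hiff t ht).2 ⟨k, hk⟩
    have h1 := hgt t ht h0
    rw [hf t ht, hk] at h1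
    refine ⟨?_, h0⟩
    have h2 := hr1 t ht
    have : 0 < r1 t * (g' t * Real.cos (k * π)) := by linarith
    exact (pos_iff_pos_of_mul_pos this).1 h2
  have slope : ∀ t, a ≤ t → ∀ k : ℤ, Ψ t = k * π →
      ∀ᶠ s in 𝓝[≠] t, 0 < (s - t) * (Real.cos (k*π) * g s) := by
    intro t ht k hk
    obtain ⟨h1, h2⟩ := key t ht k hk
    have h3 := ((hd t ht).const_mul (Real.cos (k*π)))
    rw [hasDerivAt_iff_tendsto_slope] at h3
    have h4 := h3.eventually (lt_mem_nhds (show 0 < Real.cos (k*π) * g' t by linarith))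
    filter_upwards [h4, self_mem_nhdsWithin] with s hs hne
    rw [slope_def_field, h2, mul_zero, sub_zero] at hs
    have hne' : s - t ≠ 0 := sub_ne_zero.2 hne
    have : (s - t) * (Real.cos (k*π) * g s) = (Real.cos (k*π) * g s) / (s - t) * (s-t)^2 := by
      field_simp
    rw [this]
    positivity
  have near : ∀ t, a < t → ∀ k : ℤ, Ψ t = k * π → ∀ᶠ s in 𝓝 t, |Ψ s - k*π| < π := by
    intro t ht k hk
    have := (hc.continuousAt (Ici_mem_nhds ht)).eventually (Metric.ball_mem_nhds (Ψ t) hπ)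
    filter_upwards [this] with s hs
    rw [← hk]; exact hs
  have nearR : ∀ t, a ≤ t → ∀ k : ℤ, Ψ t = k * π → ∀ᶠ s in 𝓝[>] t, |Ψ s - k*π| < π := by
    intro t ht k hk
    have h1 : Tendsto Ψ (𝓝[>] t) (𝓝 (Ψ t)) :=
      (hc t ht).tendsto.mono_left (nhdsWithin_mono _ (fun y hy => ht.trans (le_of_lt hy)))
    filter_upwards [h1.eventually (Metric.ball_mem_nhds (Ψ t) hπ)] with s hs
    rw [← hk]; exact hs
  apply cross_count Ψ a x hax hc
  · intro t ht k hk
    filter_upwards [(slope t ht k hk).filter_mono (nhdsWithin_mono _ (fun y (hy : t < y) => ne_of_gt hy)),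
      nearR t ht k hk, self_mem_nhdsWithin] with s h1 h2 h3
    have h3' : t < s := h3
    have h4 : 0 < Real.cos (k*π) * g s := (pos_iff_pos_of_mul_pos h1).1 (sub_pos.2 h3')
    rw [hg s (by linarith)] at h4
    have h5 : 0 < r2 s * Real.sin (Ψ s - k*π) := by rw [sin_sub_int_pi]; linarith
    have h6 := (pos_iff_pos_of_mul_pos h5).1 (hr2' s (by linarith))
    by_contra hcon
    push Not at hcon
    have := Real.sin_nonpos_of_nonpos_of_neg_pi_le (show Ψ s - k*π ≤ 0 by linarith) (by linarith [(abs_lt.1 h2).1])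
    linarith
  · intro t ht k hk
    filter_upwards [(slope t ht.le k hk).filter_mono (nhdsWithin_mono _ (fun y (hy : y < t) => ne_of_lt hy)),
      (near t ht k hk).filter_mono nhdsWithin_le_nhds, self_mem_nhdsWithin, (Ioo_mem_nhdsLT ht)] with s h1 h2 h3 h7
    have h3' : s < t := h3
    have h4 : Real.cos (k*π) * g s < 0 := by nlinarith
    rw [hg s h7.1.le] at h4
    have h5 : r2 s * Real.sin (Ψ s - k*π) < 0 := by rw [sin_sub_int_pi]; linarith
    have h6 : Real.sin (Ψ s - k*π) < 0 := by
      have := hr2' s h7.1.le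
      by_contra hcon; push Not at hcon; nlinarith
    by_contra hcon
    push Not at hcon
    have := Real.sin_nonneg_of_nonneg_of_le_pi (show 0 ≤ Ψ s - k*π by linarith) (by linarith [(abs_lt.1 h2).2])
    linarith


lemma angle_lift0 (f g f' g' : ℝ → ℝ) (a : ℝ) (ha : 0 < a)
    (hf : ∀ x, 0 < x → HasDerivAt f (f' x) x) (hg : ∀ x, 0 < x → HasDerivAt g (g' x) x)
    (hf' : ContinuousOn f' (Set.Ioi 0)) (hg' : ContinuousOn g' (Set.Ioi 0))
    (hne : ∀ x, 0 < x → ¬ (f x = 0 ∧ g x = 0)) (hfa : 0 < f a) :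
    ∃ ψ r : ℝ → ℝ, ((0 < g a → 0 < ψ a) ∧ |ψ a| < π/2) ∧ (∀ x, 0 < x → 0 < r x) ∧
      (∀ x, 0 < x → f x = r x * Real.cos (ψ x) ∧ g x = r x * Real.sin (ψ x)) ∧
      (∀ x, 0 < x → HasDerivAt ψ ((f x * g' x - g x * f' x) / (f x ^2 + g x ^2)) x) := by
  let ζ : ℝ → ℂ := fun x => f x + g x * Complex.I
  let ζ' : ℝ → ℂ := fun x => f' x + g' x * Complex.I
  have hζ : ∀ x, 0 < x → HasDerivAt ζ (ζ' x) x := fun x hx =>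
    (hf x hx).ofReal_comp.add ((hg x hx).ofReal_comp.mul_const Complex.I)
  have hζ0 : ∀ x, 0 < x → ζ x ≠ 0 := by
    intro x hx h
    apply hne x hx
    have h1 := congrArg Complex.re h
    have h2 := congrArg Complex.im h
    simp [ζ] at h1 h2
    exact ⟨h1, h2⟩
  have hζ'c : ContinuousOn ζ' (Set.Ioi 0) :=
    (Complex.continuous_ofReal.comp_continuousOn hf').add
      ((Complex.continuous_ofReal.comp_continuousOn hg').mul continuousOn_const)
  have hζc : ContinuousOn ζ (Set.Ioi 0) := fun x hx => (hζ x hx).continuousAt.continuousWithinAt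
  have hhc : ContinuousOn (fun x => ζ' x / ζ x) (Set.Ioi 0) := hζ'c.div hζc (fun x hx => hζ0 x hx)
  let L : ℝ → ℂ := fun x => Complex.log (ζ a) + ∫ t in a..x, ζ' t / ζ t
  have hL : ∀ x, 0 < x → HasDerivAt L (ζ' x / ζ x) x := by
    intro x hx
    apply HasDerivAt.const_add
    apply intervalIntegral.integral_hasDerivAt_right
    · apply ContinuousOn.intervalIntegrable
      apply hhc.mono
      intro y hy
      exact lt_of_lt_of_le (lt_min ha hx) hy.1
    · exact hhc.stronglyMeasurableAtFilter isOpen_Ioi x hx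
    · exact hhc.continuousAt (Ioi_mem_nhds hx)
  have hconst : ∀ x, 0 < x → ζ x = Complex.exp (L x) := by
    intro x hx
    have hd : ∀ y, 0 < y → HasDerivAt (fun y => ζ y * Complex.exp (-(L y))) 0 y := by
      intro y hy
      refine ((hζ y hy).mul ((hL y hy).neg.cexp)).congr_deriv ?_
      have := hζ0 y hy
      field_simp
      ring
    have := isOpen_Ioi.is_const_of_deriv_eq_zero (convex_Ioi (0:ℝ)).isPreconnected
      (fun y hy => (hd y hy).differentiableAt.differentiableWithinAt)
      (fun y hy => (hd y hy).deriv) (show x ∈ Set.Ioi 0 from hx) (show a ∈ Set.Ioi 0 from ha)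
    have hLa : L a = Complex.log (ζ a) := by simp [L]
    simp only [hLa, Complex.exp_neg, Complex.exp_log (hζ0 a ha), mul_inv_cancel₀ (hζ0 a ha)] at this
    have he := Complex.exp_ne_zero (L x)
    field_simp at this
    exact this
  refine ⟨fun x => (L x).im, fun x => Real.exp (L x).re, ?_, fun x _ => Real.exp_pos _, ?_, ?_⟩
  · have hLa : L a = Complex.log (ζ a) := by simp [L]
    simp only [hLa, Complex.log_im]
    have him : (ζ a).im = g a := by simp [ζ]
    have hre : (ζ a).re = f a := by simp [ζ]
    constructor
    · intro hga
      have h1 : 0 ≤ Complex.arg (ζ a) := Complex.arg_nonneg_iff.2 (by rw [him]; exact hga.le)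
      rcases h1.lt_or_eq with h | h
      · exact h
      · have := (Complex.arg_eq_zero_iff.1 h.symm).2
        rw [him] at this; linarith
    · have := Complex.abs_arg_lt_pi_div_two_iff.2 (Or.inl (by rw [hre]; exact hfa))
      exact this
  · intro x hx
    have h := hconst x hx
    have h1 := congrArg Complex.re h
    have h2 := congrArg Complex.im h
    rw [Complex.exp_re] at h1
    rw [Complex.exp_im] at h2
    simp [ζ] at h1 h2
    exact ⟨h1, h2⟩
  · intro x hx
    have h := (hL x hx)
    have h2 := (Complex.imCLM.hasFDerivAt (x := L x)).comp_hasDerivAt x h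
    refine HasDerivAt.congr_deriv (f := fun x => (L x).im) h2 ?_
    simp only [Complex.imCLM_apply, ζ, ζ', Complex.div_im]
    simp [Complex.normSq_apply]
    have : f x * f x + g x * g x ≠ 0 := by
      intro h
      apply hne x hx
      constructor <;> nlinarith [sq_nonneg (f x), sq_nonneg (g x)]
    have h3 : f x ^2 + g x ^2 ≠ 0 := by rw [pow_two, pow_two]; exact this
    field_simp

lemma angle_lift (f g f' g' : ℝ → ℝ) (a : ℝ) (ha : 0 < a)
    (hf : ∀ x, 0 < x → HasDerivAt f (f' x) x) (hg : ∀ x, 0 < x → HasDerivAt g (g' x) x)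
    (hf' : ContinuousOn f' (Set.Ioi 0)) (hg' : ContinuousOn g' (Set.Ioi 0))
    (hne : ∀ x, 0 < x → ¬ (f x = 0 ∧ g x = 0)) (hfa : 0 < f a) (hga : 0 < g a) :
    ∃ ψ r : ℝ → ℝ, (0 < ψ a ∧ ψ a < π/2) ∧ (∀ x, 0 < x → 0 < r x) ∧
      (∀ x, 0 < x → f x = r x * Real.cos (ψ x) ∧ g x = r x * Real.sin (ψ x)) ∧
      (∀ x, 0 < x → HasDerivAt ψ ((f x * g' x - g x * f' x) / (f x ^2 + g x ^2)) x) := by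
  obtain ⟨ψ, r, h1, h2, h3⟩ := angle_lift0 f g f' g' a ha hf hg hf' hg' hne hfa
  exact ⟨ψ, r, ⟨h1.1 hga, (abs_lt.1 h1.2).2⟩, h2, h3⟩

lemma interlace (f g f' g' : ℝ → ℝ) (a : ℝ) (ha : 0 < a)
    (hf : ∀ x, 0 < x → HasDerivAt f (f' x) x) (hg : ∀ x, 0 < x → HasDerivAt g (g' x) x)
    (hf' : ContinuousOn f' (Set.Ioi 0)) (hg' : ContinuousOn g' (Set.Ioi 0))
    (hne : ∀ x, 0 < x → ¬ (f x = 0 ∧ g x = 0))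
    (hfa : ∀ x, 0 < x → x ≤ a → 0 < f x) (hga : ∀ x, 0 < x → x ≤ a → 0 < g x)
    (hf0 : ∀ x, 0 < x → f x = 0 → f' x * g x < 0)
    (hg0 : ∀ x, 0 < x → g x = 0 → 0 < g' x * f x) :
    ∃ ψ r : ℝ → ℝ, (0 < ψ a ∧ ψ a < π/2) ∧ (∀ x, 0 < x → 0 < r x) ∧
      (∀ x, 0 < x → f x = r x * Real.cos (ψ x) ∧ g x = r x * Real.sin (ψ x)) ∧
      (∀ x, 0 < x → HasDerivAt ψ ((f x * g' x - g x * f' x) / (f x ^2 + g x ^2)) x) ∧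
      (∀ x, a ≤ x → {t | 0 < t ∧ t ≤ x ∧ f t = 0}.Finite ∧
        (({t | 0 < t ∧ t ≤ x ∧ f t = 0}.ncard : ℕ) : ℤ) = ⌊ψ x / π + 1/2⌋) ∧
      (∀ x, a ≤ x → {t | 0 < t ∧ t ≤ x ∧ g t = 0}.Finite ∧
        (({t | 0 < t ∧ t ≤ x ∧ g t = 0}.ncard : ℕ) : ℤ) = ⌊ψ x / π⌋) := by
  obtain ⟨ψ, r, h1, h2, h3, h4⟩ := angle_lift f g f' g' a ha hf hg hf' hg' hne (hfa a ha le_rfl) (hga a ha le_rfl)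
  have hπ := Real.pi_pos
  refine ⟨ψ, r, h1, h2, h3, h4, ?_, ?_⟩
  · intro x hx
    have hset : {t | 0 < t ∧ t ≤ x ∧ f t = 0} = {t | a < t ∧ t ≤ x ∧ -f t = 0} := by
      ext t
      constructor
      · rintro ⟨h5, h6, h7⟩
        refine ⟨?_, h6, by linarith⟩
        by_contra hcon
        have := hfa t h5 (not_lt.1 hcon); linarith
      · rintro ⟨h5, h6, h7⟩; exact ⟨by linarith, h6, by linarith⟩
    rw [hset]
    have := cross_count2 g (fun t => - f t) (fun t => - f' t) r r (fun t => ψ t - π/2) a x hx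
      (fun t ht => ((h4 t (ha.trans_le ht)).continuousAt.sub continuousAt_const).continuousWithinAt)
      (fun t ht => h2 t (ha.trans_le ht)) (fun t ht => h2 t (ha.trans ht)) (h2 a ha)
      (fun t ht => by rw [Real.cos_sub_pi_div_two]; exact (h3 t (ha.trans_le ht)).2)
      (fun t ht => by rw [Real.sin_sub_pi_div_two, (h3 t (ha.trans_le ht)).1]; ring)
      (fun t ht => (hf t (ha.trans_le ht)).neg)
      (fun t ht h => by have := hf0 t (ha.trans_le ht) (by simpa using h); linarith)
    refine ⟨this.1, this.2.trans ?_⟩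
    have e1 : ⌊(ψ a - π/2)/π⌋ = -1 := by
      rw [Int.floor_eq_iff]
      push_cast
      constructor
      · rw [le_div_iff₀ hπ]; linarith
      · rw [div_lt_iff₀ hπ]; linarith
    have e2 : (ψ x - π/2)/π = (ψ x / π + 1/2) - (1:ℤ) := by push_cast; field_simp; ring
    rw [e1, e2, Int.floor_sub_intCast]
    ring
  · intro x hx
    have hset : {t | 0 < t ∧ t ≤ x ∧ g t = 0} = {t | a < t ∧ t ≤ x ∧ g t = 0} := by
      ext t
      constructor
      · rintro ⟨h5, h6, h7⟩
        refine ⟨?_, h6, by linarith⟩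
        by_contra hcon
        have := hga t h5 (not_lt.1 hcon); linarith
      · rintro ⟨h5, h6, h7⟩; exact ⟨by linarith, h6, by linarith⟩
    rw [hset]
    have := cross_count2 f g g' r r ψ a x hx
      (fun t ht => ((h4 t (ha.trans_le ht)).continuousAt).continuousWithinAt)
      (fun t ht => h2 t (ha.trans_le ht)) (fun t ht => h2 t (ha.trans ht)) (h2 a ha)
      (fun t ht => (h3 t (ha.trans_le ht)).1)
      (fun t ht => (h3 t (ha.trans_le ht)).2)
      (fun t ht => (hg t (ha.trans_le ht)))
      (fun t ht h => hg0 t (ha.trans_le ht) h)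
    refine ⟨this.1, this.2.trans ?_⟩
    have e1 : ⌊(ψ a)/π⌋ = 0 := by
      rw [Int.floor_eq_iff]
      push_cast
      constructor
      · rw [le_div_iff₀ hπ]; linarith
      · rw [div_lt_iff₀ hπ]; linarith
    rw [e1]; ring

lemma floor_half_pos (y : ℝ) (h : 0 < Real.cos (y*π) * Real.sin (y*π)) : ⌊y + 1/2⌋ = ⌊y⌋ := by
  have hπ := Real.pi_pos
  have h0 := Int.floor_le y
  have h1 := Int.lt_floor_add_one y
  rw [Int.floor_eq_iff]
  refine ⟨by linarith, ?_⟩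
  by_contra hcon
  push Not at hcon
  have h2 : 0 < Real.sin (2*(y*π) - (2*⌊y⌋ - 0 : ℤ) * π) := by
    rw [sin_sub_int_pi, Real.sin_two_mul]
    have : Real.cos ((2 * ⌊y⌋ - 0 : ℤ) * π) = 1 := by
      push_cast; rw [show (2 * (⌊y⌋:ℝ) - 0) * π = ⌊y⌋ * (2*π) by ring, Real.cos_int_mul_two_pi]
    rw [this]; linarith
  have h3 := Real.sin_nonneg_of_nonneg_of_le_pi (x := 2*(y*π) - (2*⌊y⌋ - 0 : ℤ) * π - π) (by push_cast; nlinarith) (by push_cast; nlinarith)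
  rw [Real.sin_sub_pi] at h3
  linarith

lemma floor_half_neg (y : ℝ) (h : Real.cos (y*π) * Real.sin (y*π) < 0) : ⌊y + 1/2⌋ = ⌊y⌋ + 1 := by
  have hπ := Real.pi_pos
  have h0 := Int.floor_le y
  have h1 := Int.lt_floor_add_one y
  rw [Int.floor_eq_iff]
  push_cast
  refine ⟨?_, by linarith⟩
  by_contra hcon
  push Not at hcon
  have h2 : Real.sin (2*(y*π) - (2*⌊y⌋ - 0 : ℤ) * π) < 0 := by
    rw [sin_sub_int_pi, Real.sin_two_mul]
    have : Real.cos ((2 * ⌊y⌋ - 0 : ℤ) * π) = 1 := by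
      push_cast; rw [show (2 * (⌊y⌋:ℝ) - 0) * π = ⌊y⌋ * (2*π) by ring, Real.cos_int_mul_two_pi]
    rw [this]; linarith
  have h3 := Real.sin_nonneg_of_nonneg_of_le_pi (x := 2*(y*π) - (2*⌊y⌋ - 0 : ℤ) * π) (by push_cast; nlinarith) (by push_cast; nlinarith)
  linarith

/-- consequence for counts -/
lemma interlace_count (f g f' g' : ℝ → ℝ) (a : ℝ) (ha : 0 < a)
    (hf : ∀ x, 0 < x → HasDerivAt f (f' x) x) (hg : ∀ x, 0 < x → HasDerivAt g (g' x) x)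
    (hf' : ContinuousOn f' (Set.Ioi 0)) (hg' : ContinuousOn g' (Set.Ioi 0))
    (hne : ∀ x, 0 < x → ¬ (f x = 0 ∧ g x = 0))
    (hfa : ∀ x, 0 < x → x ≤ a → 0 < f x) (hga : ∀ x, 0 < x → x ≤ a → 0 < g x)
    (hf0 : ∀ x, 0 < x → f x = 0 → f' x * g x < 0)
    (hg0 : ∀ x, 0 < x → g x = 0 → 0 < g' x * f x) (x : ℝ) (hx : a ≤ x) :
    {t | 0 < t ∧ t ≤ x ∧ f t = 0}.Finite ∧
    (0 < f x * g x → {t | 0 < t ∧ t ≤ x ∧ f t = 0}.ncard = {t | 0 < t ∧ t ≤ x ∧ g t = 0}.ncard) ∧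
    (f x * g x < 0 → {t | 0 < t ∧ t ≤ x ∧ f t = 0}.ncard = {t | 0 < t ∧ t ≤ x ∧ g t = 0}.ncard + 1) := by
  obtain ⟨ψ, r, h1, h2, h3, h4, h5, h6⟩ := interlace f g f' g' a ha hf hg hf' hg' hne hfa hga hf0 hg0
  have hπ := Real.pi_pos
  have hr := h2 x (ha.trans_le hx)
  have e : f x * g x = r x ^2 * (Real.cos (ψ x / π * π) * Real.sin (ψ x / π * π)) := by
    rw [div_mul_cancel₀ _ hπ.ne', (h3 x (ha.trans_le hx)).1, (h3 x (ha.trans_le hx)).2]; ring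
  refine ⟨(h5 x hx).1, ?_, ?_⟩
  · intro h
    rw [e] at h
    have := floor_half_pos _ ((pos_iff_pos_of_mul_pos h).1 (by positivity))
    have h7 := (h5 x hx).2
    have h8 := (h6 x hx).2
    omega
  · intro h
    rw [e] at h
    have := floor_half_neg (ψ x / π) (by
      by_contra hcon; push Not at hcon
      have : 0 ≤ r x ^2 * (Real.cos (ψ x / π * π) * Real.sin (ψ x / π * π)) := by positivity
      linarith)
    have h7 := (h5 x hx).2
    have h8 := (h6 x hx).2
    omega


noncomputable def NJ (n : ℕ) (x : ℝ) : ℕ := {t | 0 < t ∧ t ≤ x ∧ besselJ n t = 0}.ncard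
noncomputable def NZ (σ : ℝ) (n : ℕ) (x : ℝ) : ℕ := {t | 0 < t ∧ t ≤ x ∧ phiRobin σ n t = 0}.ncard

lemma NJ_step (n : ℕ) (x : ℝ) (hx : 1 ≤ x) :
    (0 < besselJ n x * besselJ (n+1) x → NJ n x = NJ (n+1) x) ∧
    (besselJ n x * besselJ (n+1) x < 0 → NJ n x = NJ (n+1) x + 1) := by
  have hpi := Real.pi_gt_three
  have h := interlace_count (besselJ n) (besselJ (n+1)) (fun x => bv n x / x) (fun x => bv (n+1) x / x) 1 one_pos
    (fun x hx => bj_hasDerivAt n hx.ne') (fun x hx => bj_hasDerivAt (n+1) hx.ne')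
    ((bv_continuous n).continuousOn.div continuousOn_id (fun x hx => (ne_of_gt hx)))
    ((bv_continuous (n+1)).continuousOn.div continuousOn_id (fun x hx => (ne_of_gt hx)))
    (fun x hx => bj_not_both n hx)
    (fun x hx hx1 => bj_pos_small n hx (by linarith))
    (fun x hx hx1 => bj_pos_small (n+1) hx (by linarith))
    (fun x hx h0 => by
      have h1 : besselJ (n+1) x ≠ 0 := fun h1 => bj_not_both n hx ⟨h0, h1⟩
      have : bv n x / x * besselJ (n+1) x = - besselJ (n+1) x ^2 := by
        unfold bv; rw [h0]; field_simp; ring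
      rw [this]
      have := sq_pos_of_ne_zero h1
      linarith)
    (fun x hx h0 => by
      have h1 : besselJ n x ≠ 0 := fun h1 => bj_not_both n hx ⟨h1, h0⟩
      have h2 := bj_rec2 n x
      rw [← Nat.cast_one (R := ℝ), ← Nat.cast_add] at h2
      have : bv (n+1) x / x * besselJ n x = besselJ n x ^2 := by
        rw [bv_eq, h2, h0]; field_simp; ring
      rw [this]
      exact sq_pos_of_ne_zero h1) x hx
  exact h.2

lemma NZ_step {σ : ℝ} (hσ : 0 < σ) (n : ℕ) (x : ℝ) (hx : π/2 ≤ x) :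
    {t | 0 < t ∧ t ≤ x ∧ phiRobin σ n t = 0}.Finite ∧
    (0 < phiRobin σ n x * besselJ n x → NZ σ n x = NJ n x) ∧
    (phiRobin σ n x * besselJ n x < 0 → NZ σ n x = NJ n x + 1) := by
  have hpi := Real.pi_gt_three
  obtain ⟨a, ha, ha2, hpos⟩ := phi_pos_near hσ n
  have hne : ContinuousOn (fun x => bv n x / x) (Set.Ioi 0) :=
    ((bv_continuous n).continuousOn.div continuousOn_id (fun x hx => (ne_of_gt hx)))
  have h := interlace_count (phiRobin σ n) (besselJ n) (fun x => -((x^2 - n^2) / x) * besselJ n x + σ * (bv n x / x))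
    (fun x => bv n x / x) a ha
    (fun x hx => phi_hasDerivAt σ n hx.ne') (fun x hx => bj_hasDerivAt n hx.ne')
    (by
      apply ContinuousOn.add
      · apply ContinuousOn.mul _ (bj_continuous n).continuousOn
        apply ContinuousOn.neg
        apply ContinuousOn.div (by fun_prop) continuousOn_id (fun x hx => (ne_of_gt hx))
      · exact continuousOn_const.mul hne)
    hne
    (fun x hx => phi_bj_not_both σ n hx)
    hpos
    (fun x hx hx1 => bj_pos_small n hx (by linarith))
    (fun x hx h0 => by
      have h1 : besselJ n x ≠ 0 := fun h1 => phi_bj_not_both σ n hx ⟨h0, h1⟩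
      have hn : (n:ℝ) < x := by
        by_contra hcon; push Not at hcon
        have := phi_pos hσ n hx hcon; linarith
      have h2 : bv n x = - σ * besselJ n x := by have := phi_eq σ n x; linarith
      have : (-((x^2 - n^2) / x) * besselJ n x + σ * (bv n x / x)) * besselJ n x = - ((x^2 - n^2 + σ^2)/x * besselJ n x ^2) := by
        rw [h2]; field_simp; ring
      rw [this]
      have := sq_pos_of_ne_zero h1
      have h3 : (0:ℝ) ≤ n := Nat.cast_nonneg n
      have : 0 < x^2 - n^2 + σ^2 := by nlinarith
      have : 0 < (x^2 - n^2 + σ^2)/x * besselJ n x ^2 := by positivity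
      linarith)
    (fun x hx h0 => by
      have h1 : bv n x ≠ 0 := fun h1 => phi_bj_not_both σ n hx ⟨by rw [phi_eq, h1, h0]; ring, h0⟩
      have : bv n x / x * phiRobin σ n x = bv n x ^2 / x := by
        rw [phi_eq, h0]; field_simp; ring
      rw [this]
      have := sq_pos_of_ne_zero h1
      positivity) x (by linarith)
  exact h


noncomputable def fG (Y : ℝ) : ℂ := ∫ v in (0:ℝ)..Y, Complex.exp (-Complex.I * (v:ℂ)^2)

lemma fG_hasDerivAt (Y : ℝ) : HasDerivAt fG (Complex.exp (-Complex.I * (Y:ℂ)^2)) Y := by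
  have hc : Continuous (fun v : ℝ => Complex.exp (-Complex.I * (v:ℂ)^2)) := by fun_prop
  exact intervalIntegral.integral_hasDerivAt_right (hc.intervalIntegrable _ _)
    hc.stronglyMeasurable.stronglyMeasurableAtFilter hc.continuousAt

lemma norm_exp_I (y : ℝ) : ‖Complex.exp (-Complex.I * (y:ℂ))‖ = 1 := by
  rw [Complex.norm_exp]; simp

lemma fG_scale (x Y : ℝ) : fG (x * Y) = x * ∫ t in (0:ℝ)..Y, Complex.exp (-Complex.I * ((x*t : ℝ):ℂ)^2) := by
  unfold fG
  have h := intervalIntegral.smul_integral_comp_mul_left (a := 0) (b := Y) (f := fun v : ℝ => Complex.exp (-Complex.I * (v:ℂ)^2)) x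
  rw [mul_zero] at h
  rw [← h, Complex.real_smul]

noncomputable def fB (x : ℝ) : ℂ := ∫ t in (0:ℝ)..1, Complex.exp (-Complex.I * ((x^2 * (1+t^2) : ℝ):ℂ)) / ((1+t^2 : ℝ):ℂ)

lemma fB_hasDerivAt (x : ℝ) : HasDerivAt fB (∫ t in (0:ℝ)..1, (-Complex.I * (2 * x)) * Complex.exp (-Complex.I * ((x^2 * (1+t^2) : ℝ):ℂ))) x := by
  have hpos : ∀ t : ℝ, ((1+t^2 : ℝ):ℂ) ≠ 0 := fun t => by
    have : (1+t^2 : ℝ) ≠ 0 := by positivity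
    exact_mod_cast this
  have hcont : ∀ y : ℝ, Continuous (fun t : ℝ => Complex.exp (-Complex.I * ((y^2 * (1+t^2) : ℝ):ℂ)) / ((1+t^2 : ℝ):ℂ)) := by
    intro y
    apply Continuous.div (by fun_prop) (by fun_prop) hpos
  have hcont' : ∀ y : ℝ, Continuous (fun t : ℝ => (-Complex.I * (2 * y)) * Complex.exp (-Complex.I * ((y^2 * (1+t^2) : ℝ):ℂ))) := by
    intro y; fun_prop
  have := intervalIntegral.hasDerivAt_integral_of_dominated_loc_of_deriv_le (𝕜 := ℝ) (μ := volume) (a := 0) (b := 1)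
    (F := fun (y t : ℝ) => Complex.exp (-Complex.I * ((y^2 * (1+t^2) : ℝ):ℂ)) / ((1+t^2 : ℝ):ℂ))
    (F' := fun (y t : ℝ) => (-Complex.I * (2 * y)) * Complex.exp (-Complex.I * ((y^2 * (1+t^2) : ℝ):ℂ)))
    (x₀ := x) (s := Metric.ball x 1) (bound := fun _ => 2 * (|x| + 1)) (Metric.ball_mem_nhds x one_pos)
    (Filter.Eventually.of_forall (fun y => (hcont y).aestronglyMeasurable))
    ((hcont x).intervalIntegrable _ _) (hcont' x).aestronglyMeasurable
    (by
      refine Filter.Eventually.of_forall (fun t _ y hy => ?_)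
      rw [norm_mul, norm_exp_I]
      simp
      have : |y - x| < 1 := by simpa [Real.dist_eq] using hy
      have := abs_sub_abs_le_abs_sub y x
      linarith)
    (by simp)
    (by
      refine Filter.Eventually.of_forall (fun t _ y hy => ?_)
      have h1 : HasDerivAt (fun y : ℝ => y^2 * (1+t^2)) (2 * y * (1+t^2)) y := by
        simpa using (hasDerivAt_pow 2 y).mul_const (1+t^2)
      have h2 := ((h1.ofReal_comp.const_mul (-Complex.I)).cexp.div_const ((1+t^2 : ℝ):ℂ))
      refine h2.congr_deriv ?_
      have := hpos t
      rw [div_eq_iff this]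
      push_cast
      ring)
  exact this.2

lemma fG_sq (x : ℝ) : fG x ^ 2 = -Complex.I * (π/4) + Complex.I * fB x := by
  have hd : ∀ y : ℝ, HasDerivAt (fun y => fG y ^2 - Complex.I * fB y) 0 y := by
    intro y
    refine (((fG_hasDerivAt y).pow 2).sub ((fB_hasDerivAt y).const_mul Complex.I)).congr_deriv ?_
    have h1 := fG_scale y 1
    rw [mul_one] at h1
    rw [h1, intervalIntegral.integral_const_mul]
    have h2 : ∫ t in (0:ℝ)..1, Complex.exp (-Complex.I * ((y^2 * (1+t^2) : ℝ):ℂ))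
      = Complex.exp (-Complex.I * (y:ℂ)^2) * ∫ t in (0:ℝ)..1, Complex.exp (-Complex.I * ((y*t : ℝ):ℂ)^2) := by
      rw [← intervalIntegral.integral_const_mul]
      congr 1; funext t
      rw [← Complex.exp_add]; congr 1; push_cast; ring
    rw [h2]
    push_cast
    linear_combination (2 * y * Complex.exp (-Complex.I * (y:ℂ)^2) * ∫ t in (0:ℝ)..1, Complex.exp (-Complex.I * ((y:ℂ)*t)^2)) * Complex.I_sq
  have := is_const_of_deriv_eq_zero (fun y => (hd y).differentiableAt) (fun y => (hd y).deriv) x 0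
  have h0 : fG 0 = 0 := by simp [fG]
  have hB : fB 0 = π/4 := by
    unfold fB
    have : ∀ t : ℝ, Complex.exp (-Complex.I * (((0:ℝ)^2 * (1+t^2) : ℝ):ℂ)) / ((1+t^2 : ℝ):ℂ) = (((1+t^2)⁻¹ : ℝ) : ℂ) := by
      intro t; simp
    simp only [this]
    rw [intervalIntegral.integral_ofReal, integral_inv_one_add_sq]
    simp
  simp only [h0, hB] at this
  linear_combination this

lemma fB_norm (x : ℝ) : ‖fB x‖ ≤ 1 := by
  have := intervalIntegral.norm_integral_le_of_norm_le_const (a := 0) (b := 1) (C := 1) (f := fun t : ℝ => Complex.exp (-Complex.I * ((x^2 * (1+t^2) : ℝ):ℂ)) / ((1+t^2 : ℝ):ℂ))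
    (fun t _ => by
      rw [norm_div, norm_exp_I, Complex.norm_real, Real.norm_of_nonneg (by positivity)]
      rw [div_le_one (by positivity)]; nlinarith [sq_nonneg t])
  rw [sub_zero, abs_one, one_mul] at this
  exact this

lemma fG_norm (x : ℝ) : ‖fG x‖ ≤ 2 := by
  have h := fG_sq x
  have h2 : ‖fG x‖^2 ≤ 2 := by
    rw [← norm_pow, h]
    refine (norm_add_le _ _).trans ?_
    have h1 : ‖-Complex.I * ((π:ℂ)/4)‖ ≤ 1 := by
      rw [norm_mul, norm_neg, Complex.norm_I, one_mul]
      have : ((π:ℂ)/4) = ((π/4 : ℝ):ℂ) := by push_cast; rfl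
      rw [this, Complex.norm_real, Real.norm_of_nonneg (by positivity)]
      linarith [Real.pi_le_four]
    have h3 : ‖Complex.I * fB x‖ ≤ 1 := by rw [norm_mul, Complex.norm_I, one_mul]; exact fB_norm x
    linarith
  nlinarith [norm_nonneg (fG x)]

lemma fB_bound (x : ℝ) (hx : 0 < x) : ‖fB x‖ ≤ 5 / x := by
  have hx0 : (x:ℂ) ≠ 0 := by exact_mod_cast hx.ne'
  have hpos : ∀ t : ℝ, ((1+t^2 : ℝ)) ≠ 0 := fun t => by positivity
  have hu : ∀ t : ℝ, HasDerivAt (fun t : ℝ => ((((1+t^2)⁻¹ : ℝ)):ℂ)) ((-(2*t)/(1+t^2)^2 : ℝ) : ℂ) t := by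
    intro t
    have h1 : HasDerivAt (fun t : ℝ => 1 + t^2) (2*t) t := by
      simpa using (hasDerivAt_pow 2 t).const_add 1
    exact (h1.inv (hpos t)).ofReal_comp
  have hv : ∀ t : ℝ, HasDerivAt (fun t : ℝ => fG (x*t) / x) (Complex.exp (-Complex.I * ((x*t : ℝ):ℂ)^2)) t := by
    intro t
    have h1 : HasDerivAt (fun t : ℝ => x * t) x t := by simpa using (hasDerivAt_id t).const_mul x
    have h2 := ((fG_hasDerivAt (x*t)).scomp t h1).div_const (x:ℂ)
    refine h2.congr_deriv ?_
    rw [Complex.real_smul]; field_simp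
  have hcu : Continuous (fun t : ℝ => ((-(2*t)/(1+t^2)^2 : ℝ) : ℂ)) := by
    apply Complex.continuous_ofReal.comp
    apply Continuous.div (by fun_prop) (by fun_prop) (fun t => pow_ne_zero 2 (hpos t))
  have hcv : Continuous (fun t : ℝ => Complex.exp (-Complex.I * ((x*t : ℝ):ℂ)^2)) := by fun_prop
  have ibp := intervalIntegral.integral_mul_deriv_eq_deriv_mul (a := 0) (b := 1)
    (fun t _ => hu t) (fun t _ => hv t) (hcu.intervalIntegrable _ _) (hcv.intervalIntegrable _ _)
  have e : fB x = Complex.exp (-Complex.I * ((x^2:ℝ):ℂ)) * ∫ t in (0:ℝ)..1, ((((1+t^2)⁻¹ : ℝ)):ℂ) * Complex.exp (-Complex.I * ((x*t : ℝ):ℂ)^2) := by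
    unfold fB
    rw [← intervalIntegral.integral_const_mul]
    congr 1; funext t
    rw [mul_comm (((1+t^2)⁻¹ : ℝ):ℂ), ← mul_assoc, ← Complex.exp_add, div_eq_mul_inv, Complex.ofReal_inv]
    congr 2
    push_cast; ring
  rw [e, norm_mul, norm_exp_I, one_mul, ibp]
  have hG : ∀ t : ℝ, ‖fG (x*t) / x‖ ≤ 2 / x := by
    intro t
    rw [norm_div, Complex.norm_real, Real.norm_of_nonneg hx.le]
    gcongr; exact fG_norm _
  have hint := intervalIntegral.norm_integral_le_of_norm_le_const (a := 0) (b := 1) (C := 2 * (2/x)) 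
    (f := fun t : ℝ => ((-(2*t)/(1+t^2)^2 : ℝ) : ℂ) * (fG (x*t) / x)) (fun t ht => by
      rw [Set.uIoc_of_le zero_le_one] at ht
      rw [norm_mul]
      gcongr
      · rw [Complex.norm_real, Real.norm_eq_abs, abs_div, abs_neg, abs_of_nonneg (by linarith [ht.1] : 0 ≤ 2*t), abs_of_nonneg (by positivity)]
        rw [div_le_iff₀ (by positivity)]
        nlinarith [ht.1, ht.2, sq_nonneg t, sq_nonneg (1+t^2)]
      · exact hG t)
  have h0 : fG (x * 0) / x = 0 := by simp [fG]
  rw [h0, mul_zero, sub_zero]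
  refine (norm_sub_le _ _).trans ?_
  have h1 : ‖((((1+(1:ℝ)^2)⁻¹ : ℝ)):ℂ) * (fG (x*1) / x)‖ ≤ 1 * (2/x) * (1/2) := by
    rw [norm_mul, Complex.norm_real]
    have := hG 1
    have h3 : ‖((1 + (1:ℝ)^2)⁻¹ : ℝ)‖ = 1/2 := by norm_num
    rw [h3]
    linarith
  rw [sub_zero, abs_one, mul_one] at hint
  have h2 : 5 / x = 1 * (2/x) * (1/2) + 2 * (2/x) := by ring
  rw [h2]
  exact add_le_add h1 hint

open Filter Topology in
lemma fG_sq_tendsto : Tendsto (fun x => fG x ^2) atTop (𝓝 (-Complex.I * (π/4))) := by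
  have hB : Tendsto fB atTop (𝓝 0) := by
    apply squeeze_zero_norm' (a := fun x => 5 / x)
    · filter_upwards [eventually_gt_atTop 0] with x hx using fB_bound x hx
    · exact tendsto_const_nhds.div_atTop tendsto_id
  have := (hB.const_mul Complex.I).const_add (-Complex.I * (π/4))
  simp only [mul_zero, add_zero] at this
  exact this.congr (fun x => (fG_sq x).symm)


lemma j0_shift (x : ℝ) : besselJ 0 x = (1/π) * ∫ τ in (-(π/2))..(π/2), Real.cos (x * Real.cos τ) := by
  unfold besselJ
  congr 1
  have h := intervalIntegral.integral_comp_sub_right (a := 0) (b := π) (fun τ => Real.cos (x * Real.cos τ)) (π/2)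
  have e1 : (0:ℝ) - π/2 = -(π/2) := by ring
  have e2 : π - π/2 = π/2 := by ring
  rw [e1, e2] at h
  rw [← h]
  congr 1; funext t
  rw [Real.cos_sub_pi_div_two]; simp

lemma j0_re (x : ℝ) : besselJ 0 x = (1/π) * (∫ τ in (-(π/2))..(π/2), Complex.exp (Complex.I * ((x * Real.cos τ : ℝ) : ℂ))).re := by
  rw [j0_shift]
  congr 1
  have hc : Continuous (fun τ : ℝ => Complex.exp (Complex.I * ((x * Real.cos τ : ℝ) : ℂ))) := by fun_prop
  have h := Complex.reCLM.intervalIntegral_comp_comm (hc.intervalIntegrable (μ := volume) (-(π/2)) (π/2))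
  simp only [Complex.reCLM_apply] at h
  rw [← h]
  congr 1; funext τ
  rw [mul_comm Complex.I, Complex.exp_ofReal_mul_I_re]

lemma fG_neg (Y : ℝ) : fG (-Y) = - fG Y := by
  have h := fG_scale (-1) Y
  rw [neg_one_mul] at h
  rw [h, fG]
  simp

lemma j0_main (x : ℝ) (hx : 0 < x) :
    ∫ τ in (-(π/2))..(π/2), Complex.exp (Complex.I * ((x * Real.cos τ : ℝ) : ℂ)) * ((Real.cos (τ/2) : ℝ):ℂ)
      = Complex.exp (Complex.I * x) * (2 / (√(2*x) : ℝ)) * (2 * fG (√x)) := by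
  have hs : 0 < √(2*x) := Real.sqrt_pos.2 (by linarith)
  have hs0 : ((√(2*x) : ℝ):ℂ) ≠ 0 := by exact_mod_cast hs.ne'
  have hd : ∀ τ : ℝ, HasDerivAt (fun τ : ℝ => Complex.exp (Complex.I * x) * (2 / (√(2*x) : ℝ)) * fG (√(2*x) * Real.sin (τ/2)))
      (Complex.exp (Complex.I * ((x * Real.cos τ : ℝ) : ℂ)) * ((Real.cos (τ/2) : ℝ):ℂ)) τ := by
    intro τ
    have h1 : HasDerivAt (fun τ : ℝ => √(2*x) * Real.sin (τ/2)) (√(2*x) * (Real.cos (τ/2) * (1/2))) τ := by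
      have := ((hasDerivAt_id τ).div_const 2).sin.const_mul (√(2*x))
      simpa using this
    have h2 := ((fG_hasDerivAt (√(2*x) * Real.sin (τ/2))).scomp τ h1).const_mul (Complex.exp (Complex.I * x) * (2 / (√(2*x) : ℝ)))
    refine h2.congr_deriv ?_
    have e : Complex.exp (Complex.I * x) * Complex.exp (-Complex.I * ((√(2*x) * Real.sin (τ/2) : ℝ):ℂ)^2) = Complex.exp (Complex.I * ((x * Real.cos τ : ℝ) : ℂ)) := by
      rw [← Complex.exp_add]; congr 1
      have : (√(2*x) * Real.sin (τ/2))^2 = x - x * Real.cos τ := by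
        rw [mul_pow, Real.sq_sqrt (by linarith), Real.sin_sq_eq_half_sub]
        ring_nf
      rw [← Complex.ofReal_pow, this]; push_cast; ring
    rw [Complex.real_smul, ← e]
    push_cast
    field_simp
  have hc : Continuous (fun τ : ℝ => Complex.exp (Complex.I * ((x * Real.cos τ : ℝ) : ℂ)) * ((Real.cos (τ/2) : ℝ):ℂ)) := by fun_prop
  rw [intervalIntegral.integral_eq_sub_of_hasDerivAt (fun τ _ => hd τ) (hc.intervalIntegrable _ _)]
  have e1 : √(2*x) * Real.sin (π/2/2) = √x := by
    rw [show π/2/2 = π/4 by ring, Real.sin_pi_div_four, Real.sqrt_mul (by norm_num)]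
    have : √2 * √2 = 2 := Real.mul_self_sqrt (by norm_num)
    linear_combination (√x/2) * this
  have e2 : √(2*x) * Real.sin (-(π/2)/2) = -√x := by
    rw [neg_div, Real.sin_neg, mul_neg, e1]
  rw [e1, e2, fG_neg]; ring

lemma kap_den {τ : ℝ} (h : τ ∈ Set.uIcc (-(π/2)) (π/2)) : 2 * Real.cos (τ/4) * Real.cos (τ/2) ≠ 0 := by
  have hpi := Real.pi_pos
  rw [Set.uIcc_of_le (by linarith)] at h
  have h1 : 0 < Real.cos (τ/4) := Real.cos_pos_of_mem_Ioo ⟨by linarith [h.1], by linarith [h.2]⟩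
  have h2 : 0 < Real.cos (τ/2) := Real.cos_pos_of_mem_Ioo ⟨by linarith [h.1], by linarith [h.2]⟩
  positivity

noncomputable def kap (τ : ℝ) : ℝ := Real.sin (τ/4) / (2 * Real.cos (τ/4) * Real.cos (τ/2))
noncomputable def kap' (τ : ℝ) : ℝ := (Real.cos (τ/4) * (1/4) * (2 * Real.cos (τ/4) * Real.cos (τ/2))
   - Real.sin (τ/4) * (2 * (-Real.sin (τ/4) * (1/4)) * Real.cos (τ/2) + 2 * Real.cos (τ/4) * (-Real.sin (τ/2) * (1/2)))) / (2 * Real.cos (τ/4) * Real.cos (τ/2))^2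

lemma kap_hasDerivAt {τ : ℝ} (h : τ ∈ Set.uIcc (-(π/2)) (π/2)) : HasDerivAt kap (kap' τ) τ := by
  have h1 := ((hasDerivAt_id τ).div_const 4).sin
  have h2 := ((hasDerivAt_id τ).div_const 4).cos
  have h3 := ((hasDerivAt_id τ).div_const 2).cos
  exact h1.div ((h2.const_mul 2).mul h3) (kap_den h)

lemma kap_eq {τ : ℝ} (h : τ ∈ Set.uIcc (-(π/2)) (π/2)) : Real.sin τ * kap τ = 1 - Real.cos (τ/2) := by
  have h0 := kap_den h
  have e1 : Real.sin τ = 2 * Real.sin (τ/2) * Real.cos (τ/2) := by rw [← Real.sin_two_mul]; ring_nf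
  have e2 : Real.sin (τ/2) = 2 * Real.sin (τ/4) * Real.cos (τ/4) := by rw [← Real.sin_two_mul]; ring_nf
  have e3 : 1 - Real.cos (τ/2) = 2 * Real.sin (τ/4)^2 := by
    rw [Real.sin_sq_eq_half_sub]; ring_nf
  have h4 : Real.cos (τ/4) ≠ 0 := fun h => h0 (by rw [h]; ring)
  have h5 : Real.cos (τ/2) ≠ 0 := fun h => h0 (by rw [h]; ring)
  rw [e3, e1, e2, kap]
  field_simp

lemma j0_rem : ∃ M : ℝ, 0 ≤ M ∧ ∀ x : ℝ, 0 < x → ‖∫ τ in (-(π/2))..(π/2), Complex.exp (Complex.I * ((x * Real.cos τ : ℝ) : ℂ)) * ((1 - Real.cos (τ/2) : ℝ):ℂ)‖ ≤ M / x := by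
  have hk'c : ContinuousOn kap' (Set.uIcc (-(π/2)) (π/2)) := by
    unfold kap'
    apply ContinuousOn.div (by fun_prop) (by fun_prop) (fun τ h => pow_ne_zero 2 (kap_den h))
  refine ⟨|kap (π/2)| + |kap (-(π/2))| + ∫ τ in (-(π/2))..(π/2), |kap' τ|, ?_, ?_⟩
  · have : 0 ≤ ∫ τ in (-(π/2))..(π/2), |kap' τ| := intervalIntegral.integral_nonneg (by linarith [Real.pi_pos]) (fun _ _ => abs_nonneg _)
    positivity
  intro x hx
  have hx0 : (x:ℂ) ≠ 0 := by exact_mod_cast hx.ne'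
  have hv : ∀ τ : ℝ, HasDerivAt (fun τ : ℝ => Complex.I / x * Complex.exp (Complex.I * ((x * Real.cos τ : ℝ) : ℂ)))
     (Complex.exp (Complex.I * ((x * Real.cos τ : ℝ) : ℂ)) * (Real.sin τ : ℝ)) τ := by
    intro τ
    have h1 := ((Real.hasDerivAt_cos τ).const_mul x).ofReal_comp
    refine (((h1.const_mul Complex.I).cexp).const_mul (Complex.I / x)).congr_deriv ?_
    push_cast
    field_simp
    linear_combination (-Complex.sin τ) * Complex.I_sq
  have hcv : Continuous (fun τ : ℝ => Complex.exp (Complex.I * ((x * Real.cos τ : ℝ) : ℂ)) * ((Real.sin τ : ℝ):ℂ)) := by fun_prop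
  have ibp := intervalIntegral.integral_mul_deriv_eq_deriv_mul (a := -(π/2)) (b := π/2) (u := fun τ => ((kap τ : ℝ):ℂ)) (u' := fun τ => ((kap' τ : ℝ):ℂ))
    (fun τ h => (kap_hasDerivAt h).ofReal_comp) (fun τ _ => hv τ)
    ((Complex.continuous_ofReal.comp_continuousOn hk'c).intervalIntegrable) (hcv.intervalIntegrable _ _)
  have e : ∫ τ in (-(π/2))..(π/2), Complex.exp (Complex.I * ((x * Real.cos τ : ℝ) : ℂ)) * ((1 - Real.cos (τ/2) : ℝ):ℂ)
     = ∫ τ in (-(π/2))..(π/2), ((kap τ : ℝ):ℂ) * (Complex.exp (Complex.I * ((x * Real.cos τ : ℝ) : ℂ)) * (Real.sin τ : ℝ)) := by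
    apply intervalIntegral.integral_congr
    intro τ h
    simp only
    rw [← kap_eq h]; push_cast; ring
  rw [e, ibp]
  have hn : ∀ τ : ℝ, ‖Complex.I / x * Complex.exp (Complex.I * ((x * Real.cos τ : ℝ) : ℂ))‖ = 1 / x := by
    intro τ
    rw [norm_mul, mul_comm Complex.I (((x * Real.cos τ : ℝ) : ℂ)), Complex.norm_exp_ofReal_mul_I, norm_div, Complex.norm_I, Complex.norm_real, Real.norm_of_nonneg hx.le, mul_one]
  refine (norm_sub_le _ _).trans ?_
  rw [add_div]
  refine add_le_add ((norm_sub_le _ _).trans ?_) ?_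
  · rw [norm_mul ((kap (π/2) : ℝ):ℂ), norm_mul ((kap (-(π/2)) : ℝ):ℂ), hn, hn, Complex.norm_real, Complex.norm_real, add_div, Real.norm_eq_abs, Real.norm_eq_abs]
    apply le_of_eq; ring
  · refine (intervalIntegral.norm_integral_le_integral_norm (by linarith [Real.pi_pos])).trans ?_
    simp only [norm_mul ((kap' _ : ℝ):ℂ), hn, Complex.norm_real, Real.norm_eq_abs]
    rw [intervalIntegral.integral_mul_const]
    apply le_of_eq; ring

lemma j0_asym : ∃ M : ℝ, 0 ≤ M ∧ ∀ x : ℝ, 0 < x →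
    |√x * besselJ 0 x - (1/π * (4/√2)) * (Complex.exp (Complex.I * x) * fG (√x)).re| ≤ M / √x := by
  obtain ⟨M, hM, h⟩ := j0_rem
  refine ⟨M, hM, fun x hx => ?_⟩
  have hsx : 0 < √x := Real.sqrt_pos.2 hx
  have hs2 : 0 < √(2:ℝ) := Real.sqrt_pos.2 (by norm_num)
  have hr := h x hx
  have hc1 : Continuous (fun τ : ℝ => Complex.exp (Complex.I * ((x * Real.cos τ : ℝ) : ℂ)) * ((Real.cos (τ/2) : ℝ):ℂ)) := by fun_prop
  have hc2 : Continuous (fun τ : ℝ => Complex.exp (Complex.I * ((x * Real.cos τ : ℝ) : ℂ)) * ((1 - Real.cos (τ/2) : ℝ):ℂ)) := by fun_prop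
  have e : ∫ τ in (-(π/2))..(π/2), Complex.exp (Complex.I * ((x * Real.cos τ : ℝ) : ℂ)) = Complex.exp (Complex.I * x) * (2 / (√(2*x) : ℝ)) * (2 * fG (√x)) + ∫ τ in (-(π/2))..(π/2), Complex.exp (Complex.I * ((x * Real.cos τ : ℝ) : ℂ)) * ((1 - Real.cos (τ/2) : ℝ):ℂ) := by
    rw [← j0_main x hx, ← intervalIntegral.integral_add (hc1.intervalIntegrable _ _) (hc2.intervalIntegrable _ _)]
    congr 1; funext τ
    push_cast; ring
  set R := ∫ τ in (-(π/2))..(π/2), Complex.exp (Complex.I * ((x * Real.cos τ : ℝ) : ℂ)) * ((1 - Real.cos (τ/2) : ℝ):ℂ)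
  have hR : |R.re| ≤ M / x := (Complex.abs_re_le_norm R).trans hr
  have e2 : (Complex.exp (Complex.I * x) * (2 / (√(2*x) : ℝ)) * (2 * fG (√x))).re = (4/√2) / √x * (Complex.exp (Complex.I * x) * fG (√x)).re := by
    rw [← Complex.re_ofReal_mul]
    congr 1
    rw [Real.sqrt_mul (by norm_num)]
    push_cast
    have : ((√2:ℝ):ℂ) ≠ 0 := by exact_mod_cast hs2.ne'
    have : ((√x:ℝ):ℂ) ≠ 0 := by exact_mod_cast hsx.ne'
    field_simp
    ring
  rw [j0_re, e, Complex.add_re, e2]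
  have e3 : √x * (1 / π * (4 / √2 / √x * (Complex.exp (Complex.I * ↑x) * fG √x).re + R.re)) - 1 / π * (4 / √2) * (Complex.exp (Complex.I * ↑x) * fG √x).re = √x * (1/π * R.re) := by
    field_simp; ring
  rw [e3, abs_mul, abs_mul, abs_of_pos hsx, abs_of_pos (by positivity)]
  have h1 : 1/π ≤ 1 := by rw [div_le_one Real.pi_pos]; linarith [Real.pi_gt_three]
  calc √x * (1/π * |R.re|) ≤ √x * (1 * (M/x)) := by gcongr
    _ = M / √x := by
      nth_rewrite 2 [← Real.mul_self_sqrt hx.le]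
      field_simp

open Filter Topology in
lemma j0_tendsto : Tendsto (fun m : ℕ => √(m * π + 3*π/4) * besselJ 0 (m * π + 3*π/4)) atTop (𝓝 0) := by
  obtain ⟨M, hM, h⟩ := j0_asym
  have hpi := Real.pi_pos
  have hX : Tendsto (fun m : ℕ => (m * π + 3*π/4 : ℝ)) atTop atTop :=
    tendsto_atTop_add_const_right _ _ (tendsto_natCast_atTop_atTop.atTop_mul_const hpi)
  have hsX : Tendsto (fun m : ℕ => √(m * π + 3*π/4 : ℝ)) atTop atTop := Real.tendsto_sqrt_atTop.comp hX
  have hG := fG_sq_tendsto.comp hsX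
  have hz2 : Tendsto (fun m : ℕ => (Complex.exp (Complex.I * ((m * π + 3*π/4 : ℝ):ℂ)) * fG (√(m * π + 3*π/4)))^2) atTop (𝓝 (-(π/4))) := by
    have := hG.const_mul (-Complex.I)
    have e0 : -Complex.I * (-Complex.I * ((π:ℂ)/4)) = -(π/4) := by linear_combination (π/4:ℂ) * Complex.I_sq
    rw [e0] at this
    refine this.congr (fun m => ?_)
    simp only [Function.comp]
    rw [mul_pow, ← Complex.exp_nat_mul]
    congr 1
    have : ((2:ℕ):ℂ) * (Complex.I * ((m * π + 3*π/4 : ℝ):ℂ)) = m * (2 * π * Complex.I) + ((3*π/2:ℝ):ℂ) * Complex.I := by push_cast; ring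
    rw [this, Complex.exp_add, Complex.exp_nat_mul, Complex.exp_two_pi_mul_I, one_pow, one_mul, Complex.exp_mul_I, ← Complex.ofReal_cos, ← Complex.ofReal_sin]
    have h1 : Real.cos (3*π/2) = 0 := by
      rw [show 3*π/2 = π/2 + π by ring, Real.cos_add_pi, Real.cos_pi_div_two, neg_zero]
    have h2 : Real.sin (3*π/2) = -1 := by
      rw [show 3*π/2 = π/2 + π by ring, Real.sin_add_pi, Real.sin_pi_div_two]
    rw [h1, h2]; simp
  have hre2 : Tendsto (fun m : ℕ => ((Complex.exp (Complex.I * ((m * π + 3*π/4 : ℝ):ℂ)) * fG (√(m * π + 3*π/4))).re)^2) atTop (𝓝 0) := by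
    have h1 := (Complex.continuous_re.tendsto _).comp hz2
    have h2 := hz2.norm
    have h3 := (h1.add h2).div_const 2
    have e0 : ((-((π:ℂ)/4)).re + ‖-((π:ℂ)/4)‖)/2 = 0 := by
      have : -((π:ℂ)/4) = ((-(π/4) : ℝ):ℂ) := by push_cast; rfl
      rw [this, Complex.norm_real, Complex.ofReal_re, Real.norm_eq_abs, abs_neg, abs_of_pos (by positivity)]; ring
    rw [e0] at h3
    refine h3.congr (fun m => ?_)
    simp only [Function.comp]
    rw [norm_pow, ← Complex.normSq_eq_norm_sq, Complex.normSq_apply, pow_two (Complex.exp _ * _), Complex.mul_re (Complex.exp _ * _)]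
    ring
  have hre : Tendsto (fun m : ℕ => ((Complex.exp (Complex.I * ((m * π + 3*π/4 : ℝ):ℂ)) * fG (√(m * π + 3*π/4))).re)) atTop (𝓝 0) := by
    have := hre2.sqrt
    simp only [Real.sqrt_sq_eq_abs, Real.sqrt_zero] at this
    exact (tendsto_zero_iff_abs_tendsto_zero _).2 this
  have hd : Tendsto (fun m : ℕ => √(m * π + 3*π/4) * besselJ 0 (m * π + 3*π/4) - (1/π * (4/√2)) * (Complex.exp (Complex.I * ((m * π + 3*π/4 : ℝ):ℂ)) * fG (√(m * π + 3*π/4))).re) atTop (𝓝 0) := by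
    apply squeeze_zero_norm (a := fun m : ℕ => M / √(m * π + 3*π/4))
    · intro m
      exact h _ (by positivity)
    · exact tendsto_const_nhds.div_atTop hsX
  have := hd.add (hre.const_mul (1/π * (4/√2)))
  simp only [mul_zero, add_zero] at this
  refine this.congr (fun m => by ring)


open Filter Topology in
lemma mono_conv (F : ℝ → ℝ) (c B : ℝ) (hm : MonotoneOn F (Set.Ici c)) (hb : ∀ x, c ≤ x → F x ≤ B) :
    ∃ l, Tendsto F atTop (𝓝 l) ∧ F c ≤ l ∧ l ≤ B := by
  have hmono : Monotone (fun x => F (max x c)) := fun x y hxy =>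
    hm (Set.mem_Ici.2 (le_max_right _ _)) (Set.mem_Ici.2 (le_max_right _ _)) (max_le_max hxy le_rfl)
  have hbdd : BddAbove (Set.range (fun x => F (max x c))) := ⟨B, by rintro _ ⟨x, rfl⟩; exact hb _ (le_max_right _ _)⟩
  have h := tendsto_atTop_ciSup hmono hbdd
  have h2 : Tendsto F atTop (𝓝 (⨆ x, F (max x c))) := by
    refine h.congr' ?_
    filter_upwards [eventually_ge_atTop c] with x hx
    rw [max_eq_left hx]
  refine ⟨_, h2, ?_, ?_⟩
  · apply ge_of_tendsto h2
    filter_upwards [eventually_ge_atTop c] with x hx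
    exact hm (Set.mem_Ici.2 le_rfl) hx hx
  · apply le_of_tendsto h2
    filter_upwards [eventually_ge_atTop c] with x hx using hb x hx

lemma mono_of_deriv (F F' : ℝ → ℝ) (c : ℝ) (hd : ∀ x, c ≤ x → HasDerivAt F (F' x) x) (hp : ∀ x, c ≤ x → 0 ≤ F' x) :
    MonotoneOn F (Set.Ici c) := by
  apply monotoneOn_of_deriv_nonneg (convex_Ici c)
  · exact fun x hx => (hd x hx).continuousAt.continuousWithinAt
  · intro x hx; rw [interior_Ici] at hx; exact (hd x (le_of_lt hx)).differentiableAt.differentiableWithinAt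
  · intro x hx; rw [interior_Ici] at hx; rw [(hd x (le_of_lt hx)).deriv]; exact hp x (le_of_lt hx)

noncomputable def u0 (x : ℝ) : ℝ := √x * besselJ 0 x
noncomputable def p0 (x : ℝ) : ℝ := √x * besselJ 1 x - besselJ 0 x / (2 * √x)

lemma u0_hasDerivAt (x : ℝ) (hx : 0 < x) : HasDerivAt u0 (-p0 x) x := by
  have h := (Real.hasDerivAt_sqrt hx.ne').mul (bj_hasDerivAt 0 hx.ne')
  refine HasDerivAt.congr_deriv (f := u0) h ?_
  have hs : √x ≠ 0 := (Real.sqrt_pos.2 hx).ne'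
  simp only [bv, p0]
  push_cast
  field_simp
  ring

lemma p0_hasDerivAt (x : ℝ) (hx : 0 < x) : HasDerivAt p0 ((1 + 1/(4*x^2)) * u0 x) x := by
  have hs : √x ≠ 0 := (Real.sqrt_pos.2 hx).ne'
  have h := ((Real.hasDerivAt_sqrt hx.ne').mul (bj_hasDerivAt 1 hx.ne')).sub
    ((bj_hasDerivAt 0 hx.ne').div ((Real.hasDerivAt_sqrt hx.ne').const_mul 2) (by positivity))
  refine HasDerivAt.congr_deriv (f := p0) h ?_
  have h2 := bj_rec2 0 x
  have h3 := bv_eq 1 x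
  rw [h3]
  simp only [zero_add] at h2
  rw [h2]
  simp only [bv, u0]
  have hsq : √x ^2 = x := Real.sq_sqrt hx.le
  push_cast
  obtain ⟨s, hs'⟩ : ∃ s, s = √x := ⟨_, rfl⟩
  rw [← hs'] at hsq hs ⊢
  rw [← hsq]
  field_simp
  ring

lemma u0p0_ne (x : ℝ) (hx : 0 < x) : ¬ (u0 x = 0 ∧ p0 x = 0) := by
  rintro ⟨h1, h2⟩
  have hs : √x ≠ 0 := (Real.sqrt_pos.2 hx).ne'
  have h3 : besselJ 0 x = 0 := by simpa [u0, hs] using h1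
  apply bj_not_both 0 hx
  refine ⟨h3, ?_⟩
  rw [p0, h3] at h2
  simpa [hs] using h2

open Filter Topology in
lemma phase0 : ∃ ψ r : ℝ → ℝ, ∃ L : ℝ, 0 < L ∧ (∀ x, 0 < x → 0 < r x ∧ u0 x = r x * Real.cos (ψ x) ∧ p0 x = r x * Real.sin (ψ x)) ∧
    Tendsto r atTop (𝓝 L) ∧ Tendsto (fun x => ψ x - x) atTop (𝓝 (-(π/4))) ∧
    ∀ x, 1 ≤ x → (NJ 0 x : ℤ) = ⌊ψ x / π + 1/2⌋ := by
  have hpi := Real.pi_gt_three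
  have hpi2 := Real.pi_lt_d2
  have hu1 : ∀ x, 0 < x → x ≤ 1 → 0 < u0 x := fun x hx hx1 =>
    mul_pos (Real.sqrt_pos.2 hx) (bj_pos_small 0 hx (by linarith))
  have hcu : ContinuousOn u0 (Set.Ioi 0) := fun x hx => (u0_hasDerivAt x hx).continuousAt.continuousWithinAt
  have hcp : ContinuousOn p0 (Set.Ioi 0) := fun x hx => (p0_hasDerivAt x hx).continuousAt.continuousWithinAt
  obtain ⟨ψ, r, h1, h2, h3, h4⟩ := angle_lift0 u0 p0 (fun x => -p0 x) (fun x => (1 + 1/(4*x^2)) * u0 x) 1 one_pos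
    u0_hasDerivAt p0_hasDerivAt hcp.neg
    (by
      apply ContinuousOn.mul _ hcu
      apply continuousOn_const.add
      apply ContinuousOn.div continuousOn_const (by fun_prop)
      intro x hx
      have : (0:ℝ) < x := hx
      positivity) u0p0_ne (hu1 1 one_pos le_rfl)
  have hψ1 := abs_lt.1 h1.2
  have hρ : ∀ x, 0 < x → 0 < u0 x ^2 + p0 x^2 := by
    intro x hx
    rcases not_and_or.1 (u0p0_ne x hx) with h | h
    · have := sq_pos_of_ne_zero h; positivity
    · have := sq_pos_of_ne_zero h; positivity
  have h4' : ∀ x, 0 < x → HasDerivAt ψ (1 + u0 x^2 / (u0 x^2 + p0 x^2) * (1/(4*x^2))) x := by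
    intro x hx
    refine (h4 x hx).congr_deriv ?_
    have := (hρ x hx).ne'
    field_simp
    ring
  have hfrac : ∀ x, 0 < x → 0 ≤ u0 x^2 / (u0 x^2 + p0 x^2) ∧ u0 x^2 / (u0 x^2 + p0 x^2) ≤ 1 := by
    intro x hx
    refine ⟨by positivity, ?_⟩
    rw [div_le_one (hρ x hx)]; nlinarith [sq_nonneg (p0 x)]
  have hinv : ∀ x : ℝ, 0 < x → HasDerivAt (fun x : ℝ => 1/(4*x)) (-(1/(4*x^2))) x := by
    intro x hx
    have h := (hasDerivAt_const x (1:ℝ)).div ((hasDerivAt_id x).const_mul 4) (by simpa using hx.ne')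
    refine h.congr_deriv ?_
    simp only [id]; field_simp; ring
  have m1 : MonotoneOn (fun x => ψ x - x) (Set.Ici 1) := by
    apply mono_of_deriv _ (fun x => 1 + u0 x^2 / (u0 x^2 + p0 x^2) * (1/(4*x^2)) - 1)
    · intro x hx; exact (h4' x (by linarith)).sub (hasDerivAt_id x)
    · intro x hx
      have := (hfrac x (by linarith)).1
      have : 0 ≤ u0 x^2 / (u0 x^2 + p0 x^2) * (1/(4*x^2)) := by positivity
      linarith
  have m2 : MonotoneOn (fun x => -(ψ x - x + 1/(4*x))) (Set.Ici 1) := by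
    apply mono_of_deriv _ (fun x => -(1 + u0 x^2 / (u0 x^2 + p0 x^2) * (1/(4*x^2)) - 1 + -(1/(4*x^2))))
    · intro x hx; exact (((h4' x (by linarith)).sub (hasDerivAt_id x)).add (hinv x (by linarith))).neg
    · intro x hx
      have := (hfrac x (by linarith)).2
      have : u0 x^2 / (u0 x^2 + p0 x^2) * (1/(4*x^2)) ≤ 1 * (1/(4*x^2)) := by gcongr
      linarith
  obtain ⟨l, hl, hl1, hl2⟩ := mono_conv _ 1 (ψ 1 - 1 + 1/4) m1 (by
    intro x hx
    have := m2 (Set.mem_Ici.2 le_rfl) hx hx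
    simp only at this
    have h5 : 0 ≤ 1/(4*x) := by positivity
    rw [mul_one] at this
    linarith)
  -- amplitude
  have hρd : ∀ x, 0 < x → HasDerivAt (fun x => u0 x^2 + p0 x^2) (2 * u0 x * p0 x * (1/(4*x^2))) x := by
    intro x hx
    refine (((u0_hasDerivAt x hx).pow 2).add ((p0_hasDerivAt x hx).pow 2)).congr_deriv ?_
    push_cast; ring
  have hA : ∀ x, 0 < x → |2 * u0 x * p0 x| ≤ u0 x^2 + p0 x^2 := by
    intro x hx
    rw [abs_le]; constructor <;> nlinarith [sq_nonneg (u0 x + p0 x), sq_nonneg (u0 x - p0 x)]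
  have m3 : MonotoneOn (fun x => (u0 x^2 + p0 x^2) * Real.exp (-(1/(4*x)))) (Set.Ici 1) := by
    apply mono_of_deriv _ (fun x => (2 * u0 x * p0 x * (1/(4*x^2))) * Real.exp (-(1/(4*x))) + (u0 x^2 + p0 x^2) * (Real.exp (-(1/(4*x))) * (-(-(1/(4*x^2))))))
    · intro x hx; exact (hρd x (by linarith)).mul (hinv x (by linarith)).neg.exp
    · intro x hx
      have := (abs_le.1 (hA x (by linarith))).1
      have e : (2 * u0 x * p0 x * (1/(4*x^2))) * Real.exp (-(1/(4*x))) + (u0 x^2 + p0 x^2) * (Real.exp (-(1/(4*x))) * (-(-(1/(4*x^2))))) = (2 * u0 x * p0 x + (u0 x^2 + p0 x^2)) * (1/(4*x^2) * Real.exp (-(1/(4*x)))) := by ring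
      rw [e]
      have : 0 ≤ 2 * u0 x * p0 x + (u0 x^2 + p0 x^2) := by linarith
      positivity
  have m4 : MonotoneOn (fun x => -((u0 x^2 + p0 x^2) * Real.exp (1/(4*x)))) (Set.Ici 1) := by
    apply mono_of_deriv _ (fun x => -((2 * u0 x * p0 x * (1/(4*x^2))) * Real.exp (1/(4*x)) + (u0 x^2 + p0 x^2) * (Real.exp (1/(4*x)) * (-(1/(4*x^2))))))
    · intro x hx; exact ((hρd x (by linarith)).mul (hinv x (by linarith)).exp).neg
    · intro x hx
      have := (abs_le.1 (hA x (by linarith))).2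
      have e : -((2 * u0 x * p0 x * (1/(4*x^2))) * Real.exp (1/(4*x)) + (u0 x^2 + p0 x^2) * (Real.exp (1/(4*x)) * (-(1/(4*x^2))))) = (u0 x^2 + p0 x^2 - 2 * u0 x * p0 x) * (1/(4*x^2) * Real.exp (1/(4*x))) := by ring
      rw [e]
      have : 0 ≤ u0 x^2 + p0 x^2 - 2 * u0 x * p0 x := by linarith
      positivity
  obtain ⟨L, hL, hL1, hL2⟩ := mono_conv _ 1 ((u0 1^2 + p0 1^2) * Real.exp (1/(4*1))) m3 (by
    intro x hx
    have := m4 (Set.mem_Ici.2 le_rfl) hx hx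
    simp only at this
    have h5 : 0 ≤ 1/(4*x) := by positivity
    have h6 : Real.exp (-(1/(4*x))) ≤ Real.exp (1/(4*x)) := Real.exp_le_exp.2 (by linarith)
    have h7 := hρ x (by linarith)
    have : (u0 x^2 + p0 x^2) * Real.exp (-(1/(4*x))) ≤ (u0 x^2 + p0 x^2) * Real.exp (1/(4*x)) := by gcongr
    linarith)
  have hLpos : 0 < L := lt_of_lt_of_le (by have := hρ 1 one_pos; positivity) hL1
  have hinv0 : Tendsto (fun x : ℝ => 1/(4*x)) atTop (𝓝 0) :=
    tendsto_const_nhds.div_atTop (tendsto_id.const_mul_atTop (by norm_num))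
  have hρL : Tendsto (fun x => u0 x^2 + p0 x^2) atTop (𝓝 L) := by
    have := hL.mul ((Real.continuous_exp.tendsto 0).comp hinv0)
    rw [Real.exp_zero, mul_one] at this
    refine this.congr (fun x => ?_)
    simp only [Function.comp]
    rw [mul_assoc, ← Real.exp_add]; simp
  have hr2 : ∀ x, 0 < x → r x ^2 = u0 x^2 + p0 x^2 := by
    intro x hx
    rw [(h3 x hx).1, (h3 x hx).2]
    linear_combination (-(r x^2)) * (Real.sin_sq_add_cos_sq (ψ x))
  have hr : Tendsto r atTop (𝓝 (√L)) := by
    refine hρL.sqrt.congr' ?_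
    filter_upwards [eventually_gt_atTop 0] with x hx
    rw [← hr2 x hx, Real.sqrt_sq (h2 x hx).le]
  -- the limit
  have hX : Tendsto (fun m : ℕ => (m * π + 3*π/4 : ℝ)) atTop atTop :=
    tendsto_atTop_add_const_right _ _ (tendsto_natCast_atTop_atTop.atTop_mul_const Real.pi_pos)
  have hcos : Tendsto (fun m : ℕ => Real.cos (ψ (m * π + 3*π/4) - (m * π + 3*π/4) + 3*π/4)^2) atTop (𝓝 (Real.cos (l + 3*π/4)^2)) := by
    have := (hl.comp hX).add_const (3*π/4)
    exact ((Real.continuous_cos.tendsto _).comp this).pow 2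
  have hcos0 : Tendsto (fun m : ℕ => Real.cos (ψ (m * π + 3*π/4) - (m * π + 3*π/4) + 3*π/4)^2) atTop (𝓝 0) := by
    have h5 := (j0_tendsto.pow 2).div (hρL.comp hX) hLpos.ne'
    rw [zero_pow two_ne_zero, zero_div] at h5
    refine h5.congr (fun m => ?_)
    have hx : 0 < m * π + 3*π/4 := by positivity
    simp only [Pi.div_apply, Function.comp]
    rw [← hr2 _ hx, ← u0, (h3 _ hx).1]
    have e : ψ (m * π + 3*π/4) - (m * π + 3*π/4) + 3*π/4 = ψ (m * π + 3*π/4) - m * π := by ring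
    have := (h2 _ hx).ne'
    rw [e, Real.cos_sub_nat_mul_pi, mul_pow, mul_pow, ← pow_mul (-1:ℝ), mul_comm m 2, pow_mul, neg_one_sq, one_pow, one_mul]
    exact mul_div_cancel_left₀ _ (pow_ne_zero 2 this)
  have hl0 : Real.cos (l + 3*π/4) = 0 := by
    have := tendsto_nhds_unique hcos hcos0
    exact pow_eq_zero_iff two_ne_zero |>.1 this
  have hleq : l = -(π/4) := by
    have hs : Real.sin (l + π/4) = 0 := by
      have : l + π/4 = l + 3*π/4 - π/2 := by ring
      rw [this, Real.sin_sub_pi_div_two, hl0, neg_zero]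
    have := (Real.sin_eq_zero_iff_of_lt_of_lt (by linarith [hψ1.1]) (by linarith [hψ1.2])).1 hs
    linarith
  rw [hleq] at hl
  refine ⟨ψ, r, √L, Real.sqrt_pos.2 hLpos, fun x hx => ⟨h2 x hx, h3 x hx⟩, hr, hl, ?_⟩
  intro x hx
  have hset : {t | 0 < t ∧ t ≤ x ∧ besselJ 0 t = 0} = {t | 1 < t ∧ t ≤ x ∧ -u0 t = 0} := by
    ext t
    constructor
    · rintro ⟨h5, h6, h7⟩
      refine ⟨?_, h6, by rw [u0, h7]; ring⟩
      by_contra hcon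
      have := bj_pos_small 0 h5 (by linarith); linarith
    · rintro ⟨h5, h6, h7⟩
      refine ⟨by linarith, h6, ?_⟩
      have hs : √t ≠ 0 := (Real.sqrt_pos.2 (by linarith)).ne'
      simpa [u0, hs] using h7
  rw [NJ, hset]
  have := cross_count2 p0 (fun t => - u0 t) (fun t => - -p0 t) r r (fun t => ψ t - π/2) 1 x hx
    (fun t ht => ((h4 t (one_pos.trans_le ht)).continuousAt.sub continuousAt_const).continuousWithinAt)
    (fun t ht => h2 t (one_pos.trans_le ht)) (fun t ht => h2 t (one_pos.trans ht)) (h2 1 one_pos)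
    (fun t ht => by rw [Real.cos_sub_pi_div_two]; exact (h3 t (one_pos.trans_le ht)).2)
    (fun t ht => by rw [Real.sin_sub_pi_div_two, (h3 t (one_pos.trans_le ht)).1]; ring)
    (fun t ht => (u0_hasDerivAt t (one_pos.trans_le ht)).neg)
    (fun t ht h => by
      have h5 : p0 t ≠ 0 := fun h5 => u0p0_ne t (one_pos.trans_le ht) ⟨by simpa using h, h5⟩
      have := sq_pos_of_ne_zero h5
      nlinarith)
  rw [this.2]
  have e1 : ⌊(ψ 1 - π/2)/π⌋ = -1 := by
    rw [Int.floor_eq_iff]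
    push_cast
    constructor
    · rw [le_div_iff₀ Real.pi_pos]; linarith
    · rw [div_lt_iff₀ Real.pi_pos]; linarith
  have e2 : (ψ x - π/2)/π = (ψ x / π + 1/2) - (1:ℤ) := by push_cast; field_simp; ring
  rw [e1, e2, Int.floor_sub_intCast]
  ring


noncomputable def yb (n : ℕ) (x : ℝ) : ℂ :=
  ((√x * besselJ n x : ℝ) + (√x * besselJ (n+1) x : ℝ) * Complex.I) * Complex.exp (-Complex.I * x)

open Filter Topology in
lemma bessel_limits : ∃ L : ℝ, 0 < L ∧
    (∀ n, Tendsto (yb n) atTop (𝓝 ((-Complex.I)^n * (L * Complex.exp (((-(π/4) : ℝ):ℂ) * Complex.I))))) ∧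
    ∀ᶠ j : ℕ in atTop, NJ 0 (2*π*j + π/2) = 2*j := by
  have hpi := Real.pi_pos
  obtain ⟨ψ, r, L, hL, h1, hr, hψ, hN⟩ := phase0
  refine ⟨L, hL, ?_, ?_⟩
  · intro n
    induction n with
    | zero =>
      rw [pow_zero, one_mul]
      have t1 : Tendsto (fun x => (r x : ℂ) * Complex.exp (((ψ x - x : ℝ):ℂ) * Complex.I)) atTop (𝓝 (L * Complex.exp (((-(π/4) : ℝ):ℂ) * Complex.I))) := by
        apply Tendsto.mul
        · exact (Complex.continuous_ofReal.tendsto _).comp hr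
        · have hc : Continuous (fun y : ℝ => Complex.exp ((y:ℂ) * Complex.I)) := by fun_prop
          exact (hc.tendsto _).comp hψ
      have t2 : Tendsto (fun x => ((r x * Real.cos (ψ x) / (2*x) : ℝ):ℂ) * (Complex.I * Complex.exp (-Complex.I * x))) atTop (𝓝 0) := by
        have hb : Tendsto (fun x => r x / (2*x)) atTop (𝓝 0) := hr.div_atTop (tendsto_id.const_mul_atTop (by norm_num))
        apply squeeze_zero_norm' _ hb
        filter_upwards [eventually_gt_atTop 0] with x hx
        rw [norm_mul, norm_mul, Complex.norm_I, norm_exp_I, mul_one, mul_one, Complex.norm_real, Real.norm_eq_abs, abs_div, abs_mul, abs_of_pos (h1 x hx).1, abs_of_pos (show 0 < 2*x by linarith)]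
        have := Real.abs_cos_le_one (ψ x)
        have := (h1 x hx).1
        gcongr
        nlinarith
      have t3 := t1.add t2
      rw [add_zero] at t3
      refine t3.congr' ?_
      filter_upwards [eventually_gt_atTop 0] with x hx
      have hs : √x ≠ 0 := (Real.sqrt_pos.2 hx).ne'
      obtain ⟨h2, h3, h4⟩ := h1 x hx
      have e1 : Complex.exp (((ψ x - x : ℝ):ℂ) * Complex.I) = ((Real.cos (ψ x) : ℝ) + (Real.sin (ψ x) : ℝ) * Complex.I) * Complex.exp (-Complex.I * x) := by
        rw [Complex.ofReal_cos, Complex.ofReal_sin, ← Complex.exp_mul_I, ← Complex.exp_add]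
        congr 1; push_cast; ring
      have e2 : √x * besselJ 0 x = r x * Real.cos (ψ x) := h3
      have e3 : √x * besselJ (0+1) x = r x * Real.sin (ψ x) + r x * Real.cos (ψ x) / (2*x) := by
        rw [← h4, ← h3, p0, u0]
        have := Real.sq_sqrt hx.le
        obtain ⟨s, hs'⟩ : ∃ s, s = √x := ⟨_, rfl⟩
        rw [← hs'] at this hs ⊢
        rw [← this]; simp only [zero_add]
        field_simp; ring
      rw [yb, e2, e3, e1]
      push_cast; ring
    | succ n ih =>
      have t1 := ih.const_mul (-Complex.I)
      have t2 : Tendsto (fun x => ((2 * (n+1) / x * (√x * besselJ (n+1) x) : ℝ):ℂ) * (Complex.I * Complex.exp (-Complex.I * x))) atTop (𝓝 0) := by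
        have hb : Tendsto (fun x => (2 * (n+1) / x : ℝ) * ‖yb n x‖) atTop (𝓝 0) := by
          have := (tendsto_const_nhds (x := (2 * ((n:ℝ)+1)))).div_atTop tendsto_id (l := atTop)
          have := this.mul ih.norm
          rw [zero_mul] at this
          exact this
        apply squeeze_zero_norm' _ hb
        filter_upwards [eventually_gt_atTop 0] with x hx
        rw [norm_mul, norm_mul, Complex.norm_I, norm_exp_I, mul_one, mul_one, Complex.norm_real, Real.norm_eq_abs, abs_mul, abs_of_nonneg (by positivity)]
        gcongr
        rw [yb, norm_mul, norm_exp_I, mul_one]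
        have := Complex.abs_im_le_norm (((√x * besselJ n x : ℝ):ℂ) + ((√x * besselJ (n+1) x : ℝ):ℂ) * Complex.I)
        simpa using this
      have t3 := t1.add t2
      rw [add_zero, ← mul_assoc, ← pow_succ'] at t3
      refine t3.congr' ?_
      filter_upwards [eventually_gt_atTop 0] with x hx
      rw [yb, yb, bj_rec3 n x hx.ne']
      push_cast
      linear_combination (-(√x:ℂ) * besselJ (n+1) x * Complex.exp (-Complex.I * x)) * Complex.I_sq
  · have hX : Tendsto (fun j : ℕ => (2*π*j + π/2 : ℝ)) atTop atTop :=
      tendsto_atTop_add_const_right _ _ (tendsto_natCast_atTop_atTop.const_mul_atTop (by positivity))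
    have h2 := (hψ.comp hX).eventually (Ioo_mem_nhds (show -(π/2) < -(π/4) by linarith) (show -(π/4) < 0 by linarith))
    filter_upwards [h2, hX.eventually (eventually_ge_atTop 1)] with j hj hj1
    have h3 := hN _ hj1
    have : ⌊ψ (2*π*j + π/2) / π + 1/2⌋ = 2*j := by
      simp only [Function.comp] at hj
      obtain ⟨h5, h6⟩ := hj
      rw [Int.floor_eq_iff]
      push_cast
      have e : ψ (2*π*j + π/2) / π + 1/2 = (ψ (2*π*j + π/2) + π/2) / π := by field_simp
      rw [e, le_div_iff₀ hpi, div_lt_iff₀ hpi]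
      constructor <;> linarith
    rw [this] at h3
    exact_mod_cast h3

open Filter Topology in
lemma counts_at_X {σ : ℝ} (hσ : 0 < σ) (n : ℕ) :
    ∀ᶠ j : ℕ in atTop, NZ σ n (2*π*j + π/2) + (n+1)/2 = 2*j+1 := by
  have hpi := Real.pi_gt_three
  obtain ⟨L, hL, hy, h0⟩ := bessel_limits
  have hX : Tendsto (fun j : ℕ => (2*π*j + π/2 : ℝ)) atTop atTop :=
    tendsto_atTop_add_const_right _ _ (tendsto_natCast_atTop_atTop.const_mul_atTop (by positivity))
  have hexp : ∀ j : ℕ, Complex.exp (-Complex.I * ((2*π*j + π/2 : ℝ):ℂ)) = -Complex.I := by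
    intro j
    have : -Complex.I * ((2*π*j + π/2 : ℝ):ℂ) = -(j * (2*π*Complex.I) + (π/2) * Complex.I) := by push_cast; ring
    rw [this, Complex.exp_neg, Complex.exp_add, Complex.exp_nat_mul, Complex.exp_two_pi_mul_I, one_pow, one_mul, Complex.exp_pi_div_two_mul_I, Complex.inv_I]
  have hsq : ∀ n : ℕ, Tendsto (fun j : ℕ => (((√(2*π*j + π/2) * besselJ n (2*π*j + π/2) : ℝ):ℂ) + (√(2*π*j + π/2) * besselJ (n+1) (2*π*j + π/2) : ℝ) * Complex.I)^2) atTop (𝓝 ((((-1)^n * L^2 : ℝ):ℂ) * Complex.I)) := by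
    intro n
    have h := (((hy n).comp hX).pow 2).neg
    have e1 : -(((-Complex.I)^n * (L * Complex.exp (((-(π/4) : ℝ):ℂ) * Complex.I)))^2) = (((-1)^n * L^2 : ℝ):ℂ) * Complex.I := by
      rw [mul_pow, ← pow_mul, mul_comm n 2, pow_mul, mul_pow, ← Complex.exp_nat_mul]
      have : ((2:ℕ):ℂ) * (((-(π/4) : ℝ):ℂ) * Complex.I) = -(π/2 * Complex.I) := by push_cast; ring
      rw [this, Complex.exp_neg, Complex.exp_pi_div_two_mul_I, neg_sq, Complex.I_sq, Complex.inv_I]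
      push_cast; ring
    rw [e1] at h
    refine h.congr (fun j => ?_)
    simp only [Function.comp, yb, hexp]
    rw [mul_pow, neg_sq, Complex.I_sq]; ring
  have hprod : ∀ n : ℕ, Tendsto (fun j : ℕ => (2*π*j + π/2) * (besselJ n (2*π*j + π/2) * besselJ (n+1) (2*π*j + π/2))) atTop (𝓝 ((-1)^n * L^2 / 2)) := by
    intro n
    have h := ((Complex.continuous_im.tendsto _).comp (hsq n)).div_const 2
    have e1 : ((((-1)^n * L^2 : ℝ):ℂ) * Complex.I).im = (-1)^n * L^2 := by
      rw [Complex.im_ofReal_mul]; simp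
    rw [e1] at h
    refine h.congr (fun j => ?_)
    have hx : 0 ≤ 2*π*j + π/2 := by positivity
    have := Real.mul_self_sqrt hx
    simp only [Function.comp]
    rw [pow_two, Complex.mul_im]
    simp only [Complex.add_re, Complex.add_im, Complex.mul_re, Complex.mul_im, Complex.ofReal_re, Complex.ofReal_im, Complex.I_re, Complex.I_im]
    linear_combination (besselJ n (2*π*j + π/2) * besselJ (n+1) (2*π*j + π/2)) * this
  have hbd : ∀ n : ℕ, Tendsto (fun j : ℕ => besselJ n (2*π*j + π/2)^2) atTop (𝓝 0) := by
    intro n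
    have h := (hsq n).norm.div_atTop hX
    apply squeeze_zero' (Eventually.of_forall (fun j => sq_nonneg _)) _ h
    filter_upwards with j
    have hx : 0 < 2*π*j + π/2 := by positivity
    rw [le_div_iff₀ hx, norm_pow, ← Complex.normSq_eq_norm_sq, Complex.normSq_apply]
    have := Real.mul_self_sqrt hx.le
    simp
    nlinarith [mul_self_nonneg (√(2*π*j + π/2) * besselJ (n+1) (2*π*j + π/2))]
  have hNJ : ∀ n : ℕ, ∀ᶠ j : ℕ in atTop, NJ n (2*π*j + π/2) + n/2 = 2*j := by
    intro n
    induction n with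
    | zero => simpa using h0
    | succ n ih =>
      rcases Nat.even_or_odd n with he | ho
      · have h := hprod n
        rw [he.neg_one_pow, one_mul] at h
        filter_upwards [ih, h.eventually (lt_mem_nhds (show 0 < L^2/2 by positivity)), hX.eventually (eventually_ge_atTop 1)] with j h1 h2 h3
        have := (NJ_step n _ h3).1 (pos_of_mul_pos_right h2 (by linarith))
        obtain ⟨k, rfl⟩ := he
        omega
      · have h := hprod n
        rw [ho.neg_one_pow] at h
        filter_upwards [ih, h.eventually (gt_mem_nhds (show -1 * L^2/2 < 0 by nlinarith [sq_pos_of_pos hL])), hX.eventually (eventually_ge_atTop 1)] with j h1 h2 h3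
        have := (NJ_step n _ h3).2 (by
          by_contra hcon; push Not at hcon
          have := mul_nonneg (show (0:ℝ) ≤ 2*π*j + π/2 by linarith) hcon
          linarith)
        obtain ⟨k, rfl⟩ := ho
        omega
  have hφ : Tendsto (fun j : ℕ => phiRobin σ n (2*π*j + π/2) * besselJ n (2*π*j + π/2)) atTop (𝓝 (-((-1)^n * L^2 / 2))) := by
    have h := ((hbd n).const_mul (n+σ)).sub (hprod n)
    rw [mul_zero, zero_sub] at h
    refine h.congr (fun j => ?_)
    rw [phi_eq, bv]; ring
  rcases Nat.even_or_odd n with he | ho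
  · rw [he.neg_one_pow] at hφ
    filter_upwards [hNJ n, hφ.eventually (gt_mem_nhds (show -(1 * L^2/2) < 0 by nlinarith [sq_pos_of_pos hL])), hX.eventually (eventually_ge_atTop (π/2))] with j h1 h2 h3
    have := (NZ_step hσ n _ h3).2.2 h2
    obtain ⟨k, rfl⟩ := he
    omega
  · rw [ho.neg_one_pow] at hφ
    filter_upwards [hNJ n, hφ.eventually (lt_mem_nhds (show 0 < -(-1 * L^2/2) by nlinarith [sq_pos_of_pos hL])), hX.eventually (eventually_ge_atTop (π/2))] with j h1 h2 h3
    have := (NZ_step hσ n _ h3).2.1 h2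
    obtain ⟨k, rfl⟩ := ho
    omega


open Filter Topology in
lemma ode_abstract (W W' : ℝ → ℂ) (β β' : ℝ → ℝ) (a : ℝ) (w : ℂ)
    (hW : ∀ x, a ≤ x → HasDerivAt W (W' x) x) (hβ : ∀ x, a ≤ x → HasDerivAt β (β' x) x)
    (hβ0 : ∀ x, a ≤ x → β' x ≤ 0) (hb : ∀ x, a ≤ x → 0 ≤ β x ∧ β x ≤ 1/4)
    (hWb : ∀ x, a ≤ x → ‖W' x‖ ≤ 2 * (-β' x) * ‖W x‖)
    (hl : Tendsto W atTop (𝓝 w)) (hβl : Tendsto β atTop (𝓝 0)) :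
    ‖W a‖ ≤ 2 * ‖w‖ ∧ ‖W a - w‖ ≤ 4 * ‖w‖ * β a := by
  have m1 : MonotoneOn (fun x => ‖W x‖^2 * Real.exp (-(4 * β x))) (Set.Ici a) := by
    apply mono_of_deriv _ (fun x => (2 * inner ℝ (W x) (W' x)) * Real.exp (-(4 * β x)) + ‖W x‖^2 * (Real.exp (-(4 * β x)) * (-(4 * β' x))))
    · intro x hx
      exact (hW x hx).norm_sq.mul ((hβ x hx).const_mul 4).neg.exp
    · intro x hx
      have h1 := abs_le.1 (abs_real_inner_le_norm (W x) (W' x))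
      have h2 := hWb x hx
      have h3 : ‖W x‖ * ‖W' x‖ ≤ ‖W x‖ * (2 * (-β' x) * ‖W x‖) := by gcongr
      have e : (2 * inner ℝ (W x) (W' x)) * Real.exp (-(4 * β x)) + ‖W x‖^2 * (Real.exp (-(4 * β x)) * (-(4 * β' x))) = (2 * inner ℝ (W x) (W' x) + ‖W x‖^2 * (-(4 * β' x))) * Real.exp (-(4 * β x)) := by ring
      rw [e]
      apply mul_nonneg _ (Real.exp_pos _).le
      nlinarith [h1.1]
  have hlim : Tendsto (fun x => ‖W x‖^2 * Real.exp (-(4 * β x))) atTop (𝓝 (‖w‖^2)) := by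
    have h1 := (hl.norm.pow 2).mul ((Real.continuous_exp.tendsto _).comp (hβl.const_mul 4).neg)
    simpa using h1
  have hWn : ∀ x, a ≤ x → ‖W x‖ ≤ 2 * ‖w‖ := by
    intro x hx
    have h1 : ‖W x‖^2 * Real.exp (-(4 * β x)) ≤ ‖w‖^2 := by
      apply ge_of_tendsto hlim
      filter_upwards [eventually_ge_atTop x] with y hy
      exact m1 hx (Set.mem_Ici.2 (hx.trans hy)) hy
    have h2 : Real.exp (-1) ≤ Real.exp (-(4 * β x)) := Real.exp_le_exp.2 (by linarith [(hb x hx).2])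
    have h3 : (1/4:ℝ) ≤ Real.exp (-1) := by
      rw [Real.exp_neg, ← one_div, div_le_div_iff₀ (by norm_num) (Real.exp_pos _)]
      have := Real.exp_one_lt_d9
      linarith
    have h4 : ‖W x‖^2 * (1/4) ≤ ‖W x‖^2 * Real.exp (-(4 * β x)) := by gcongr; linarith
    nlinarith [norm_nonneg w, norm_nonneg (W x)]
  refine ⟨hWn a le_rfl, ?_⟩
  have key : ∀ x, a ≤ x → ‖W x - W a‖ ≤ 4 * ‖w‖ * (β a - β x) := by
    intro x hx
    have := image_norm_le_of_norm_deriv_right_le_deriv_boundary' (a := a) (b := x)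
      (f := fun y => W y - W a) (f' := W') (B := fun y => 4 * ‖w‖ * (β a - β y)) (B' := fun y => 4 * ‖w‖ * (-β' y))
      (fun y hy => ((hW y hy.1).sub_const (W a)).continuousAt.continuousWithinAt)
      (fun y hy => ((hW y hy.1).sub_const (W a)).hasDerivWithinAt)
      (by simp)
      (fun y hy => (((hβ y hy.1).const_sub (β a)).const_mul (4 * ‖w‖)).continuousAt.continuousWithinAt)
      (fun y hy => (((hβ y hy.1).const_sub (β a)).const_mul (4 * ‖w‖)).hasDerivWithinAt)
      (fun y hy => by
        refine (hWb y hy.1).trans ?_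
        have h1 := hWn y hy.1
        have h2 : 0 ≤ -β' y := by linarith [hβ0 y hy.1]
        have : 2 * (-β' y) * ‖W y‖ ≤ 2 * (-β' y) * (2 * ‖w‖) := by gcongr
        linarith)
    exact this (Set.right_mem_Icc.2 hx)
  have h1 : Tendsto (fun x => ‖W x - W a‖) atTop (𝓝 ‖w - W a‖) := (hl.sub_const (W a)).norm
  have h2 : Tendsto (fun x => 4 * ‖w‖ * (β a - β x)) atTop (𝓝 (4 * ‖w‖ * (β a - 0))) := (hβl.const_sub (β a)).const_mul (4 * ‖w‖)
  rw [sub_zero] at h2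
  rw [norm_sub_rev]
  apply le_of_tendsto_of_tendsto h1 h2
  filter_upwards [eventually_ge_atTop a] with x hx using key x hx

noncomputable def sqn (n : ℕ) (x : ℝ) : ℝ := √(x^2 - n^2)
noncomputable def hqn (n : ℕ) (x : ℝ) : ℝ := √(sqn n x)
noncomputable def thn (n : ℕ) (x : ℝ) : ℝ := sqn n x - n * Real.arccos (n / x)
noncomputable def ben (n : ℕ) (x : ℝ) : ℝ := x^2 / (4 * sqn n x ^ 3)
noncomputable def ben' (n : ℕ) (x : ℝ) : ℝ := -((x^3 + 2 * x * n^2) / (4 * sqn n x ^ 5))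

lemma q_pos {n : ℕ} {x : ℝ} (h : (n:ℝ) < x) : 0 < x^2 - (n:ℝ)^2 := by
  have : (0:ℝ) ≤ n := Nat.cast_nonneg n
  nlinarith

lemma sqn_pos {n : ℕ} {x : ℝ} (h : (n:ℝ) < x) : 0 < sqn n x := Real.sqrt_pos.2 (q_pos h)
lemma hqn_pos {n : ℕ} {x : ℝ} (h : (n:ℝ) < x) : 0 < hqn n x := Real.sqrt_pos.2 (sqn_pos h)
lemma sqn_sq {n : ℕ} {x : ℝ} (h : (n:ℝ) < x) : sqn n x ^2 = x^2 - n^2 := Real.sq_sqrt (q_pos h).le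
lemma hqn_sq {n : ℕ} {x : ℝ} (h : (n:ℝ) < x) : hqn n x ^2 = sqn n x := Real.sq_sqrt (sqn_pos h).le

lemma sqn_hasDerivAt {n : ℕ} {x : ℝ} (h : (n:ℝ) < x) : HasDerivAt (sqn n) (x / sqn n x) x := by
  have h1 : HasDerivAt (fun x : ℝ => x^2 - (n:ℝ)^2) (2*x) x := by
    simpa using (hasDerivAt_pow 2 x).sub_const ((n:ℝ)^2)
  refine HasDerivAt.congr_deriv (f := sqn n) (h1.sqrt (q_pos h).ne') ?_
  have := sqn_pos h
  unfold sqn at *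
  field_simp

lemma hqn_hasDerivAt {n : ℕ} {x : ℝ} (h : (n:ℝ) < x) : HasDerivAt (hqn n) (hqn n x * (x / (2 * sqn n x ^ 2))) x := by
  have h1 := (sqn_hasDerivAt h).sqrt (sqn_pos h).ne'
  refine HasDerivAt.congr_deriv (f := hqn n) h1 ?_
  have h2 := sqn_pos h
  have h3 := hqn_pos h
  have h4 := hqn_sq h
  change x / sqn n x / (2 * hqn n x) = _
  field_simp
  rw [h4]

lemma thn_hasDerivAt {n : ℕ} {x : ℝ} (h : (n:ℝ) < x) : HasDerivAt (thn n) (sqn n x / x) x := by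
  have hn : (0:ℝ) ≤ n := Nat.cast_nonneg n
  have hx : 0 < x := by linarith
  have h1 : HasDerivAt (fun x : ℝ => (n:ℝ)/x) (-(n/x^2)) x := by
    refine ((hasDerivAt_const x (n:ℝ)).div (hasDerivAt_id x) hx.ne').congr_deriv ?_
    simp only [id]; field_simp; ring
  have hlt : (n:ℝ)/x < 1 := (div_lt_one hx).2 h
  have hge : 0 ≤ (n:ℝ)/x := by positivity
  have h2 := ((Real.hasDerivAt_arccos (by linarith : (n:ℝ)/x ≠ -1) hlt.ne).comp x h1)
  have h3 := (sqn_hasDerivAt h).sub (h2.const_mul (n:ℝ))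
  refine HasDerivAt.congr_deriv (f := thn n) h3 ?_
  have h4 := sqn_pos h
  have e : √(1 - ((n:ℝ)/x)^2) = sqn n x / x := by
    rw [sqn, ← Real.sqrt_sq hx.le, ← Real.sqrt_div' _ (by positivity), Real.sqrt_sq hx.le]
    congr 1; field_simp
  rw [e]
  have := sqn_sq h
  field_simp
  linarith

lemma ben_hasDerivAt {n : ℕ} {x : ℝ} (h : (n:ℝ) < x) : HasDerivAt (ben n) (ben' n x) x := by
  have h4 := sqn_pos h
  have h1 := (hasDerivAt_pow 2 x).div (((sqn_hasDerivAt h).pow 3).const_mul 4) (by simp only [Pi.pow_apply]; positivity)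
  refine HasDerivAt.congr_deriv (f := ben n) h1 ?_
  have h5 := sqn_sq h
  simp only [Pi.pow_apply]
  rw [ben', div_eq_iff (by positivity)]
  push_cast
  field_simp
  obtain ⟨s, hs⟩ : ∃ s, s = sqn n x := ⟨_, rfl⟩
  rw [← hs] at h5 ⊢
  linear_combination (2 * x : ℝ) * h5

/-- z and its conjugate -/
noncomputable def zn (n : ℕ) (x : ℝ) : ℂ := ((hqn n x * besselJ n x : ℝ):ℂ) - ((bv n x / hqn n x : ℝ):ℂ) * Complex.I
noncomputable def zbn (n : ℕ) (x : ℝ) : ℂ := ((hqn n x * besselJ n x : ℝ):ℂ) + ((bv n x / hqn n x : ℝ):ℂ) * Complex.I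

lemma zbn_norm (n : ℕ) (x : ℝ) : ‖zbn n x‖ = ‖zn n x‖ := by
  have : zbn n x = (starRingEnd ℂ) (zn n x) := by
    simp [zbn, zn]
  rw [this, Complex.norm_conj]

lemma zn_re_hasDerivAt {n : ℕ} {x : ℝ} (h : (n:ℝ) < x) : HasDerivAt (fun x => hqn n x * besselJ n x)
    (x / (2 * sqn n x^2) * (hqn n x * besselJ n x) + sqn n x / x * (bv n x / hqn n x)) x := by
  have hn : (0:ℝ) ≤ n := Nat.cast_nonneg n
  have hx : 0 < x := by linarith
  refine ((hqn_hasDerivAt h).mul (bj_hasDerivAt n hx.ne')).congr_deriv ?_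
  have h2 := sqn_pos h
  have h3 := hqn_pos h
  rw [← hqn_sq h] at *
  field_simp

lemma zn_im_hasDerivAt {n : ℕ} {x : ℝ} (h : (n:ℝ) < x) : HasDerivAt (fun x => bv n x / hqn n x)
    (-(x / (2 * sqn n x^2)) * (bv n x / hqn n x) - sqn n x / x * (hqn n x * besselJ n x)) x := by
  have hn : (0:ℝ) ≤ n := Nat.cast_nonneg n
  have hx : 0 < x := by linarith
  refine ((bv_hasDerivAt n hx.ne').div (hqn_hasDerivAt h) (hqn_pos h).ne').congr_deriv ?_
  have h3 := hqn_pos h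
  rw [← sqn_sq h, ← hqn_sq h]
  field_simp
  ring

lemma zn_hasDerivAt {n : ℕ} {x : ℝ} (h : (n:ℝ) < x) : HasDerivAt (zn n)
    (((x / (2 * sqn n x^2) : ℝ):ℂ) * zbn n x + Complex.I * ((sqn n x / x : ℝ):ℂ) * zn n x) x := by
  refine ((zn_re_hasDerivAt h).ofReal_comp.sub ((zn_im_hasDerivAt h).ofReal_comp.mul_const Complex.I)).congr_deriv ?_
  rw [zbn, zn]
  push_cast
  linear_combination (((sqn n x : ℂ) / x) * ((bv n x : ℂ) / (hqn n x : ℂ))) * Complex.I_sq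

lemma zbn_hasDerivAt {n : ℕ} {x : ℝ} (h : (n:ℝ) < x) : HasDerivAt (zbn n)
    (((x / (2 * sqn n x^2) : ℝ):ℂ) * zn n x - Complex.I * ((sqn n x / x : ℝ):ℂ) * zbn n x) x := by
  refine ((zn_re_hasDerivAt h).ofReal_comp.add ((zn_im_hasDerivAt h).ofReal_comp.mul_const Complex.I)).congr_deriv ?_
  rw [zbn, zn]
  push_cast
  linear_combination (((sqn n x : ℂ) / x) * ((bv n x : ℂ) / (hqn n x : ℂ))) * Complex.I_sq

noncomputable def Wn (n : ℕ) (x : ℝ) : ℂ := Complex.exp (-Complex.I * ((thn n x : ℝ):ℂ)) * (zn n x - Complex.I * ((ben n x : ℝ):ℂ) * zbn n x)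
noncomputable def Wn' (n : ℕ) (x : ℝ) : ℂ := Complex.exp (-Complex.I * ((thn n x : ℝ):ℂ)) *
  (-Complex.I * ((ben' n x : ℝ):ℂ) * zbn n x - Complex.I * ((ben n x * (x / (2 * sqn n x^2)) : ℝ):ℂ) * zn n x)

lemma Wn_hasDerivAt {n : ℕ} {x : ℝ} (h : (n:ℝ) < x) : HasDerivAt (Wn n) (Wn' n x) x := by
  have hn : (0:ℝ) ≤ n := Nat.cast_nonneg n
  have hx : 0 < x := by linarith
  have h1 := ((thn_hasDerivAt h).ofReal_comp.const_mul (-Complex.I)).cexp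
  have h2 := (zn_hasDerivAt h).sub (((ben_hasDerivAt h).ofReal_comp.const_mul Complex.I).mul (zbn_hasDerivAt h))
  refine HasDerivAt.congr_deriv (f := Wn n) (h1.mul h2) ?_
  have h3 := sqn_pos h
  have e : ben n x * (sqn n x / x) = x / (2 * sqn n x^2) / 2 := by
    unfold ben; field_simp; norm_num
  have e' : ((ben n x : ℝ):ℂ) * ((sqn n x / x : ℝ):ℂ) = ((x / (2 * sqn n x^2) : ℝ):ℂ) / 2 := by
    rw [← Complex.ofReal_mul, e]; push_cast; rfl
  rw [Wn']
  rw [Complex.ofReal_mul (ben n x)]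
  generalize ((ben n x : ℝ):ℂ) = b at *
  generalize ((ben' n x : ℝ):ℂ) = b' at *
  generalize ((sqn n x / x : ℝ):ℂ) = t at *
  generalize ((x / (2 * sqn n x^2) : ℝ):ℂ) = m at *
  generalize Complex.exp (-Complex.I * ((thn n x : ℝ):ℂ)) = c at *
  generalize zn n x = z at *
  generalize zbn n x = zb at *
  linear_combination (-2 * c * zb) * e' + (2 * c * b * t * zb) * Complex.I_sq


lemma norm_exp_negI (y : ℝ) : ‖Complex.exp (-Complex.I * (y:ℂ))‖ = 1 := by
  have : -Complex.I * (y:ℂ) = ((-y : ℝ):ℂ) * Complex.I := by push_cast; ring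
  rw [this, Complex.norm_exp_ofReal_mul_I]

noncomputable def wn (n : ℕ) (x : ℝ) : ℂ := Complex.exp (-Complex.I * ((thn n x : ℝ):ℂ)) * zn n x

lemma wn_norm (n : ℕ) (x : ℝ) : ‖wn n x‖ = ‖zn n x‖ := by
  rw [wn, norm_mul, norm_exp_negI, one_mul]

lemma ben_nonneg (n : ℕ) (x : ℝ) : 0 ≤ ben n x := by
  unfold ben sqn; positivity

lemma Wn_sub_wn (n : ℕ) (x : ℝ) : ‖wn n x - Wn n x‖ = ben n x * ‖zn n x‖ := by
  have : wn n x - Wn n x = Complex.exp (-Complex.I * ((thn n x : ℝ):ℂ)) * (Complex.I * ((ben n x : ℝ):ℂ) * zbn n x) := by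
    rw [wn, Wn]; ring
  rw [this, norm_mul, norm_exp_negI, one_mul, norm_mul, norm_mul, Complex.norm_I, one_mul, zbn_norm, Complex.norm_real, Real.norm_of_nonneg (ben_nonneg n x)]

lemma ben'_nonpos {n : ℕ} {x : ℝ} (h : (n:ℝ) < x) : ben' n x ≤ 0 := by
  have hn : (0:ℝ) ≤ n := Nat.cast_nonneg n
  have hx : 0 < x := by linarith
  have := sqn_pos h
  unfold ben'
  have : 0 ≤ (x ^ 3 + 2 * x * ↑n ^ 2) / (4 * sqn n x ^ 5) := by positivity
  linarith

lemma Wn'_bound {n : ℕ} {x : ℝ} (h : (n:ℝ) < x) (hb : ben n x ≤ 1/4) : ‖Wn' n x‖ ≤ 2 * (-ben' n x) * ‖Wn n x‖ := by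
  have hn : (0:ℝ) ≤ n := Nat.cast_nonneg n
  have hx : 0 < x := by linarith
  have hs := sqn_pos h
  have hb' := ben'_nonpos h
  have hb0 := ben_nonneg n x
  have hm : 0 ≤ ben n x * (x / (2 * sqn n x^2)) := by positivity
  have h1 : ben n x * (x / (2 * sqn n x^2)) ≤ (1/2) * (-ben' n x) := by
    rw [ben, ben', neg_neg]
    have : x ^ 2 / (4 * sqn n x ^ 3) * (x / (2 * sqn n x ^ 2)) = 1/2 * (x^3 / (4 * sqn n x ^ 5)) := by
      field_simp
      try norm_num
    rw [this]
    gcongr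
    nlinarith [mul_nonneg hx.le (sq_nonneg (n:ℝ))]
  have h2 : ‖Wn' n x‖ ≤ (-ben' n x) * ‖zn n x‖ + ben n x * (x / (2 * sqn n x^2)) * ‖zn n x‖ := by
    rw [Wn', norm_mul, norm_exp_negI, one_mul]
    refine (norm_sub_le _ _).trans ?_
    rw [norm_mul, norm_mul, norm_mul, norm_mul, norm_neg, Complex.norm_I, one_mul, one_mul, zbn_norm, Complex.norm_real, Complex.norm_real,
      Real.norm_of_nonneg hm, Real.norm_of_nonpos hb']
  have h3 : ‖zn n x‖ ≤ (4/3) * ‖Wn n x‖ := by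
    have h4 := Wn_sub_wn n x
    have h5 := wn_norm n x
    have h6 := norm_sub_norm_le (wn n x) (Wn n x)
    have : ben n x * ‖zn n x‖ ≤ 1/4 * ‖zn n x‖ := by gcongr
    linarith
  calc ‖Wn' n x‖ ≤ (3/2) * (-ben' n x) * ‖zn n x‖ := by
        refine h2.trans ?_
        have : ben n x * (x / (2 * sqn n x^2)) * ‖zn n x‖ ≤ (1/2) * (-ben' n x) * ‖zn n x‖ := by gcongr
        linarith
    _ ≤ (3/2) * (-ben' n x) * ((4/3) * ‖Wn n x‖) := by
        have : 0 ≤ -ben' n x := by linarith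
        gcongr
    _ = _ := by ring

lemma ben_anti {n : ℕ} {a x : ℝ} (h : (n:ℝ) < a) (hax : a ≤ x) : ben n x ≤ ben n a := by
  have := mono_of_deriv (fun x => -ben n x) (fun x => -ben' n x) a
    (fun x hx => (ben_hasDerivAt (h.trans_le hx)).neg) (fun x hx => by have := ben'_nonpos (h.trans_le hx); linarith)
  have := this (Set.mem_Ici.2 le_rfl) (Set.mem_Ici.2 hax) hax
  simp only at this
  linarith

noncomputable def rhn (n : ℕ) (x : ℝ) : ℝ := √(√(1 - ((n:ℝ)/x)^2))

lemma rhn_pos {n : ℕ} {x : ℝ} (h : (n:ℝ) < x) : 0 < rhn n x := by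
  have hn : (0:ℝ) ≤ n := Nat.cast_nonneg n
  have hx : 0 < x := by linarith
  have hlt : (n:ℝ)/x < 1 := (div_lt_one hx).2 h
  have hge : 0 ≤ (n:ℝ)/x := by positivity
  apply Real.sqrt_pos.2 (Real.sqrt_pos.2 (by nlinarith))

lemma sqn_rhn {n : ℕ} {x : ℝ} (h : (n:ℝ) < x) : sqn n x = x * rhn n x^2 := by
  have hn : (0:ℝ) ≤ n := Nat.cast_nonneg n
  have hx : 0 < x := by linarith
  rw [rhn, Real.sq_sqrt (Real.sqrt_nonneg _), sqn]
  have : x^2 - (n:ℝ)^2 = x^2 * (1 - ((n:ℝ)/x)^2) := by field_simp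
  rw [this, Real.sqrt_mul (by positivity), Real.sqrt_sq hx.le]

lemma hqn_rhn {n : ℕ} {x : ℝ} (h : (n:ℝ) < x) : hqn n x = √x * rhn n x := by
  have hn : (0:ℝ) ≤ n := Nat.cast_nonneg n
  have hx : 0 < x := by linarith
  rw [hqn, sqn_rhn h, Real.sqrt_mul hx.le, Real.sqrt_sq (rhn_pos h).le]

open Filter Topology

lemma ndiv_tendsto (n : ℕ) : Tendsto (fun x : ℝ => (n:ℝ)/x) atTop (𝓝 0) := tendsto_const_nhds.div_atTop tendsto_id

lemma rhn_tendsto (n : ℕ) : Tendsto (rhn n) atTop (𝓝 1) := by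
  have h1 := ((((ndiv_tendsto n).pow 2).const_sub 1).sqrt).sqrt
  have e : √√(1 - (0:ℝ)^2) = 1 := by norm_num
  rw [e] at h1
  exact h1

lemma ben_tendsto (n : ℕ) : Tendsto (ben n) atTop (𝓝 0) := by
  have h1 : Tendsto (fun x : ℝ => (1/x) * (1/(4 * rhn n x^6))) atTop (𝓝 (0 * (1/(4*1^6)))) := by
    apply Tendsto.mul
    · exact tendsto_const_nhds.div_atTop tendsto_id
    · exact tendsto_const_nhds.div (((rhn_tendsto n).pow 6).const_mul 4) (by norm_num)
  rw [zero_mul] at h1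
  refine h1.congr' ?_
  filter_upwards [eventually_gt_atTop (n:ℝ)] with x hx
  have hn : (0:ℝ) ≤ n := Nat.cast_nonneg n
  have hx0 : 0 < x := by linarith
  rw [ben, sqn_rhn hx]
  have := rhn_pos hx
  field_simp

lemma thn_tendsto (n : ℕ) : Tendsto (fun x => x - thn n x) atTop (𝓝 (n * (π/2))) := by
  have h1 : Tendsto (fun x : ℝ => (n:ℝ) * ((n:ℝ)/x) * (1 / (1 + rhn n x^2)) + n * Real.arccos ((n:ℝ)/x)) atTop (𝓝 (n * 0 * (1 / (1 + 1^2)) + n * Real.arccos 0)) := by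
    apply Tendsto.add
    · apply Tendsto.mul ((ndiv_tendsto n).const_mul _)
      exact tendsto_const_nhds.div (((rhn_tendsto n).pow 2).const_add 1) (by norm_num)
    · exact ((Real.continuous_arccos.tendsto 0).comp (ndiv_tendsto n)).const_mul _
  rw [Real.arccos_zero, mul_zero, zero_mul, zero_add] at h1
  refine h1.congr' ?_
  filter_upwards [eventually_gt_atTop (n:ℝ)] with x hx
  have hn : (0:ℝ) ≤ n := Nat.cast_nonneg n
  have hx0 : 0 < x := by linarith
  have h2 := sqn_sq hx
  rw [thn]
  rw [sqn_rhn hx] at *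
  have := rhn_pos hx
  generalize Real.arccos (↑n/x) = A
  generalize rhn n x = r at *
  field_simp
  linear_combination h2

lemma wn_tendsto {L : ℝ} (hy : ∀ n, Tendsto (yb n) atTop (𝓝 ((-Complex.I)^n * (L * Complex.exp (((-(π/4) : ℝ):ℂ) * Complex.I))))) (n : ℕ) :
    Tendsto (wn n) atTop (𝓝 (L * Complex.exp (((-(π/4) : ℝ):ℂ) * Complex.I))) := by
  have hε : Tendsto (fun x : ℝ => (|rhn n x - 1| + |1/rhn n x - 1| + (n:ℝ)/x * (1/rhn n x)) * ‖yb n x‖) atTop (𝓝 0) := by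
    have a1 : Tendsto (fun x => |rhn n x - 1|) atTop (𝓝 |1 - 1|) := ((rhn_tendsto n).sub_const 1).abs
    have a2 : Tendsto (fun x => 1/rhn n x) atTop (𝓝 (1/1)) := tendsto_const_nhds.div (rhn_tendsto n) (by norm_num)
    have a3 : Tendsto (fun x => |1/rhn n x - 1|) atTop (𝓝 |1/1 - 1|) := (a2.sub_const 1).abs
    have := ((a1.add a3).add ((ndiv_tendsto n).mul a2)).mul (hy n).norm
    simpa using this
  have hd : Tendsto (fun x : ℝ => zn n x * Complex.exp (-Complex.I * x) - yb n x) atTop (𝓝 0) := by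
    refine squeeze_zero_norm' ?_ hε
    filter_upwards [eventually_gt_atTop (n:ℝ)] with x hx
    have hn : (0:ℝ) ≤ n := Nat.cast_nonneg n
    have hx0 : 0 < x := by linarith
    have hr := rhn_pos hx
    obtain ⟨a, ha⟩ : ∃ a, a = √x * besselJ n x := ⟨_, rfl⟩
    obtain ⟨b, hb⟩ : ∃ b, b = √x * besselJ (n+1) x := ⟨_, rfl⟩
    have hyn : ‖yb n x‖ = ‖(a:ℂ) + b * Complex.I‖ := by rw [yb, norm_mul, norm_exp_negI, mul_one, ha, hb]
    have hA : |a| ≤ ‖yb n x‖ := by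
      rw [hyn]; simpa using Complex.abs_re_le_norm ((a:ℂ) + b * Complex.I)
    have hB : |b| ≤ ‖yb n x‖ := by
      rw [hyn]; simpa using Complex.abs_im_le_norm ((a:ℂ) + b * Complex.I)
    have hs : 0 < √x := Real.sqrt_pos.2 hx0
    have hss : √x^2 = x := Real.sq_sqrt hx0.le
    have e1 : hqn n x * besselJ n x = rhn n x * a := by rw [hqn_rhn hx, ha]; ring
    have e2 : bv n x / hqn n x = (n:ℝ)/x * (1/rhn n x) * a - 1/rhn n x * b := by
      rw [hqn_rhn hx, ha, hb, bv]
      generalize rhn n x = r at *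
      generalize √x = s at *
      rw [← hss]
      field_simp
    have e3 : zn n x * Complex.exp (-Complex.I * x) - yb n x =
      (((rhn n x - 1) * a : ℝ) + ((1/rhn n x - 1) * b : ℝ) * Complex.I - (((n:ℝ)/x * (1/rhn n x) * a : ℝ):ℂ) * Complex.I) * Complex.exp (-Complex.I * x) := by
      rw [zn, e1, e2, yb, ← ha, ← hb]
      push_cast
      ring
    rw [e3, norm_mul, norm_exp_negI, mul_one]
    refine (norm_sub_le _ _).trans ?_
    refine (add_le_add_left (norm_add_le _ _) _).trans ?_
    rw [norm_mul, norm_mul, Complex.norm_I, mul_one, mul_one, Complex.norm_real, Complex.norm_real, Complex.norm_real, Real.norm_eq_abs, Real.norm_eq_abs, Real.norm_eq_abs, abs_mul, abs_mul, abs_mul _ a, abs_of_nonneg (show 0 ≤ (n:ℝ)/x * (1/rhn n x) by positivity), add_mul, add_mul]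
    gcongr
  have h2 : Tendsto (fun x : ℝ => zn n x * Complex.exp (-Complex.I * x)) atTop (𝓝 ((-Complex.I)^n * (L * Complex.exp (((-(π/4) : ℝ):ℂ) * Complex.I)))) := by
    simpa using hd.add (hy n)
  have h3 : Tendsto (fun x : ℝ => Complex.exp (Complex.I * ((x - thn n x : ℝ):ℂ))) atTop (𝓝 (Complex.exp (Complex.I * ((n * (π/2) : ℝ):ℂ)))) := by
    have : Continuous (fun y : ℝ => Complex.exp (Complex.I * (y:ℂ))) := by fun_prop
    exact (this.tendsto _).comp (thn_tendsto n)
  have h4 := h2.mul h3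
  have e : (-Complex.I)^n * (L * Complex.exp (((-(π/4) : ℝ):ℂ) * Complex.I)) * Complex.exp (Complex.I * ((n * (π/2) : ℝ):ℂ)) = L * Complex.exp (((-(π/4) : ℝ):ℂ) * Complex.I) := by
    have : Complex.exp (Complex.I * ((n * (π/2) : ℝ):ℂ)) = Complex.I^n := by
      have := Complex.exp_nat_mul (π/2*Complex.I) n
      rw [Complex.exp_pi_div_two_mul_I] at this
      rw [← this]
      congr 1; push_cast; ring
    rw [this]
    have : (-Complex.I)^n * Complex.I^n = 1 := by
      rw [← mul_pow]; simp
    linear_combination (L * Complex.exp (((-(π/4) : ℝ):ℂ) * Complex.I)) * this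
  rw [e] at h4
  refine h4.congr ?_
  intro x
  rw [wn, mul_assoc, ← Complex.exp_add, mul_comm]
  congr 2
  push_cast; ring

lemma wn_est {L : ℝ} (hL : 0 < L) (hy : ∀ n, Tendsto (yb n) atTop (𝓝 ((-Complex.I)^n * (L * Complex.exp (((-(π/4) : ℝ):ℂ) * Complex.I)))))
    {n : ℕ} {a : ℝ} (h : (n:ℝ) < a) (hb : ben n a ≤ 1/4) :
    ‖wn n a‖ ≤ 3 * L ∧ ‖wn n a - L * Complex.exp (((-(π/4) : ℝ):ℂ) * Complex.I)‖ ≤ 7 * L * ben n a := by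
  set w := (L:ℂ) * Complex.exp (((-(π/4) : ℝ):ℂ) * Complex.I) with hw
  have hwn : ‖w‖ = L := by rw [hw, norm_mul, Complex.norm_exp_ofReal_mul_I, mul_one, Complex.norm_real, Real.norm_of_nonneg hL.le]
  have hwt := wn_tendsto hy n
  have hWt : Tendsto (Wn n) atTop (𝓝 w) := by
    have h0 : Tendsto (fun x => wn n x - Wn n x) atTop (𝓝 0) := by
      rw [tendsto_zero_iff_norm_tendsto_zero]
      have := (ben_tendsto n).mul hwt.norm
      rw [zero_mul] at this
      refine this.congr ?_
      intro x; rw [Wn_sub_wn, wn_norm]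
    have := hwt.sub h0
    rw [sub_zero] at this
    exact this.congr (fun x => by ring)
  have := ode_abstract (Wn n) (Wn' n) (ben n) (ben' n) a w
    (fun x hx => Wn_hasDerivAt (h.trans_le hx)) (fun x hx => ben_hasDerivAt (h.trans_le hx))
    (fun x hx => ben'_nonpos (h.trans_le hx)) (fun x hx => ⟨ben_nonneg n x, (ben_anti h hx).trans hb⟩)
    (fun x hx => Wn'_bound (h.trans_le hx) ((ben_anti h hx).trans hb)) hWt (ben_tendsto n)
  rw [hwn] at this
  obtain ⟨h1, h2⟩ := this
  have h3 := Wn_sub_wn n a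
  have h4 := wn_norm n a
  have h5 := norm_sub_norm_le (wn n a) (Wn n a)
  have h6 : ben n a * ‖zn n a‖ ≤ 1/4 * ‖zn n a‖ := by gcongr
  have h7 : ‖wn n a‖ ≤ 3 * L := by linarith
  refine ⟨h7, ?_⟩
  calc ‖wn n a - w‖ = ‖(wn n a - Wn n a) + (Wn n a - w)‖ := by congr 1; ring
    _ ≤ _ := norm_add_le _ _
    _ ≤ ben n a * (3 * L) + 4 * L * ben n a := by
        rw [h3, ← h4]
        have := ben_nonneg n a
        gcongr
    _ = _ := by ring

open Filter Topology

lemma key_phase {L : ℝ} (hL : 0 < L) (hy : ∀ n, Tendsto (yb n) atTop (𝓝 ((-Complex.I)^n * (L * Complex.exp (((-(π/4) : ℝ):ℂ) * Complex.I)))))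
    {σ : ℝ} (hσ : 0 < σ) {n : ℕ} {a : ℝ} (h : (n:ℝ) < a) (hb : (7 + 12*σ) * ben n a ≤ 1/2) :
    ∃ e R : ℝ → ℝ, ContinuousOn e (Set.Ici a) ∧ ∀ x, a ≤ x → |e x| ≤ 3/2 * ((7 + 12*σ) * ben n x) ∧ 0 < R x ∧
      hqn n x * besselJ n x = R x * Real.cos (thn n x - π/4 + e x) ∧
      -(phiRobin σ n x) / hqn n x = R x * Real.sin (thn n x - π/4 + e x) := by
  obtain ⟨w, hw⟩ : ∃ w, w = (L:ℂ) * Complex.exp (((-(π/4) : ℝ):ℂ) * Complex.I) := ⟨_, rfl⟩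
  have hwn : ‖w‖ = L := by rw [hw, norm_mul, Complex.norm_exp_ofReal_mul_I, mul_one, Complex.norm_real, Real.norm_of_nonneg hL.le]
  have hw0 : w ≠ 0 := by rw [← norm_pos_iff, hwn]; exact hL
  obtain ⟨ζ, hζ⟩ : ∃ ζ : ℝ → ℂ, ζ = fun x => ((hqn n x * besselJ n x : ℝ):ℂ) + ((-(phiRobin σ n x) / hqn n x : ℝ):ℂ) * Complex.I := ⟨_, rfl⟩
  obtain ⟨ξ, hξ⟩ : ∃ ξ : ℝ → ℂ, ξ = fun x => Complex.exp (-Complex.I * ((thn n x : ℝ):ℂ)) * ζ x / w := ⟨_, rfl⟩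
  have hbx : ∀ x, a ≤ x → (7 + 12*σ) * ben n x ≤ 1/2 := by
    intro x hx
    refine le_trans ?_ hb
    have := ben_anti h hx
    gcongr
  have hest : ∀ x, a ≤ x → ‖ξ x - 1‖ ≤ (7 + 12*σ) * ben n x := by
    intro x hx
    have hnx := h.trans_le hx
    have hn : (0:ℝ) ≤ n := Nat.cast_nonneg n
    have hx0 : 0 < x := by linarith
    have hb0 := ben_nonneg n x
    have hb4 : ben n x ≤ 1/4 := by nlinarith [hbx x hx, mul_nonneg hσ.le hb0]
    obtain ⟨e1, e2⟩ := wn_est hL hy hnx hb4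
    rw [← hw] at e2
    have hs := sqn_pos hnx
    have hh := hqn_pos hnx
    have hh2 := hqn_sq hnx
    have e3 : ξ x - 1 = ((wn n x - w) - Complex.exp (-Complex.I * ((thn n x : ℝ):ℂ)) * (((σ * besselJ n x / hqn n x : ℝ):ℂ) * Complex.I)) / w := by
      rw [eq_div_iff hw0, sub_mul, hξ]
      simp only
      rw [div_mul_cancel₀ _ hw0, hζ, wn, zn]
      simp only [phi_eq]
      push_cast
      ring
    have e4 : |hqn n x * besselJ n x| ≤ 3 * L := by
      refine le_trans ?_ e1
      rw [wn_norm]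
      have := Complex.abs_re_le_norm (zn n x)
      simpa [zn] using this
    have e5 : 1 / sqn n x ≤ 4 * ben n x := by
      rw [ben, div_le_iff₀ hs]
      have h1 : sqn n x ^2 ≤ x^2 := by rw [sqn_sq hnx]; nlinarith
      have : 4 * (x ^ 2 / (4 * sqn n x ^ 3)) * sqn n x = x^2 / sqn n x^2 := by field_simp
      rw [this, le_div_iff₀ (by positivity)]
      linarith
    have e6 : |σ * besselJ n x / hqn n x| ≤ 12 * σ * L * ben n x := by
      have : σ * besselJ n x / hqn n x = σ * (hqn n x * besselJ n x) * (1 / sqn n x) := by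
        rw [← hh2]; field_simp
      rw [this, abs_mul, abs_mul, abs_of_pos hσ, abs_of_pos (by positivity : 0 < 1 / sqn n x)]
      calc σ * |hqn n x * besselJ n x| * (1 / sqn n x) ≤ σ * (3 * L) * (4 * ben n x) := by gcongr
        _ = _ := by ring
    rw [e3, norm_div, hwn, div_le_iff₀ hL]
    refine (norm_sub_le _ _).trans ?_
    rw [norm_mul, norm_exp_negI, one_mul, norm_mul, Complex.norm_I, mul_one, Complex.norm_real, Real.norm_eq_abs]
    nlinarith
  have hre : ∀ x, a ≤ x → 0 < (ξ x).re := by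
    intro x hx
    have h1 := Complex.abs_re_le_norm (ξ x - 1)
    have h2 := abs_le.1 (h1.trans ((hest x hx).trans (hbx x hx)))
    simp at h2
    linarith
  refine ⟨fun x => (ξ x).arg, fun x => L * ‖ξ x‖, ?_, ?_⟩
  · intro x hx
    have hx' : a ≤ x := hx
    have hnx := h.trans_le hx'
    have hn : (0:ℝ) ≤ n := Nat.cast_nonneg n
    have hx0 : 0 < x := by linarith
    apply ContinuousAt.continuousWithinAt
    have c1 : ContinuousAt ξ x := by
      have c2 := (hqn_hasDerivAt hnx).continuousAt
      have c3 := (thn_hasDerivAt hnx).continuousAt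
      have c4 := (bj_hasDerivAt n hx0.ne').continuousAt
      have c5 := (phi_hasDerivAt σ n hx0.ne').continuousAt
      have c6 : ContinuousAt (fun x => hqn n x * besselJ n x) x := c2.mul c4
      have c7 : ContinuousAt (fun x => -(phiRobin σ n x) / hqn n x) x := c5.neg.div c2 (hqn_pos hnx).ne'
      rw [hξ, hζ]
      refine ContinuousAt.div_const (ContinuousAt.mul ?_ ?_) _
      · exact (ContinuousAt.mul continuousAt_const (Complex.continuous_ofReal.continuousAt.comp c3)).cexp
      · exact (Complex.continuous_ofReal.continuousAt.comp c6).add ((Complex.continuous_ofReal.continuousAt.comp c7).mul continuousAt_const)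
    exact ContinuousAt.comp (g := Complex.arg) (Complex.continuousAt_arg (Or.inl (hre x hx'))) c1
  · intro x hx
    have hnx := h.trans_le hx
    have hr := hre x hx
    have hx1 : ξ x ≠ 0 := by intro h0; rw [h0] at hr; simp at hr
    have hE := hest x hx
    refine ⟨?_, mul_pos hL (norm_pos_iff.2 hx1), ?_⟩
    · have h1 := Complex.norm_log_one_add_half_le_self (hE.trans (hbx x hx))
      rw [add_sub_cancel] at h1
      have h2 := Complex.abs_im_le_norm (Complex.log (ξ x))
      rw [Complex.log_im] at h2
      linarith
    · have e1 : ζ x = ((L * ‖ξ x‖ : ℝ):ℂ) * Complex.exp (((thn n x - π/4 + (ξ x).arg : ℝ):ℂ) * Complex.I) := by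
        have h1 : Complex.exp (-Complex.I * ((thn n x : ℝ):ℂ)) * ζ x = ξ x * w := by
          rw [hξ]; simp only; rw [div_mul_cancel₀ _ hw0]
        have h2 := Complex.norm_mul_exp_arg_mul_I (ξ x)
        have h3 : Complex.exp (((thn n x : ℝ):ℂ) * Complex.I) * Complex.exp (-Complex.I * ((thn n x : ℝ):ℂ)) = 1 := by
          rw [← Complex.exp_add, ← Complex.exp_zero]; congr 1; ring
        have h4 : Complex.exp (((thn n x - π/4 + (ξ x).arg : ℝ):ℂ) * Complex.I) = Complex.exp (((thn n x : ℝ):ℂ) * Complex.I) * Complex.exp (((-(π/4) : ℝ):ℂ) * Complex.I) * Complex.exp ((ξ x).arg * Complex.I) := by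
          rw [← Complex.exp_add, ← Complex.exp_add]; congr 1; push_cast; ring
        rw [h4]
        push_cast at *
        calc ζ x = Complex.exp (((thn n x : ℝ):ℂ) * Complex.I) * (Complex.exp (-Complex.I * ((thn n x : ℝ):ℂ)) * ζ x) := by rw [← mul_assoc, h3, one_mul]
          _ = Complex.exp (((thn n x : ℝ):ℂ) * Complex.I) * ((‖ξ x‖ * Complex.exp ((ξ x).arg * Complex.I)) * w) := by rw [h1, h2]
          _ = _ := by rw [hw]; ring
      have e2 : ζ x = ((L * ‖ξ x‖ * Real.cos (thn n x - π/4 + (ξ x).arg) : ℝ):ℂ) + ((L * ‖ξ x‖ * Real.sin (thn n x - π/4 + (ξ x).arg) : ℝ):ℂ) * Complex.I := by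
        rw [e1, Complex.exp_mul_I]; push_cast; ring
      rw [hζ] at e2
      simp only at e2
      have e3 := fun a b c d : ℝ => fun (hh : (a:ℂ) + (b:ℂ) * Complex.I = c + d * Complex.I) => (show a = c ∧ b = d by
        constructor
        · simpa using congrArg Complex.re hh
        · simpa using congrArg Complex.im hh)
      exact e3 _ _ _ _ e2

lemma X_floor (n j : ℕ) (y : ℝ) (hy : |y| < 1/8) : ⌊2*(j:ℝ) + 1/4 - (n:ℝ)/2 + y⌋ = 2*(j:ℤ) - (((n+1)/2 : ℕ):ℤ) := by
  have h0 := abs_lt.1 hy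
  rcases Nat.even_or_odd n with ⟨m, hm⟩ | ⟨m, hm⟩
  · have h1 : (n+1)/2 = m := by omega
    rw [h1, hm, Int.floor_eq_iff]
    push_cast
    constructor <;> linarith
  · have h1 : (n+1)/2 = m+1 := by omega
    rw [h1, hm, Int.floor_eq_iff]
    push_cast
    constructor <;> linarith

lemma NZ_split {σ : ℝ} (hσ : 0 < σ) (n : ℕ) {a x : ℝ} (ha : 0 ≤ a) (hax : a ≤ x) (hx : π/2 ≤ x) :
    NZ σ n x = NZ σ n a + {t | a < t ∧ t ≤ x ∧ -phiRobin σ n t = 0}.ncard := by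
  have hf := (NZ_step hσ n x hx).1
  have hf1 : {t | 0 < t ∧ t ≤ a ∧ phiRobin σ n t = 0}.Finite := hf.subset (fun t ⟨h1, h2, h3⟩ => ⟨h1, h2.trans hax, h3⟩)
  have hf2 : {t | a < t ∧ t ≤ x ∧ -phiRobin σ n t = 0}.Finite := hf.subset (fun t ⟨h1, h2, h3⟩ => ⟨ha.trans_lt h1, h2, by simpa using h3⟩)
  rw [NZ, NZ, ← Set.ncard_union_eq (hs := hf1) (ht := hf2)]
  · congr 1
    ext t
    simp only [Set.mem_ofPred_eq, Set.mem_union, neg_eq_zero]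
    constructor
    · rintro ⟨h1, h2, h3⟩
      rcases le_or_gt t a with h | h
      · exact Or.inl ⟨h1, h, h3⟩
      · exact Or.inr ⟨h, h2, h3⟩
    · rintro (⟨h1, h2, h3⟩ | ⟨h1, h2, h3⟩)
      · exact ⟨h1, h2.trans hax, h3⟩
      · exact ⟨ha.trans_lt h1, h2, h3⟩
  · rw [Set.disjoint_left]
    rintro t ⟨h1, h2, h3⟩ ⟨h4, h5, h6⟩
    linarith

theorem key_count {σ : ℝ} (hσ : 0 < σ) (n : ℕ) (a : ℝ) (h : (n:ℝ) < a) (hb : (7 + 12*σ) * ben n a ≤ 1/2) :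
    ∃ e : ℝ, |e| ≤ (7 + 12*σ) * ben n a ∧ (NZ σ n a : ℤ) = ⌊thn n a / π + 3/4 + e⌋ := by
  have hpi := Real.pi_gt_three
  have hn : (0:ℝ) ≤ n := Nat.cast_nonneg n
  have ha0 : 0 < a := by linarith
  obtain ⟨L, hL, hy, -⟩ := bessel_limits
  obtain ⟨e, R, hec, hall⟩ := key_phase hL hy hσ h hb
  have hb0 := fun x => ben_nonneg n x
  have hX : Tendsto (fun j : ℕ => (2*π*j + π/2 : ℝ)) atTop atTop :=
    tendsto_atTop_add_const_right _ _ (tendsto_natCast_atTop_atTop.const_mul_atTop (by positivity))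
  have he0 : Tendsto e atTop (𝓝 0) := by
    have : Tendsto (fun x => 3/2 * ((7 + 12*σ) * ben n x)) atTop (𝓝 0) := by
      simpa using ((ben_tendsto n).const_mul (7 + 12*σ)).const_mul (3/2)
    refine squeeze_zero_norm' ?_ this
    filter_upwards [eventually_ge_atTop a] with x hx using (hall x hx).1
  have herr : Tendsto (fun x => (e x - (x - thn n x - n*(π/2)))/π) atTop (𝓝 0) := by
    have := (he0.sub ((thn_tendsto n).sub_const (n*(π/2)))).div_const π
    simpa using this
  have hsm : ∀ᶠ x in atTop, |(e x - (x - thn n x - n*(π/2)))/π| < 1/8 := by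
    have := herr.abs
    rw [abs_zero] at this
    exact this.eventually_lt_const (by norm_num)
  obtain ⟨j, hj1, hj2, hj3⟩ := ((counts_at_X hσ n).and ((hX.eventually hsm).and (hX.eventually (eventually_ge_atTop a)))).exists
  set X := 2*π*(j:ℝ) + π/2 with hXd
  have hXpi : π/2 ≤ X := by rw [hXd]; have : 0 ≤ 2*π*(j:ℝ) := by positivity
                            linarith
  have hsplit := NZ_split hσ n ha0.le hj3 hXpi
  have hcc := (cross_count2 (besselJ n) (fun t => -phiRobin σ n t) (fun x => -(-((x^2-n^2)/x)*besselJ n x + σ*(bv n x/x)))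
    (fun t => R t / hqn n t) (fun t => R t * hqn n t) (fun t => thn n t - π/4 + e t) a X hj3
    (ContinuousOn.add (ContinuousOn.sub (fun t ht => (thn_hasDerivAt (h.trans_le ht)).continuousAt.continuousWithinAt) continuousOn_const) hec)
    (fun t ht => div_pos (hall t ht).2.1 (hqn_pos (h.trans_le ht)))
    (fun t ht => mul_pos (hall t ht.le).2.1 (hqn_pos (h.trans_le ht.le)))
    (mul_pos (hall a le_rfl).2.1 (hqn_pos h))
    (fun t ht => by
      have := hqn_pos (h.trans_le ht)
      have h2 := (hall t ht).2.2.1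
      rw [div_mul_eq_mul_div, ← h2]; field_simp)
    (fun t ht => by
      have := hqn_pos (h.trans_le ht)
      have h2 := (hall t ht).2.2.2
      rw [mul_right_comm, ← h2]; field_simp)
    (fun t ht => (phi_hasDerivAt σ n (ha0.trans_le ht).ne').neg)
    (fun t ht h0 => by
      have ht0 := ha0.trans_le ht
      have h1 : phiRobin σ n t = 0 := by simpa using h0
      have h2 : besselJ n t ≠ 0 := fun h2 => phi_bj_not_both σ n ht0 ⟨h1, h2⟩
      rw [phi_eq] at h1
      have h3 : bv n t = -σ * besselJ n t := by linarith
      rw [h3]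
      have h4 := q_pos (h.trans_le ht)
      have h5 : -(-((t^2-(n:ℝ)^2)/t)*besselJ n t + σ*(-σ * besselJ n t/t)) * besselJ n t = (t^2 - n^2 + σ^2)/t * besselJ n t^2 := by
        field_simp; ring
      rw [h5]
      positivity)).2
  rw [hsplit] at hj1
  have hfl := X_floor n j _ hj2
  have e1 : (thn n X - π/4 + e X)/π = 2*(j:ℝ) + 1/4 - (n:ℝ)/2 + (e X - (X - thn n X - n*(π/2)))/π := by
    have hX' : X = 2*π*(j:ℝ) + π/2 := hXd
    field_simp
    rw [hX']; ring
  rw [e1, hfl] at hcc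
  refine ⟨e a / π, ?_, ?_⟩
  · rw [abs_div, abs_of_pos Real.pi_pos, div_le_iff₀ Real.pi_pos]
    have := (hall a le_rfl).1
    nlinarith [mul_nonneg (by positivity : 0 ≤ 7 + 12*σ) (hb0 a)]
  · have e2 : thn n a / π + 3/4 + e a / π = (thn n a - π/4 + e a)/π + 1 := by field_simp; ring
    rw [e2, Int.floor_add_one]
    have hj1' : ((NZ σ n a : ℤ) + ({t | a < t ∧ t ≤ X ∧ -phiRobin σ n t = 0}.ncard : ℤ)) + (((n+1)/2 : ℕ):ℤ) = 2 * (j:ℤ) + 1 := by exact_mod_cast hj1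
    omega

open Filter Topology

lemma thn_zero {n : ℕ} {x : ℝ} (hx : 0 < x) (h : x ≤ n) : thn n x = 0 := by
  rw [thn, sqn, Real.sqrt_eq_zero_of_nonpos (by nlinarith), Real.arccos_of_one_le ((one_le_div hx).2 h)]
  simp

lemma sin_conc {α β : ℝ} (h0 : 0 ≤ α) (h : α ≤ β) (hβ : β ≤ π) : (β - α) * Real.cos β ≤ Real.sin β - Real.sin α := by
  rcases h.eq_or_lt with h | h
  · subst h; simp
  · obtain ⟨c, hc, hc2⟩ := exists_hasDerivAt_eq_slope Real.sin Real.cos h Real.continuous_sin.continuousOn (fun x _ => Real.hasDerivAt_sin x)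
    rw [eq_div_iff (by linarith)] at hc2
    rw [← hc2, mul_comm]
    have := Real.cos_le_cos_of_nonneg_of_le_pi (h0.trans hc.1.le) hβ hc.2.le
    have h' : 0 ≤ β - α := by linarith
    gcongr

lemma par_n {n : ℕ} {x : ℝ} (h : (n:ℝ) < x) : (n:ℝ) = x * Real.cos (Real.arccos (n/x)) ∧ sqn n x = x * Real.sin (Real.arccos (n/x)) := by
  have hn : (0:ℝ) ≤ n := Nat.cast_nonneg n
  have hx : 0 < x := by linarith
  have hlt : (n:ℝ)/x < 1 := (div_lt_one hx).2 h
  have hge : 0 ≤ (n:ℝ)/x := by positivity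
  constructor
  · rw [Real.cos_arccos (by linarith) hlt.le]; field_simp
  · rw [Real.sin_arccos, sqn]
    have : x^2 - (n:ℝ)^2 = x^2 * (1 - ((n:ℝ)/x)^2) := by field_simp
    rw [this, Real.sqrt_mul (by positivity), Real.sqrt_sq hx.le]

lemma thn_nonneg {n : ℕ} {x : ℝ} (hx : 0 < x) : 0 ≤ thn n x := by
  rcases le_or_gt x n with h | h
  · rw [thn_zero hx h]
  · obtain ⟨h1, h2⟩ := par_n h
    have := sin_conc le_rfl (Real.arccos_nonneg (n/x)) (Real.arccos_le_pi _)
    rw [Real.sin_zero, sub_zero, sub_zero] at this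
    rw [thn, h2]
    nth_rewrite 2 [h1]
    nlinarith

lemma thn_mono {n : ℕ} {x y : ℝ} (hx : 0 < x) (h : x ≤ y) : thn n x ≤ thn n y := by
  rcases le_or_gt x n with h1 | h1
  · rw [thn_zero hx h1]; exact thn_nonneg (hx.trans_le h)
  · exact mono_of_deriv (thn n) (fun x => sqn n x / x) x (fun t ht => thn_hasDerivAt (h1.trans_le ht))
      (fun t ht => by have := sqn_pos (h1.trans_le ht); have := hx.trans_le ht; positivity) (Set.mem_Ici.2 le_rfl) (Set.mem_Ici.2 h) h

lemma arccos_ge {n : ℕ} {x : ℝ} (h : (n:ℝ) < x) : sqn n x / x ≤ Real.arccos (n/x) := by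
  have hn : (0:ℝ) ≤ n := Nat.cast_nonneg n
  have hx : 0 < x := by linarith
  rw [(par_n h).2, mul_div_cancel_left₀ _ hx.ne']
  exact Real.sin_le (Real.arccos_nonneg _)

lemma thn_le {n : ℕ} {x : ℝ} (h : (n:ℝ) < x) : thn n x ≤ sqn n x ^3 / x^2 := by
  have hn : (0:ℝ) ≤ n := Nat.cast_nonneg n
  have hx : 0 < x := by linarith
  have h1 := arccos_ge h
  have h2 := sqn_pos h
  have h3 := sqn_sq h
  have h4 : (n:ℝ) * (sqn n x / x) ≤ n * Real.arccos (n/x) := by gcongr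
  rw [thn]
  have h5 : sqn n x - n * (sqn n x / x) ≤ sqn n x ^3 / x^2 := by
    rw [le_div_iff₀ (by positivity)]
    have : (sqn n x - n * (sqn n x / x)) * x^2 = sqn n x * (x * (x - n)) := by field_simp
    rw [this, pow_succ', h3]
    gcongr
    nlinarith
  linarith

lemma thn_diff {n m : ℕ} {x : ℝ} (hnm : n < m) (h : (m:ℝ) < x) : ((m:ℝ) - n) * (sqn m x / x) ≤ thn n x - thn m x := by
  have hn : (0:ℝ) ≤ n := Nat.cast_nonneg n
  have hnm' : (n:ℝ) < m := by exact_mod_cast hnm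
  have hx : 0 < x := by linarith
  have hnx : (n:ℝ) < x := by linarith
  obtain ⟨a1, a2⟩ := par_n h
  obtain ⟨b1, b2⟩ := par_n hnx
  have h1 := arccos_ge h
  have h2 : ((m:ℝ) - n) * (sqn m x / x) ≤ ((m:ℝ) - n) * Real.arccos (m/x) := by
    have : 0 ≤ (m:ℝ) - n := by linarith
    gcongr
  refine h2.trans ?_
  have h3 : Real.arccos (m/x) ≤ Real.arccos (n/x) := Real.arccos_le_arccos (by gcongr)
  have h4 := sin_conc (Real.arccos_nonneg (m/x)) h3 (Real.arccos_le_pi _)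
  rw [thn, thn, a2, b2]
  generalize Real.arccos (m/x) = α at *
  generalize Real.arccos (n/x) = β at *
  rw [a1, b1]
  nlinarith

lemma thn_incr {n : ℕ} {x y : ℝ} (h : (n:ℝ) < x) (hxy : x ≤ y) : (y - x) * (sqn n x / y) ≤ thn n y - thn n x := by
  have hn : (0:ℝ) ≤ n := Nat.cast_nonneg n
  have hx : 0 < x := by linarith
  rcases hxy.eq_or_lt with h1 | h1
  · subst h1; simp
  · obtain ⟨c, hc, hc2⟩ := exists_hasDerivAt_eq_slope (thn n) (fun x => sqn n x / x) h1
      (fun t ht => (thn_hasDerivAt (h.trans_le ht.1)).continuousAt.continuousWithinAt) (fun t ht => thn_hasDerivAt (h.trans ht.1))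
    rw [eq_div_iff (by linarith)] at hc2
    rw [← hc2, mul_comm]
    have h2 : sqn n x ≤ sqn n c := Real.sqrt_le_sqrt (by nlinarith [hc.1])
    have h3 := sqn_pos h
    have h4 : 0 < c := hx.trans hc.1
    have h' : 0 ≤ y - x := by linarith
    have := hc.2.le
    have h5 : 0 ≤ sqn n c := h3.le.trans h2
    gcongr

noncomputable def Gn (n : ℕ) (x : ℝ) : ℤ := ⌊thn n x / π + 3/4⌋

lemma Gn_nonneg {n : ℕ} {x : ℝ} (hx : 0 < x) : 0 ≤ Gn n x := by
  apply Int.floor_nonneg.2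
  have := thn_nonneg (n := n) hx
  positivity

lemma Gn_zero {n : ℕ} {x : ℝ} (hx : 0 < x) (h : x ≤ n) : Gn n x = 0 := by
  rw [Gn, thn_zero hx h]; norm_num

lemma Gn_mono {n : ℕ} {x y : ℝ} (hx : 0 < x) (h : x ≤ y) : Gn n x ≤ Gn n y := by
  apply Int.floor_le_floor
  have := thn_mono (n := n) hx h
  have := Real.pi_pos
  gcongr

lemma NZ_fin {σ : ℝ} (hσ : 0 < σ) (n : ℕ) (x : ℝ) : {t | 0 < t ∧ t ≤ x ∧ phiRobin σ n t = 0}.Finite :=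
  (NZ_step hσ n (max x (π/2)) (le_max_right _ _)).1.subset (fun _ ⟨h1, h2, h3⟩ => ⟨h1, h2.trans (le_max_left _ _), h3⟩)

lemma NZ_mono {σ : ℝ} (hσ : 0 < σ) {n : ℕ} {x y : ℝ} (h : x ≤ y) : NZ σ n x ≤ NZ σ n y :=
  Set.ncard_le_ncard (fun _ ⟨h1, h2, h3⟩ => ⟨h1, h2.trans h, h3⟩) (NZ_fin hσ n y)

lemma NZ_zero {σ : ℝ} (hσ : 0 < σ) {n : ℕ} {x : ℝ} (h : x ≤ n) : NZ σ n x = 0 := by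
  rw [NZ]
  convert Set.ncard_empty ℝ
  ext t
  simp only [Set.mem_ofPred_eq, Set.mem_empty_iff_false, iff_false]
  rintro ⟨h1, h2, h3⟩
  exact (phi_pos hσ n h1 (h2.trans h)).ne' h3

lemma NZ_Gn_close {σ : ℝ} (hσ : 0 < σ) {n : ℕ} {x : ℝ} (h : (n:ℝ) < x) :
    |((NZ σ n x : ℤ):ℝ) - Gn n x| ≤ (7 + 12*σ) + 2 := by
  have hn : (0:ℝ) ≤ n := Nat.cast_nonneg n
  have hx : 0 < x := by linarith
  have hpi := Real.pi_gt_three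
  rcases le_or_gt ((7 + 12*σ) * ben n x) (1/2) with hb | hb
  · obtain ⟨e, he, heq⟩ := key_count hσ n x h hb
    rw [heq, Gn, abs_le]
    have h1 := Int.floor_le (thn n x / π + 3/4 + e)
    have h2 := Int.lt_floor_add_one (thn n x / π + 3/4 + e)
    have h3 := Int.floor_le (thn n x / π + 3/4)
    have h4 := Int.lt_floor_add_one (thn n x / π + 3/4)
    have h5 := abs_le.1 (he.trans hb)
    constructor <;> linarith
  · -- the other case
    have hY : ∀ᶠ y in atTop, (7 + 12*σ) * ben n y < 1/2 := by
      have := (ben_tendsto n).const_mul (7 + 12*σ)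
      rw [mul_zero] at this
      exact this.eventually_lt_const (by norm_num)
    obtain ⟨Y, hY1, hY2⟩ := (hY.and (eventually_ge_atTop x)).exists
    have hc : ContinuousOn (fun y => (7 + 12*σ) * ben n y) (Set.Icc x Y) :=
      fun t ht => ((ben_hasDerivAt (h.trans_le ht.1)).continuousAt.continuousWithinAt).const_mul _
    obtain ⟨z, hz, hz2⟩ := intermediate_value_Icc' hY2 hc ⟨hY1.le, hb.le⟩
    simp only at hz2
    have hz0 : 0 < z := hx.trans_le hz.1
    have hnz := h.trans_le hz.1
    obtain ⟨e, he, heq⟩ := key_count hσ n z hnz hz2.le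
    have hs := sqn_pos hnz
    have t1 := thn_le hnz
    have t2 : sqn n z ^3 / z^2 = (7 + 12*σ)/2 := by
      rw [ben] at hz2
      field_simp at hz2 ⊢
      linarith
    have t3 := thn_mono (n := n) hx hz.1
    have t4 : thn n z / π ≤ (7 + 12*σ)/2 := by
      rw [div_le_iff₀ Real.pi_pos]
      nlinarith
    have t5 : thn n x / π ≤ thn n z / π := by have := Real.pi_pos; gcongr
    have t6 : ((NZ σ n z : ℤ):ℝ) ≤ (7 + 12*σ)/2 + 3/4 + 1/2 := by
      rw [heq]
      have h1 := Int.floor_le (thn n z / π + 3/4 + e)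
      have h5 := abs_le.1 (he.trans hz2.le)
      linarith
    have t7 : ((NZ σ n x : ℤ):ℝ) ≤ ((NZ σ n z : ℤ):ℝ) := by
      have := NZ_mono hσ (n := n) hz.1
      exact_mod_cast this
    have t8 : (Gn n x : ℝ) ≤ (7 + 12*σ)/2 + 3/4 := by
      have h3 := Int.floor_le (thn n x / π + 3/4)
      rw [Gn]; linarith
    have t9 : (0:ℝ) ≤ Gn n x := by exact_mod_cast Gn_nonneg hx
    have t10 : (0:ℝ) ≤ ((NZ σ n x : ℤ):ℝ) := by positivity
    rw [abs_le]
    constructor <;> linarith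

lemma fib_count {α : Type*} (P : ℤ → α → Prop) (S : Finset ℤ) (hf : ∀ n, {t | P n t}.Finite) (hS : ∀ n t, P n t → n ∈ S) :
    {p : ℤ × α | P p.1 p.2}.ncard = ∑ n ∈ S, {t | P n t}.ncard := by
  classical
  have : {p : ℤ × α | P p.1 p.2} = ↑(S.biUnion (fun n => (hf n).toFinset.image (fun t => (n, t)))) := by
    ext ⟨n, t⟩
    simp only [Set.mem_ofPred_eq, Finset.coe_biUnion, Finset.coe_image, Set.Finite.coe_toFinset, Set.mem_iUnion, Set.mem_image, Prod.mk.injEq, Finset.mem_coe]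
    constructor
    · intro h; exact ⟨n, hS n t h, t, h, rfl, rfl⟩
    · rintro ⟨m, _, s, hs, rfl, rfl⟩; exact hs
  rw [this, Set.ncard_coe_finset, Finset.card_biUnion]
  · apply Finset.sum_congr rfl
    intro n _
    rw [Finset.card_image_of_injective _ (fun a b h => by simpa using h), Set.ncard_eq_toFinset_card _ (hf n)]
  · intro n _ m _ hnm
    rw [Function.onFun, Finset.disjoint_left]
    intro p hp hq
    simp only [Finset.mem_image] at hp hq
    obtain ⟨t, _, rfl⟩ := hp
    obtain ⟨s, _, h⟩ := hq
    exact hnm (by have := congrArg Prod.fst h; exact this.symm)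

lemma robin_sum {σ : ℝ} (hσ : 0 < σ) (μ : ℝ) (M : ℕ) (hM : μ ≤ M) :
    diskRobinCountMu σ μ = ∑ n ∈ Finset.Icc (-(M:ℤ)) M, NZ σ n.natAbs μ := by
  rw [diskRobinCountMu]
  exact fib_count (fun n t => 0 < t ∧ t ≤ μ ∧ phiRobin σ n.natAbs t = 0) _ (fun n => NZ_fin hσ n.natAbs μ) (fun n t ⟨h1, h2, h3⟩ => by
    rw [Finset.mem_Icc]
    by_contra hc
    have : M ≤ n.natAbs := by omega
    have h4 : (M:ℝ) ≤ n.natAbs := by exact_mod_cast this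
    exact (phi_pos hσ n.natAbs h1 (by linarith)).ne' h3)

lemma gfun_neg (y : ℝ) : gfun (-y) = gfun y + y := by
  have := Real.pi_pos
  rw [gfun, gfun, Real.arccos_neg]
  have : (-y)^2 = y^2 := by ring
  rw [this]
  field_simp; ring

lemma gfun_thn {n : ℕ} {x : ℝ} (hx : 0 < x) : x * gfun ((n:ℝ)/x) = thn n x / π := by
  have := Real.pi_pos
  rw [gfun, thn, sqn]
  have : x^2 - (n:ℝ)^2 = x^2 * (1 - ((n:ℝ)/x)^2) := by field_simp
  rw [this, Real.sqrt_mul (by positivity), Real.sqrt_sq hx.le]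
  field_simp

lemma lat_fib {μ : ℝ} (hμ : 0 < μ) (n k : ℤ) :
    (1 ≤ k ∧ ((n:ℝ), (k:ℝ) + max 0 (-(n:ℝ)) - 3/4) ∈ μ • domD) ↔ (1 ≤ k ∧ k ≤ Gn n.natAbs μ) := by
  have hpi := Real.pi_pos
  apply and_congr_right
  intro hk
  have hk' : (1:ℝ) ≤ k := by exact_mod_cast hk
  rw [Set.mem_smul_set_iff_inv_smul_mem₀ hμ.ne']
  simp only [domD, Set.mem_ofPred_eq, Prod.smul_mk, smul_eq_mul]
  rw [inv_mul_eq_div, inv_mul_eq_div]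
  rcases lt_or_ge μ (n.natAbs:ℝ) with hlt | hle
  · rw [Gn_zero hμ hlt.le]
    constructor
    · rintro ⟨h1, h2, -⟩
      rw [le_div_iff₀ hμ] at h1
      rw [div_le_iff₀ hμ] at h2
      have : (n.natAbs:ℝ) = |(n:ℝ)| := by rw [Nat.cast_natAbs, Int.cast_abs]
      rw [this] at hlt
      have := abs_le.2 ⟨(by linarith : -μ ≤ (n:ℝ)), (by linarith : (n:ℝ) ≤ μ)⟩
      linarith
    · intro h; omega
  · have habs : (n.natAbs:ℝ) = |(n:ℝ)| := by rw [Nat.cast_natAbs, Int.cast_abs]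
    have hle' := abs_le.1 (habs ▸ hle)
    have hg : μ * gfun ((n:ℝ)/μ) = thn n.natAbs μ / π + max 0 (-(n:ℝ)) := by
      rw [← gfun_thn hμ, habs]
      rcases le_total 0 (n:ℝ) with h0 | h0
      · rw [abs_of_nonneg h0, max_eq_left (by linarith)]; ring
      · rw [abs_of_nonpos h0, max_eq_right (by linarith)]
        have := gfun_neg (-(n:ℝ)/μ)
        rw [neg_div, neg_neg] at this
        rw [this]; field_simp
        try ring
    rw [Gn, Int.le_floor]
    constructor
    · rintro ⟨-, -, -, h4⟩
      rw [div_le_iff₀' hμ, hg] at h4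
      linarith
    · intro h
      refine ⟨by rw [le_div_iff₀ hμ]; linarith, by rw [div_le_iff₀ hμ]; linarith, ?_, ?_⟩
      · rw [le_div_iff₀ hμ]
        have : max 0 (-((n:ℝ)/μ)) * μ = max 0 (-(n:ℝ)) := by
          rw [max_mul_of_nonneg _ _ hμ.le]; congr 1
          · simp
          · field_simp
        rw [this]; linarith
      · rw [div_le_iff₀' hμ, hg]; linarith

lemma lat_sum {μ : ℝ} (hμ : 0 < μ) (M : ℕ) (hM : μ ≤ M) :
    (latticeCountD μ : ℤ) = ∑ n ∈ Finset.Icc (-(M:ℤ)) M, Gn n.natAbs μ := by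
  have hset : ∀ n : ℤ, {k : ℤ | 1 ≤ k ∧ ((n:ℝ), (k:ℝ) + max 0 (-(n:ℝ)) - 3/4) ∈ μ • domD} = ↑(Finset.Icc 1 (Gn n.natAbs μ)) := by
    intro n; ext k; rw [Set.mem_ofPred_eq, lat_fib hμ]; simp
  rw [latticeCountD]
  rw [fib_count (fun (n k : ℤ) => 1 ≤ k ∧ ((n:ℝ), (k:ℝ) + max 0 (-(n:ℝ)) - 3/4) ∈ μ • domD) (Finset.Icc (-(M:ℤ)) M)]
  · push_cast
    apply Finset.sum_congr rfl
    intro n _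
    rw [hset, Set.ncard_coe_finset, Int.card_Icc]
    have := Gn_nonneg (n := n.natAbs) hμ
    omega
  · intro n; rw [hset]; exact Finset.finite_toSet _
  · intro n k h
    rw [lat_fib hμ] at h
    rw [Finset.mem_Icc]
    by_contra hc
    have : M ≤ n.natAbs := by omega
    have h4 : (M:ℝ) ≤ n.natAbs := by exact_mod_cast this
    rw [Gn_zero hμ (by linarith)] at h
    omega

open Filter Topology

lemma regI {σ : ℝ} (hσ : 0 < σ) {K C u : ℝ} (hK : K = 7 + 12*σ) (hC : C = 6*K+12) (hu : C ≤ u) {n : ℕ}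
    (hn : (n:ℝ) < u^7) (hq : u^12 ≤ (u^7)^2 - (n:ℝ)^2) :
    (NZ σ n (u^7) : ℤ) ≤ Gn n (u^7 + C/u^3) ∧ Gn n (u^7 - C/u^3) ≤ (NZ σ n (u^7) : ℤ) := by
  have hpi := Real.pi_gt_three
  have hpi4 := Real.pi_lt_four
  have hn0 : (0:ℝ) ≤ n := Nat.cast_nonneg n
  have hK7 : 7 ≤ K := by linarith
  have hu1 : 54 ≤ u := by linarith
  have hu0 : 0 < u := by linarith
  have hC0 : 0 < C := by linarith
  have hs := sqn_pos hn
  have hs2 := sqn_sq hn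
  have hs6 : u^6 ≤ sqn n (u^7) := by
    apply le_of_pow_le_pow_left₀ two_ne_zero hs.le
    rw [hs2]; calc (u^6)^2 = u^12 := by ring
      _ ≤ _ := hq
  have hs3 : u^18 ≤ sqn n (u^7)^3 := by
    calc u^18 = (u^6)^3 := by ring
      _ ≤ _ := by gcongr
  have hs4 : u^24 ≤ sqn n (u^7)^4 := by
    calc u^24 = (u^6)^4 := by ring
      _ ≤ _ := by gcongr
  have hben : K * ben n (u^7) ≤ 1/2 := by
    rw [ben, mul_div_assoc', div_le_iff₀ (by positivity)]
    have h1 : K ≤ u := by linarith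
    have h2 : (u^7)^2 * u ≤ u^18 := by
      calc (u^7)^2 * u = u^15 := by ring
        _ ≤ u^18 := pow_le_pow_right₀ (by linarith) (by norm_num)
    have h3 : K * (u^7)^2 ≤ u * (u^7)^2 := by gcongr
    have h4 := pow_pos hs 3
    linarith
  -- the increment
  have hinc : K * ben n (u^7) * π ≤ C/u^3 * ((sqn n (u^7)/2) / u^7) := by
    have e1 : K * ben n (u^7) * π = K * π * u^14 / (4 * sqn n (u^7)^3) := by rw [ben]; field_simp
    have e2 : C/u^3 * ((sqn n (u^7)/2) / u^7) = C * sqn n (u^7) / (2 * u^10) := by field_simp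
    rw [e1, e2, div_le_div_iff₀ (by positivity) (by positivity)]
    have : K * π ≤ C := by nlinarith
    calc K * π * u^14 * (2 * u^10) = K * π * 2 * u^24 := by ring
      _ ≤ C * 2 * sqn n (u^7)^4 := by gcongr
      _ ≤ C * sqn n (u^7) * (4 * sqn n (u^7)^3) := by nlinarith [pow_pos hs 4, mul_pos hC0 (pow_pos hs 4)]
  have hCu : C/u^3 ≤ u^7/2 := by
    rw [div_le_iff₀ (by positivity)]
    have h1 : u * 54 ≤ u^7/2*u^3 := by
      have : u * 54^9 ≤ u * u^9 := by gcongr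
      have e : u^7/2*u^3 = u * u^9 / 2 := by ring
      rw [e]; linarith
    linarith
  have hCu0 : 0 < C/u^3 := by positivity
  obtain ⟨e, he, heq⟩ := key_count hσ n (u^7) hn (by rw [← hK]; exact hben)
  rw [← hK] at he
  have he' := abs_le.1 he
  rw [heq, Gn, Gn]
  constructor
  · apply Int.floor_le_floor
    have h1 := thn_incr hn (show u^7 ≤ u^7 + C/u^3 by linarith)
    rw [add_sub_cancel_left] at h1
    have h2 : C/u^3 * ((sqn n (u^7)/2) / u^7) ≤ C/u^3 * (sqn n (u^7) / (u^7 + C/u^3)) := by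
      rw [div_div]
      gcongr
      linarith
    have h3 : thn n (u^7) / π + K * ben n (u^7) ≤ thn n (u^7 + C/u^3) / π := by
      rw [le_div_iff₀ Real.pi_pos, add_mul, div_mul_cancel₀ _ Real.pi_pos.ne']
      linarith
    linarith
  · apply Int.floor_le_floor
    have hm0 : 0 < u^7 - C/u^3 := by have : 0 < u^7 := by positivity
                                     linarith
    have hq4 : (sqn n (u^7)/2)^2 ≤ (u^7 - C/u^3)^2 - (n:ℝ)^2 := by
      have e1 : (u^7 - C/u^3)^2 = (u^7)^2 - 2*C*u^4 + (C/u^3)^2 := by field_simp; ring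
      have h1 : 2*C*u^4 ≤ 3/4*u^12 := by
        have : 54^7 * u^5 ≤ u^7 * u^5 := by gcongr
        have h2 : C * u^4 ≤ u * u^4 := by gcongr
        nlinarith [pow_pos hu0 5]
      rw [e1, div_pow, hs2]
      nlinarith [sq_nonneg (C/u^3)]
    have hnm : (n:ℝ) < u^7 - C/u^3 := by
      apply lt_of_pow_lt_pow_left₀ 2 hm0.le
      have : 0 < (sqn n (u^7)/2)^2 := by positivity
      linarith
    have hsm : sqn n (u^7)/2 ≤ sqn n (u^7 - C/u^3) := by
      rw [sqn.eq_1 n (u^7 - C/u^3)]; exact Real.le_sqrt_of_sq_le hq4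
    have h1 := thn_incr hnm (show u^7 - C/u^3 ≤ u^7 by linarith)
    rw [sub_sub_cancel] at h1
    have h2 : C/u^3 * ((sqn n (u^7)/2) / u^7) ≤ C/u^3 * (sqn n (u^7 - C/u^3) / u^7) := by
      gcongr
    have h3 : thn n (u^7 - C/u^3) / π + K * ben n (u^7) ≤ thn n (u^7) / π := by
      rw [le_div_iff₀ Real.pi_pos, add_mul, div_mul_cancel₀ _ Real.pi_pos.ne']
      linarith
    linarith

/-- region IIa -/
lemma regIIa {σ : ℝ} (hσ : 0 < σ) {K C u : ℝ} (hK : K = 7 + 12*σ) (hC : C = 6*K+12) (hu : C ≤ u) {n : ℕ}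
    (hn : (n:ℝ) < u^7) (hq : u^11 ≤ (u^7)^2 - (n:ℝ)^2) (hne : (NZ σ n (u^7) : ℤ) ≠ Gn n (u^7)) :
    K * ben n (u^7) ≤ 1/2 ∧
    |thn n (u^7) / π + 3/4 - (max (NZ σ n (u^7) : ℤ) (Gn n (u^7)) : ℤ)| ≤ K * ben n (u^7) := by
  have hn0 : (0:ℝ) ≤ n := Nat.cast_nonneg n
  have hK7 : 7 ≤ K := by linarith
  have hu1 : 54 ≤ u := by linarith
  have hu0 : 0 < u := by linarith
  have hs := sqn_pos hn
  have hs2 := sqn_sq hn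
  have hs3 : u^16 ≤ sqn n (u^7)^3 := by
    apply le_of_pow_le_pow_left₀ two_ne_zero (by positivity)
    calc (u^16)^2 = u^32 := by ring
      _ ≤ u^33 := pow_le_pow_right₀ (by linarith) (by norm_num)
      _ = (u^11)^3 := by ring
      _ ≤ (sqn n (u^7)^2)^3 := by rw [hs2]; gcongr
      _ = _ := by ring
  have hben : K * ben n (u^7) ≤ 1/2 := by
    rw [ben, mul_div_assoc', div_le_iff₀ (by positivity)]
    have h1 : K ≤ u := by linarith
    have h2 : (u^7)^2 * u ≤ u^16 := by
      calc (u^7)^2 * u = u^15 := by ring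
        _ ≤ u^16 := pow_le_pow_right₀ (by linarith) (by norm_num)
    have h3 : K * (u^7)^2 ≤ u * (u^7)^2 := by gcongr
    have h4 := pow_pos hs 3
    linarith
  refine ⟨hben, ?_⟩
  obtain ⟨e, he, heq⟩ := key_count hσ n (u^7) hn (by rw [← hK]; exact hben)
  rw [← hK] at he
  have he' := abs_le.1 he
  have h1 := Int.floor_le (thn n (u^7) / π + 3/4 + e)
  have h2 := Int.lt_floor_add_one (thn n (u^7) / π + 3/4 + e)
  have h3 := Int.floor_le (thn n (u^7) / π + 3/4)
  have h4 := Int.lt_floor_add_one (thn n (u^7) / π + 3/4)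
  rw [← heq] at h1 h2
  change (Gn n (u^7) : ℝ) ≤ _ at h3
  change _ < (Gn n (u^7) : ℝ) + 1 at h4
  rw [abs_le]
  rcases lt_or_gt_of_ne hne with h | h
  · rw [max_eq_right h.le]
    have h5 : ((NZ σ n (u^7) : ℤ):ℝ) + 1 ≤ (Gn n (u^7) : ℝ) := by exact_mod_cast h
    constructor <;> linarith
  · rw [max_eq_left h.le]
    have h5 : (Gn n (u^7) : ℝ) + 1 ≤ ((NZ σ n (u^7) : ℤ):ℝ) := by exact_mod_cast h
    constructor <;> linarith

lemma bad_set {σ : ℝ} (hσ : 0 < σ) {K C u : ℝ} (hK : K = 7 + 12*σ) (hC : C = 6*K+12) (hu : C ≤ u) :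
    ∃ Bad : Finset ℕ, (Bad.card : ℝ) ≤ 3 * u^4 ∧ ∀ n : ℕ, n ∉ Bad →
      (NZ σ n (u^7) : ℤ) ≤ Gn n (u^7 + C/u^3) ∧ Gn n (u^7 - C/u^3) ≤ (NZ σ n (u^7) : ℤ) := by
  classical
  have hpi := Real.pi_gt_three
  have hpi4 := Real.pi_lt_four
  have hK7 : 7 ≤ K := by linarith
  have hu1 : 54 ≤ u := by linarith
  have hu0 : 0 < u := by linarith
  have hC0 : 0 < C := by linarith
  have hCu0 : 0 < C/u^3 := by positivity
  have hCu : C/u^3 ≤ u^7/2 := by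
    rw [div_le_iff₀ (by positivity)]
    have h1 : u * 54 ≤ u^7/2*u^3 := by
      have : u * 54^9 ≤ u * u^9 := by gcongr
      have e : u^7/2*u^3 = u * u^9 / 2 := by ring
      rw [e]; linarith
    linarith
  have hu7 : 0 < u^7 := by positivity
  set Bb := (Finset.Ico ⌈u^7 - u^4⌉₊ ⌈u^7⌉₊) with hBb
  set Ba := (Finset.range ⌈u^7⌉₊).filter (fun n : ℕ => (n:ℝ) < u^7 ∧ u^11 ≤ (u^7)^2 - (n:ℝ)^2 ∧ (u^7)^2 - (n:ℝ)^2 < u^12 ∧ (NZ σ n (u^7) : ℤ) ≠ Gn n (u^7)) with hBa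
  have hBbc : (Bb.card:ℝ) ≤ u^4 + 1 := by
    rw [hBb, Nat.card_Ico]
    have h1 : ⌈u^7 - u^4⌉₊ ≤ ⌈u^7⌉₊ := Nat.ceil_mono (by have : 0 < u^4 := by positivity
                                                         linarith)
    rw [Nat.cast_sub h1]
    have h2 := Nat.ceil_lt_add_one hu7.le
    have h3 := Nat.le_ceil (u^7 - u^4)
    linarith
  have hBac : (Ba.card:ℝ) ≤ u^4 + 3 := by
    have h1 : Ba.card ≤ (Finset.Icc (0:ℤ) ⌊u^4 + 2⌋).card := by
      apply Finset.card_le_card_of_injOn (fun n => max (NZ σ n (u^7) : ℤ) (Gn n (u^7)))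
      · intro n hn
        simp only [hBa, Finset.coe_filter, Set.mem_ofPred_eq] at hn
        obtain ⟨-, hn1, hn2, hn3, hn4⟩ := hn
        obtain ⟨a1, a2⟩ := regIIa hσ hK hC hu hn1 hn2 hn4
        have a3 := abs_le.1 (a2.trans a1)
        have hs := sqn_pos hn1
        have hs6 : sqn n (u^7) ≤ u^6 := by
          apply le_of_pow_le_pow_left₀ two_ne_zero (by positivity)
          rw [sqn_sq hn1]; refine hn3.le.trans (le_of_eq (by ring))
        have b1 : thn n (u^7) / π ≤ u^4 := by
          rw [div_le_iff₀ Real.pi_pos]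
          refine (thn_le hn1).trans ?_
          rw [div_le_iff₀ (by positivity)]
          calc sqn n (u^7)^3 ≤ (u^6)^3 := by gcongr
            _ = u^4 * 1 * (u^7)^2 := by ring
            _ ≤ u^4 * π * (u^7)^2 := by gcongr; linarith
        simp only [Finset.coe_Icc, Set.mem_Icc]
        refine ⟨(Int.natCast_nonneg _).trans (le_max_left _ _), Int.le_floor.2 ?_⟩
        linarith
      · -- injectivity
        have key : ∀ n ∈ Ba, ∀ m ∈ Ba, n < m → max (NZ σ n (u^7) : ℤ) (Gn n (u^7)) ≠ max (NZ σ m (u^7) : ℤ) (Gn m (u^7)) := by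
          intro n hn m hm hnm heq
          simp only [hBa, Finset.mem_filter] at hn hm
          obtain ⟨-, hn1, hn2, hn3, hn4⟩ := hn
          obtain ⟨-, hm1, hm2, hm3, hm4⟩ := hm
          have a2 := abs_le.1 (regIIa hσ hK hC hu hn1 hn2 hn4).2
          have b2 := abs_le.1 (regIIa hσ hK hC hu hm1 hm2 hm4).2
          rw [heq] at a2
          have hnm1 : (n:ℝ) + 1 ≤ m := by exact_mod_cast hnm
          have hn0 : (0:ℝ) ≤ n := Nat.cast_nonneg n
          have hs := sqn_pos hm1
          have hsn := sqn_pos hn1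
          have hss : sqn m (u^7) ≤ sqn n (u^7) := Real.sqrt_le_sqrt (by nlinarith)
          have hbb : ben n (u^7) ≤ ben m (u^7) := by
            rw [ben, ben]; gcongr
          have hd := thn_diff hnm hm1
          have h5 : sqn m (u^7) / u^7 ≤ ((m:ℝ) - n) * (sqn m (u^7) / u^7) := by
            apply le_mul_of_one_le_left (by positivity)
            linarith
          have h6 : thn n (u^7) / π - thn m (u^7) / π ≤ 2 * (K * ben m (u^7)) := by
            have : K * ben n (u^7) ≤ K * ben m (u^7) := by gcongr
            linarith
          rw [← sub_div, div_le_iff₀ Real.pi_pos] at h6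
          have h7 : sqn m (u^7) / u^7 ≤ 2 * (K * ben m (u^7)) * π := by linarith
          have e1 : 2 * (K * ben m (u^7)) * π = K * π * u^14 / (2 * sqn m (u^7)^3) := by rw [ben]; field_simp; norm_num
          rw [e1, div_le_div_iff₀ (by positivity) (by positivity)] at h7
          have h8 : u^22 ≤ sqn m (u^7)^4 := by
            calc u^22 = (u^11)^2 := by ring
              _ ≤ (sqn m (u^7)^2)^2 := by rw [sqn_sq hm1]; gcongr
              _ = _ := by ring
          have h9 : K * π < 2 * u := by nlinarith
          have h10 : K * π * u^21 < 2 * u * u^21 := by gcongr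
          nlinarith
        intro n hn m hm heq
        simp only at heq
        rcases lt_trichotomy n m with h | h | h
        · exact absurd heq (key n hn m hm h)
        · exact h
        · exact absurd heq.symm (key m hm n hn h)
    rw [Int.card_Icc] at h1
    have h2 := Int.floor_nonneg.2 (show 0 ≤ u^4 + 2 by positivity)
    have h3 : (Ba.card : ℤ) ≤ ⌊u^4 + 2⌋ + 1 - 0 := by omega
    have h4 : ((Ba.card : ℤ):ℝ) ≤ ((⌊u^4 + 2⌋ + 1 - 0 : ℤ):ℝ) := by exact_mod_cast h3
    push_cast at h4
    have := Int.floor_le (u^4+2)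
    linarith
  refine ⟨Bb ∪ Ba, ?_, ?_⟩
  · have h1 : ((Bb ∪ Ba).card : ℝ) ≤ Bb.card + Ba.card := by exact_mod_cast Finset.card_union_le _ _
    have : (54:ℝ)^4 ≤ u^4 := by gcongr
    linarith
  · intro n hn
    rw [Finset.mem_union, not_or] at hn
    obtain ⟨hnb, hna⟩ := hn
    rcases le_or_gt (u^7) n with h | h
    · rw [NZ_zero hσ h]
      refine ⟨Gn_nonneg (by linarith), ?_⟩
      rw [Gn_zero (by linarith) (by linarith)]; simp
    · rcases le_or_gt (u^12) ((u^7)^2 - (n:ℝ)^2) with hq | hq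
      · exact regI hσ hK hC hu h hq
      · have hn0 : (0:ℝ) ≤ n := Nat.cast_nonneg n
        have h1 : (n:ℝ) < u^7 - u^4 := by
          by_contra hc
          push Not at hc
          apply hnb
          rw [hBb, Finset.mem_Ico]
          exact ⟨Nat.ceil_le.2 hc, Nat.lt_ceil.2 h⟩
        have h2 : u^11 ≤ (u^7)^2 - (n:ℝ)^2 := by
          have h3 : (n:ℝ)^2 ≤ (u^7 - u^4)^2 := by gcongr
          have h4 : u^8 ≤ u^11 := pow_le_pow_right₀ (by linarith) (by norm_num)
          nlinarith
        have h3 : (NZ σ n (u^7) : ℤ) = Gn n (u^7) := by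
          by_contra hc
          apply hna
          rw [hBa, Finset.mem_filter, Finset.mem_range]
          exact ⟨Nat.lt_ceil.2 h, h, h2, hq, hc⟩
        rw [h3]
        exact ⟨Gn_mono hu7 (by linarith), Gn_mono (by linarith) (by linarith)⟩

lemma sum_bad (S : Finset ℤ) (Bad : Finset ℕ) (B : ℝ) (hB : 0 ≤ B) (f : ℤ → ℝ) (h1 : ∀ n : ℤ, n.natAbs ∉ Bad → f n ≤ 0) (h2 : ∀ n, f n ≤ B) :
    ∑ n ∈ S, f n ≤ 2 * Bad.card * B := by
  classical
  have a1 : ∑ n ∈ S, f n ≤ ∑ n ∈ S, if n.natAbs ∈ Bad then B else 0 := by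
    apply Finset.sum_le_sum
    intro n _
    split_ifs with h
    · exact h2 n
    · exact h1 n h
  refine a1.trans ?_
  rw [← Finset.sum_filter, Finset.sum_const, nsmul_eq_mul]
  have a2 : (S.filter (fun n => n.natAbs ∈ Bad)) ⊆ Bad.image (fun m : ℕ => (m:ℤ)) ∪ Bad.image (fun m : ℕ => -(m:ℤ)) := by
    intro n hn
    rw [Finset.mem_filter] at hn
    rw [Finset.mem_union, Finset.mem_image, Finset.mem_image]
    rcases le_total 0 n with h | h
    · exact Or.inl ⟨n.natAbs, hn.2, by omega⟩
    · exact Or.inr ⟨n.natAbs, hn.2, by omega⟩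
  have a3 : (S.filter (fun n => n.natAbs ∈ Bad)).card ≤ 2 * Bad.card := by
    refine (Finset.card_le_card a2).trans ((Finset.card_union_le _ _).trans ?_)
    have := Finset.card_image_le (s := Bad) (f := fun m : ℕ => (m:ℤ))
    have := Finset.card_image_le (s := Bad) (f := fun m : ℕ => -(m:ℤ))
    omega
  have a4 : ((S.filter (fun n => n.natAbs ∈ Bad)).card : ℝ) ≤ 2 * Bad.card := by exact_mod_cast a3
  gcongr

lemma final_u {σ : ℝ} (hσ : 0 < σ) {K C u : ℝ} (hK : K = 7 + 12*σ) (hC : C = 6*K+12) (hu : C ≤ u) :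
    (latticeCountD (u^7 - C/u^3) : ℝ) - C * u^4 ≤ (diskRobinCountMu σ (u^7) : ℝ) ∧
    (diskRobinCountMu σ (u^7) : ℝ) ≤ (latticeCountD (u^7 + C/u^3) : ℝ) + C * u^4 := by
  have hK7 : 7 ≤ K := by linarith
  have hu1 : 54 ≤ u := by linarith
  have hu0 : 0 < u := by linarith
  have hC0 : 0 < C := by linarith
  have hCu0 : 0 < C/u^3 := by positivity
  have hCu : C/u^3 ≤ u^7/2 := by
    rw [div_le_iff₀ (by positivity)]
    have h1 : u * 54 ≤ u^7/2*u^3 := by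
      have : u * 54^9 ≤ u * u^9 := by gcongr
      have e : u^7/2*u^3 = u * u^9 / 2 := by ring
      rw [e]; linarith
    linarith
  have hu7 : 0 < u^7 := by positivity
  obtain ⟨Bad, hcard, hgood⟩ := bad_set hσ hK hC hu
  obtain ⟨M, hM⟩ := exists_nat_ge (2 * u^7)
  have s1 : (diskRobinCountMu σ (u^7) : ℝ) = ∑ n ∈ Finset.Icc (-(M:ℤ)) M, ((NZ σ n.natAbs (u^7) : ℤ):ℝ) := by
    rw [robin_sum hσ (u^7) M (by linarith)]; push_cast; rfl
  have s2 : ∀ x : ℝ, 0 < x → x ≤ M → (latticeCountD x : ℝ) = ∑ n ∈ Finset.Icc (-(M:ℤ)) M, (Gn n.natAbs x : ℝ) := by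
    intro x hx hxM
    have := lat_sum hx M hxM
    have : ((latticeCountD x : ℤ):ℝ) = ((∑ n ∈ Finset.Icc (-(M:ℤ)) M, Gn n.natAbs x : ℤ):ℝ) := by rw [this]
    push_cast at this
    exact this
  have hcl : ∀ n : ℕ, |((NZ σ n (u^7) : ℤ):ℝ) - Gn n (u^7)| ≤ K + 2 := by
    intro n
    rcases le_or_gt (u^7) n with h | h
    · rw [NZ_zero hσ h, Gn_zero hu7 h]; simp; linarith
    · rw [hK]; exact NZ_Gn_close hσ h
  have hfin : 2 * (Bad.card:ℝ) * (K+2) ≤ C * u^4 := by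
    have : 2 * (Bad.card:ℝ) * (K+2) ≤ 2 * (3 * u^4) * (K+2) := by gcongr
    rw [hC]; linarith
  rw [s1, s2 _ (by linarith) (by linarith), s2 _ (by linarith) (by linarith)]
  constructor
  · have h := sum_bad (Finset.Icc (-(M:ℤ)) M) Bad (K+2) (by linarith) (fun n => (Gn n.natAbs (u^7 - C/u^3) : ℝ) - ((NZ σ n.natAbs (u^7) : ℤ):ℝ))
      (fun n hn => by
        have := (hgood n.natAbs hn).2
        have h' : (Gn n.natAbs (u^7 - C/u^3) : ℝ) ≤ ((NZ σ n.natAbs (u^7) : ℤ):ℝ) := by exact_mod_cast this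
        linarith)
      (fun n => by
        have h1 := abs_le.1 (hcl n.natAbs)
        have h2 : (Gn n.natAbs (u^7 - C/u^3) : ℝ) ≤ Gn n.natAbs (u^7) := by exact_mod_cast Gn_mono (by linarith) (by linarith)
        linarith)
    rw [Finset.sum_sub_distrib] at h
    linarith
  · have h := sum_bad (Finset.Icc (-(M:ℤ)) M) Bad (K+2) (by linarith) (fun n => ((NZ σ n.natAbs (u^7) : ℤ):ℝ) - (Gn n.natAbs (u^7 + C/u^3) : ℝ))
      (fun n hn => by
        have := (hgood n.natAbs hn).1
        have h' : ((NZ σ n.natAbs (u^7) : ℤ):ℝ) ≤ (Gn n.natAbs (u^7 + C/u^3) : ℝ) := by exact_mod_cast this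
        linarith)
      (fun n => by
        have h1 := abs_le.1 (hcl n.natAbs)
        have h2 : (Gn n.natAbs (u^7) : ℝ) ≤ Gn n.natAbs (u^7 + C/u^3) := by exact_mod_cast Gn_mono (by linarith) (by linarith)
        linarith)
    rw [Finset.sum_sub_distrib] at h
    linarith

theorem disk_weyl_lattice_comparison (σ : ℝ) (hσ : 0 < σ) :
    ∃ C : ℝ, 0 < C ∧ ∃ μ₀ : ℝ, 0 < μ₀ ∧ ∀ μ : ℝ, μ₀ ≤ μ →
      (latticeCountD (μ - C * μ ^ (-(3:ℝ)/7)) : ℝ) - C * μ ^ ((4:ℝ)/7)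
          ≤ (diskRobinCountMu σ μ : ℝ) ∧
      (diskRobinCountMu σ μ : ℝ)
          ≤ (latticeCountD (μ + C * μ ^ (-(3:ℝ)/7)) : ℝ) + C * μ ^ ((4:ℝ)/7) := by
  obtain ⟨K, hK⟩ : ∃ K, K = 7 + 12*σ := ⟨_, rfl⟩
  obtain ⟨C, hC⟩ : ∃ C, C = 6*K+12 := ⟨_, rfl⟩
  have hC0 : 0 < C := by linarith
  refine ⟨C, hC0, C^7, by positivity, ?_⟩
  intro μ hμ
  have hμ0 : 0 < μ := lt_of_lt_of_le (by positivity) hμ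
  obtain ⟨u, hu⟩ : ∃ u, u = μ^((1:ℝ)/7) := ⟨_, rfl⟩
  have hu0 : 0 < u := by rw [hu]; exact Real.rpow_pos_of_pos hμ0 _
  have e7 : u^7 = μ := by
    rw [hu, ← Real.rpow_natCast, ← Real.rpow_mul hμ0.le]; norm_num
  have e4 : μ^((4:ℝ)/7) = u^4 := by
    rw [hu, ← Real.rpow_natCast, ← Real.rpow_mul hμ0.le]; norm_num
  have e3 : C * μ^(-(3:ℝ)/7) = C/u^3 := by
    rw [div_eq_mul_inv C, hu, ← Real.rpow_natCast, ← Real.rpow_mul hμ0.le, ← Real.rpow_neg hμ0.le]; norm_num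
  have huC : C ≤ u := by
    apply le_of_pow_le_pow_left₀ (n := 7) (by norm_num) hu0.le
    rw [e7]; exact hμ
  rw [e3, e4]
  have := final_u hσ hK hC huC
  rw [e7] at this
  exact this
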